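/- arXiv:math/0410522 — 2 statements merged into one kernel-verified Lean document; each statement's English description precedes it below -/
import Mathlib

section
/- There exists a constant c' > 0 such that limsup_{x→∞} P(x) / ( x^{1/4} · exp( c' · (log log x)^{1/4} · (log log log x)^{−3/4} ) ) > 0 (Corrádi–Kátai). -/
open Real Filter

/-- The number of integer lattice points in the closed origin-centered disc of radius `√x`. -/
noncomputable def latticeA (x : ℝ) : ℕ :=
  {p : ℤ × ℤ | (p.1 : ℝ) ^ 2 + (p.2 : ℝ) ^ 2 ≤ x}.ncard

/-- The lattice point discrepancy of the circle. -/
noncomputable def latticeP (x : ℝ) : ℝ := (latticeA x : ℝ) - Real.pi * x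

/-- The real multiquadratic field generated by the square roots of the entries of a list. -/
noncomputable def sqrtField : List ℕ → Subfield ℝ
  | [] => (Rat.castHom ℝ).fieldRange
  | p :: l =>
    { carrier := {x | ∃ a ∈ sqrtField l, ∃ b ∈ sqrtField l, x = a + b * √(p : ℝ)}
      mul_mem' := by
        rintro _ _ ⟨a, ha, b, hb, rfl⟩ ⟨c, hc, d, hd, rfl⟩
        refine ⟨a * c + p * (b * d), ?_, a * d + b * c, ?_, ?_⟩
        · exact add_mem (mul_mem ha hc) (mul_mem (natCast_mem _ p) (mul_mem hb hd))
        · exact add_mem (mul_mem ha hd) (mul_mem hb hc)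
        · have h : √(p : ℝ) * √(p : ℝ) = p := Real.mul_self_sqrt (Nat.cast_nonneg p)
          linear_combination b * d * h
      one_mem' := ⟨1, one_mem _, 0, zero_mem _, by simp⟩
      add_mem' := by
        rintro _ _ ⟨a, ha, b, hb, rfl⟩ ⟨c, hc, d, hd, rfl⟩
        exact ⟨a + c, add_mem ha hc, b + d, add_mem hb hd, by ring⟩
      zero_mem' := ⟨0, zero_mem _, 0, zero_mem _, by simp⟩
      neg_mem' := by
        rintro _ ⟨a, ha, b, hb, rfl⟩
        exact ⟨-a, neg_mem ha, -b, neg_mem hb, by ring⟩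
      inv_mem' := by
        rintro _ ⟨a, ha, b, hb, rfl⟩
        have h : √(p : ℝ) * √(p : ℝ) = p := Real.mul_self_sqrt (Nat.cast_nonneg p)
        have hD : a ^ 2 - p * b ^ 2 = (a + b * √(p : ℝ)) * (a - b * √(p : ℝ)) := by
          linear_combination b ^ 2 * h
        have hDm : a ^ 2 - p * b ^ 2 ∈ sqrtField l :=
          sub_mem (pow_mem ha 2) (mul_mem (natCast_mem _ p) (pow_mem hb 2))
        by_cases h1 : a + b * √(p : ℝ) = 0
        · exact ⟨0, zero_mem _, 0, zero_mem _, by rw [h1]; simp⟩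
        by_cases h2 : a - b * √(p : ℝ) = 0
        · refine ⟨(a + a)⁻¹, inv_mem (add_mem ha ha), 0, zero_mem _, ?_⟩
          rw [show b * √(p : ℝ) = a by linarith]; simp
        · have h3 : a ^ 2 - p * b ^ 2 ≠ 0 := by rw [hD]; exact mul_ne_zero h1 h2
          refine ⟨a / (a ^ 2 - p * b ^ 2), div_mem ha hDm, -b / (a ^ 2 - p * b ^ 2),
            div_mem (neg_mem hb) hDm, ?_⟩
          have h4 : a / (a ^ 2 - p * b ^ 2) + -b / (a ^ 2 - p * b ^ 2) * √(p : ℝ) =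
              (a - b * √(p : ℝ)) / (a ^ 2 - p * b ^ 2) := by ring
          rw [h4, hD, inv_eq_one_div, div_eq_div_iff h1 (mul_ne_zero h1 h2)]
          ring }

theorem sqrt_notMem_sqrtField (l : List ℕ) (hl : ∀ p ∈ l, p.Prime) (hn : l.Nodup) (d : ℕ)
    (hd : Squarefree d) (h1 : d ≠ 1) (hc : ∀ p ∈ l, ¬ p ∣ d) : √(d : ℝ) ∉ sqrtField l := by
  induction l generalizing d with
  | nil =>
    intro h
    have hirr : Irrational √(d : ℝ) := by
      rw [irrational_sqrt_natCast_iff]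
      rintro ⟨r, rfl⟩
      exact h1 (by simpa using Nat.isUnit_iff.1 (hd r dvd_rfl))
    obtain ⟨q, hq⟩ := h
    exact hirr ⟨q, hq⟩
  | cons p l ih =>
    rw [List.nodup_cons] at hn
    have hp := hl p (by simp)
    have hpl : √(p : ℝ) ∉ sqrtField l := by
      refine ih (fun q hq => hl q (by simp [hq])) hn.2 p hp.prime.squarefree hp.ne_one ?_
      intro q hq hqp
      rw [(Nat.prime_dvd_prime_iff_eq (hl q (by simp [hq])) hp).1 hqp] at hq
      exact hn.1 hq
    rintro ⟨a, ha, b, hb, hab⟩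
    have hpp : √(p : ℝ) * √(p : ℝ) = p := Real.mul_self_sqrt (Nat.cast_nonneg p)
    have hdd : √(d : ℝ) * √(d : ℝ) = d := Real.mul_self_sqrt (Nat.cast_nonneg d)
    have key : 2 * a * b * √(p : ℝ) = d - a ^ 2 - p * b ^ 2 := by
      rw [hab] at hdd
      linear_combination hdd - b ^ 2 * hpp
    by_cases hb0 : b = 0
    · refine ih (fun q hq => hl q (by simp [hq])) hn.2 d hd h1 (fun q hq => hc q (by simp [hq])) ?_
      rw [hab, hb0]; simpa using ha
    by_cases ha0 : a = 0
    · have hpd : Nat.Coprime p d := (Nat.Prime.coprime_iff_not_dvd hp).2 (hc p (by simp))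
      refine ih (fun q hq => hl q (by simp [hq])) hn.2 (p * d)
        ((Nat.squarefree_mul hpd).2 ⟨hp.prime.squarefree, hd⟩) ?_ ?_ ?_
      · intro h; exact hp.ne_one (Nat.eq_one_of_mul_eq_one_right h)
      · intro q hq hqd
        have hqp := hl q (by simp [hq])
        rcases (Nat.Prime.dvd_mul hqp).1 hqd with h | h
        · rw [(Nat.prime_dvd_prime_iff_eq hqp hp).1 h] at hq
          exact hn.1 hq
        · exact hc q (by simp [hq]) h
      · rw [Nat.cast_mul, Real.sqrt_mul (Nat.cast_nonneg p), hab, ha0]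
        have : √(p : ℝ) * (0 + b * √(p : ℝ)) = p * b := by linear_combination b * hpp
        rw [this]
        exact mul_mem (natCast_mem _ p) hb
    · apply hpl
      have : √(p : ℝ) = (d - a ^ 2 - p * b ^ 2) / (2 * a * b) := by
        rw [eq_div_iff (by simp [ha0, hb0]), ← key]; ring
      rw [this]
      refine div_mem (sub_mem (sub_mem (natCast_mem _ d) (pow_mem ha 2))
        (mul_mem (natCast_mem _ p) (pow_mem hb 2))) (mul_mem (mul_mem (ofNat_mem _ 2) ha) hb)

theorem sqrt_head_notMem_sqrtField {p : ℕ} {l : List ℕ} (hl : ∀ q ∈ p :: l, q.Prime)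
    (hn : (p :: l).Nodup) : √(p : ℝ) ∉ sqrtField l := by
  rw [List.nodup_cons] at hn
  have hp := hl p (by simp)
  refine sqrt_notMem_sqrtField l (fun q hq => hl q (by simp [hq])) hn.2 p hp.prime.squarefree
    hp.ne_one ?_
  intro q hq hqp
  rw [(Nat.prime_dvd_prime_iff_eq (hl q (by simp [hq])) hp).1 hqp] at hq
  exact hn.1 hq

/-- If `a + b √p = 0` with `a, b` in a field not containing `√p`, then `a = b = 0`. -/
theorem eq_zero_of_add_mul_sqrt {K : Subfield ℝ} {r a b : ℝ} (hr : r ∉ K) (ha : a ∈ K)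
    (hb : b ∈ K) (h : a + b * r = 0) : a = 0 ∧ b = 0 := by
  by_cases hb0 : b = 0
  · subst hb0; simpa using h
  · exfalso
    apply hr
    rw [show r = -a / b by rw [eq_div_iff hb0]; linarith]
    exact div_mem (neg_mem ha) hb

/-- `SqrtRep l x H`: `x` is an integral combination of square roots of products of distinct
entries of `l`, and the same combination with absolute values of the coefficients is at most `H`. -/
def SqrtRep : List ℕ → ℝ → ℝ → Prop
  | [], x, H => ∃ k : ℤ, x = k ∧ |x| ≤ H
  | p :: l, x, H => ∃ a b A B : ℝ, SqrtRep l a A ∧ SqrtRep l b B ∧ x = a + b * √(p : ℝ) ∧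
      A + B * √(p : ℝ) ≤ H

namespace SqrtRep

theorem abs_le {l : List ℕ} {x H : ℝ} (h : SqrtRep l x H) : |x| ≤ H := by
  induction l generalizing x H with
  | nil => obtain ⟨k, -, h⟩ := h; exact h
  | cons p l ih =>
    obtain ⟨a, b, A, B, ha, hb, rfl, hH⟩ := h
    refine (abs_add_le _ _).trans (le_trans ?_ hH)
    rw [abs_mul, abs_of_nonneg (Real.sqrt_nonneg (p : ℝ))]
    gcongr
    · exact ih ha
    · exact ih hb

theorem nonneg {l : List ℕ} {x H : ℝ} (h : SqrtRep l x H) : 0 ≤ H := (abs_nonneg x).trans h.abs_le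

theorem mono {l : List ℕ} {x H H' : ℝ} (h : SqrtRep l x H) (hH : H ≤ H') : SqrtRep l x H' := by
  cases l with
  | nil => obtain ⟨k, h1, h⟩ := h; exact ⟨k, h1, h.trans hH⟩
  | cons p l =>
    obtain ⟨a, b, A, B, ha, hb, hx, h⟩ := h
    exact ⟨a, b, A, B, ha, hb, hx, h.trans hH⟩

theorem intCast (l : List ℕ) (k : ℤ) : SqrtRep l k |(k : ℝ)| := by
  induction l generalizing k with
  | nil => exact ⟨k, rfl, le_rfl⟩
  | cons p l ih => exact ⟨k, (0 : ℤ), |(k : ℝ)|, |((0 : ℤ) : ℝ)|, ih k, ih 0, by simp, by simp⟩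

theorem add {l : List ℕ} {x y H H' : ℝ} (hx : SqrtRep l x H) (hy : SqrtRep l y H') :
    SqrtRep l (x + y) (H + H') := by
  induction l generalizing x y H H' with
  | nil =>
    obtain ⟨k, rfl, h1⟩ := hx
    obtain ⟨k', rfl, h2⟩ := hy
    exact ⟨k + k', by push_cast; ring, (abs_add_le _ _).trans (add_le_add h1 h2)⟩
  | cons p l ih =>
    obtain ⟨a, b, A, B, ha, hb, rfl, h1⟩ := hx
    obtain ⟨c, d, C, D, hc, hd, rfl, h2⟩ := hy
    exact ⟨a + c, b + d, A + C, B + D, ih ha hc, ih hb hd, by ring, by linarith⟩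

theorem mul {l : List ℕ} {x y H H' : ℝ} (hx : SqrtRep l x H) (hy : SqrtRep l y H') :
    SqrtRep l (x * y) (H * H') := by
  induction l generalizing x y H H' with
  | nil =>
    obtain ⟨k, rfl, h1⟩ := hx
    obtain ⟨k', rfl, h2⟩ := hy
    refine ⟨k * k', by push_cast; ring, ?_⟩
    rw [abs_mul]
    exact mul_le_mul h1 h2 (abs_nonneg _) ((abs_nonneg _).trans h1)
  | cons p l ih =>
    obtain ⟨a, b, A, B, ha, hb, rfl, h1⟩ := hx
    obtain ⟨c, d, C, D, hc, hd, rfl, h2⟩ := hy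
    have hpp : √(p : ℝ) * √(p : ℝ) = p := Real.mul_self_sqrt (Nat.cast_nonneg p)
    have hp : SqrtRep l (p : ℝ) (p : ℝ) := by simpa using intCast l (p : ℤ)
    refine ⟨_, _, _, _, (ih ha hc).add (ih hp (ih hb hd)), (ih ha hd).add (ih hb hc), ?_, ?_⟩
    · linear_combination b * d * hpp
    · have hA := ha.nonneg
      have hB := hb.nonneg
      have hC := hc.nonneg
      have hD := hd.nonneg
      have : (A + B * √(p : ℝ)) * (C + D * √(p : ℝ)) ≤ H * H' :=
        mul_le_mul h1 h2 (by positivity) (le_trans (by positivity) h1)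
      linear_combination this - B * D * hpp

theorem neg {l : List ℕ} {x H : ℝ} (hx : SqrtRep l x H) : SqrtRep l (-x) H := by
  have := (intCast l (-1)).mul hx
  simpa using this

theorem mem_sqrtField {l : List ℕ} {x H : ℝ} (hx : SqrtRep l x H) : x ∈ sqrtField l := by
  induction l generalizing x H with
  | nil => obtain ⟨k, rfl, -⟩ := hx; exact intCast_mem _ k
  | cons p l ih =>
    obtain ⟨a, b, A, B, ha, hb, rfl, -⟩ := hx
    exact ⟨a, ih ha, b, ih hb, rfl⟩

/-- A Liouville type lower bound. -/
theorem one_le_abs_mul_pow {l : List ℕ} (hl : ∀ p ∈ l, p.Prime) (hn : l.Nodup) {x H : ℝ}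
    (hx : SqrtRep l x H) (h0 : x ≠ 0) : 1 ≤ |x| * H ^ (2 ^ l.length - 1) := by
  induction l generalizing x H with
  | nil =>
    obtain ⟨k, rfl, -⟩ := hx
    have : k ≠ 0 := by rintro rfl; simp at h0
    simpa using (by exact_mod_cast Int.one_le_abs this : (1 : ℝ) ≤ |(k : ℝ)|)
  | cons p l ih =>
    have hH := hx.nonneg
    obtain ⟨a, b, A, B, ha, hb, rfl, h1⟩ := hx
    have hpp : √(p : ℝ) * √(p : ℝ) = p := Real.mul_self_sqrt (Nat.cast_nonneg p)
    have hp : SqrtRep l (p : ℝ) (p : ℝ) := by simpa using intCast l (p : ℤ)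
    have hA := ha.nonneg
    have hB := hb.nonneg
    have hrep : SqrtRep l ((a + b * √(p : ℝ)) * (a - b * √(p : ℝ))) (H ^ 2) := by
      have := (ha.mul ha).add (hp.mul (hb.mul hb)).neg
      rw [show (a + b * √(p : ℝ)) * (a - b * √(p : ℝ)) = a * a + -(p * (b * b)) by
        linear_combination - b ^ 2 * hpp]
      refine this.mono ?_
      have h2 : (A + B * √(p : ℝ)) ^ 2 ≤ H ^ 2 := pow_le_pow_left₀ (by positivity) h1 2
      have h3 : 0 ≤ A * B * √(p : ℝ) := by positivity
      linear_combination h2 + 2 * h3 - B ^ 2 * hpp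
    have hne : a - b * √(p : ℝ) ≠ 0 := by
      intro h
      obtain ⟨ha0, hb0⟩ := eq_zero_of_add_mul_sqrt (sqrt_head_notMem_sqrtField hl hn)
        ha.mem_sqrtField (neg_mem hb.mem_sqrtField) (by linarith)
      rw [neg_eq_zero] at hb0
      simp [ha0, hb0] at h0
    have hcon : |a - b * √(p : ℝ)| ≤ H := by
      refine (abs_sub _ _).trans (le_trans ?_ h1)
      rw [abs_mul, abs_of_nonneg (Real.sqrt_nonneg (p : ℝ))]
      gcongr
      · exact ha.abs_le
      · exact hb.abs_le
    have := ih (fun q hq => hl q (by simp [hq])) (List.nodup_cons.1 hn).2 hrep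
      (mul_ne_zero h0 hne)
    refine this.trans ?_
    rw [abs_mul, mul_assoc, List.length_cons]
    refine mul_le_mul_of_nonneg_left ?_ (abs_nonneg _)
    have he : 2 ^ (l.length + 1) - 1 = 1 + 2 * (2 ^ l.length - 1) := by
      have := Nat.one_le_two_pow (n := l.length)
      rw [pow_succ]; omega
    rw [he, pow_add, pow_one, pow_mul]
    gcongr

theorem sum {ι : Type*} {l : List ℕ} (s : Finset ι) (f F : ι → ℝ)
    (h : ∀ i ∈ s, SqrtRep l (f i) (F i)) : SqrtRep l (∑ i ∈ s, f i) (∑ i ∈ s, F i) := by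
  classical
  induction s using Finset.induction_on with
  | empty => simpa using intCast l 0
  | insert a s ha ih =>
    rw [Finset.sum_insert ha, Finset.sum_insert ha]
    exact (h a (by simp)).add (ih fun i hi => h i (by simp [hi]))

theorem sqrt_prod {l : List ℕ} (hn : l.Nodup) (t : Finset ℕ) (ht : t ⊆ l.toFinset) :
    SqrtRep l √((∏ p ∈ t, p : ℕ) : ℝ) √((∏ p ∈ t, p : ℕ) : ℝ) := by
  induction l generalizing t with
  | nil =>
    have : t = ∅ := by simpa using ht
    subst this
    exact ⟨1, by simp, by simp⟩
  | cons p l ih =>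
    rw [List.nodup_cons] at hn
    have h0 : SqrtRep l 0 0 := by simpa using intCast l 0
    by_cases hp : p ∈ t
    · have := ih hn.2 (t.erase p) (by
        intro q hq
        have := ht (Finset.mem_of_mem_erase hq)
        simp only [List.toFinset_cons, Finset.mem_insert] at this
        exact this.resolve_left (Finset.ne_of_mem_erase hq))
      refine ⟨0, _, 0, _, h0, this, ?_, le_of_eq ?_⟩ <;>
      · rw [← Finset.prod_erase_mul _ _ hp, Nat.cast_mul, Real.sqrt_mul (Nat.cast_nonneg _)]
        ring
    · refine ⟨_, 0, _, 0, ih hn.2 t ?_, h0, by simp, by simp⟩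
      intro q hq
      have := ht hq
      simp only [List.toFinset_cons, Finset.mem_insert] at this
      refine this.resolve_left ?_
      rintro rfl
      exact hp hq

end SqrtRep

/-- Linear independence over `ℚ` of the square roots of distinct products of primes. -/
theorem sqrt_prod_linearIndependent {l : List ℕ} (hl : ∀ p ∈ l, p.Prime) (hn : l.Nodup)
    (c : Finset ℕ → ℚ)
    (h : ∑ t ∈ l.toFinset.powerset, (c t : ℝ) * √((∏ p ∈ t, p : ℕ) : ℝ) = 0) :
    ∀ t ∈ l.toFinset.powerset, c t = 0 := by
  induction l generalizing c with
  | nil => simpa using h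
  | cons p l ih =>
    have hpl : p ∉ l.toFinset := by simpa using (List.nodup_cons.1 hn).1
    have hmem : ∀ c : Finset ℕ → ℚ,
        ∑ t ∈ l.toFinset.powerset, (c t : ℝ) * √((∏ p ∈ t, p : ℕ) : ℝ) ∈ sqrtField l := by
      intro c
      refine sum_mem fun t ht => mul_mem (SubfieldClass.ratCast_mem _ _)
        (SqrtRep.sqrt_prod (List.nodup_cons.1 hn).2 t (Finset.mem_powerset.1 ht)).mem_sqrtField
    rw [List.toFinset_cons, Finset.sum_powerset_insert hpl] at h
    have h2 : ∑ t ∈ l.toFinset.powerset, (c (insert p t) : ℝ) *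
        √((∏ q ∈ insert p t, q : ℕ) : ℝ) = (∑ t ∈ l.toFinset.powerset, (c (insert p t) : ℝ) *
        √((∏ q ∈ t, q : ℕ) : ℝ)) * √(p : ℝ) := by
      rw [Finset.sum_mul]
      refine Finset.sum_congr rfl fun t ht => ?_
      rw [Finset.prod_insert (fun h => hpl (Finset.mem_powerset.1 ht h)), Nat.cast_mul,
        Real.sqrt_mul (Nat.cast_nonneg _)]
      ring
    rw [h2] at h
    obtain ⟨h3, h4⟩ := eq_zero_of_add_mul_sqrt (sqrt_head_notMem_sqrtField hl hn) (hmem c)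
      (hmem fun t => c (insert p t)) h
    have hl' : ∀ q ∈ l, q.Prime := fun q hq => hl q (by simp [hq])
    have h5 := ih hl' (List.nodup_cons.1 hn).2 c h3
    have h6 := ih hl' (List.nodup_cons.1 hn).2 (fun t => c (insert p t)) h4
    intro t ht
    rw [List.toFinset_cons, Finset.mem_powerset] at ht
    by_cases hp : p ∈ t
    · have := h6 (t.erase p) (Finset.mem_powerset.2 (Finset.subset_insert_iff.1 ht))
      simpa [Finset.insert_erase hp] using this
    · exact h5 t (Finset.mem_powerset.2 ((Finset.subset_insert_iff_of_notMem hp).1 ht))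

/-- An element of a multiquadratic field with rational square is a rational multiple of the square
root of a product of distinct generators. -/
theorem exists_eq_mul_sqrt_prod {l : List ℕ} (hl : ∀ p ∈ l, p.Prime) (hn : l.Nodup) {x : ℝ}
    (hx : x ∈ sqrtField l) (r : ℚ) (hr : x ^ 2 = r) :
    ∃ t ∈ l.toFinset.powerset, ∃ y : ℚ, x = y * √((∏ p ∈ t, p : ℕ) : ℝ) := by
  induction l generalizing x r with
  | nil =>
    obtain ⟨q, rfl⟩ := hx
    exact ⟨∅, by simp, q, by simp⟩
  | cons p l ih =>
    have hpl : p ∉ l.toFinset := by simpa using (List.nodup_cons.1 hn).1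
    have hp0 : (p : ℝ) ≠ 0 := by exact_mod_cast (hl p (by simp)).ne_zero
    have hl' : ∀ q ∈ l, q.Prime := fun q hq => hl q (by simp [hq])
    obtain ⟨a, ha, b, hb, rfl⟩ := hx
    have hpp : √(p : ℝ) * √(p : ℝ) = p := Real.mul_self_sqrt (Nat.cast_nonneg p)
    obtain ⟨h1, h2⟩ := eq_zero_of_add_mul_sqrt (a := a ^ 2 + p * b ^ 2 - r) (b := 2 * a * b)
      (sqrt_head_notMem_sqrtField hl hn)
      (sub_mem (add_mem (pow_mem ha 2) (mul_mem (natCast_mem _ p) (pow_mem hb 2)))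
        (SubfieldClass.ratCast_mem _ _)) (mul_mem (mul_mem (ofNat_mem _ 2) ha) hb)
      (by linear_combination hr - b ^ 2 * hpp)
    rcases mul_eq_zero.1 h2 with h | h
    · have ha0 : a = 0 := by simpa using h
      subst ha0
      obtain ⟨t, ht, y, rfl⟩ := ih hl' (List.nodup_cons.1 hn).2 hb (r / p) (by
        push_cast
        rw [eq_div_iff hp0]; linarith)
      refine ⟨insert p t, ?_, y, ?_⟩
      · rw [Finset.mem_powerset] at ht ⊢
        rw [List.toFinset_cons]
        exact Finset.insert_subset_insert _ ht
      · rw [Finset.prod_insert (fun h => hpl (Finset.mem_powerset.1 ht h)), Nat.cast_mul,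
          Real.sqrt_mul (Nat.cast_nonneg _)]
        ring
    · subst h
      obtain ⟨t, ht, y, rfl⟩ := ih hl' (List.nodup_cons.1 hn).2 ha r (by linarith)
      refine ⟨t, ?_, y, by simp⟩
      rw [Finset.mem_powerset] at ht ⊢
      rw [List.toFinset_cons]
      exact ht.trans (Finset.subset_insert _ _)

theorem exists_single_of_sq_eq {S : Finset ℕ} (hS : ∀ p ∈ S, p.Prime) (ε : S.powerset → ℤ)
    (hε : ∀ T, |ε T| ≤ 1) (n : ℕ)
    (h : (n : ℝ) = (∑ T, ε T * √((∏ p ∈ T.1, p : ℕ) : ℝ)) ^ 2) :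
    ε = 0 ∨ ∃ T, ε = Pi.single T 1 ∨ ε = Pi.single T (-1) := by
  have hl : ∀ p ∈ S.toList, p.Prime := fun p hp => hS p (Finset.mem_toList.1 hp)
  have hn := S.nodup_toList
  have hw : ∑ T, ε T * √((∏ p ∈ T.1, p : ℕ) : ℝ) ∈ sqrtField S.toList :=
    sum_mem fun T _ => mul_mem (intCast_mem _ _) (SqrtRep.sqrt_prod hn T.1
      (by simpa using Finset.mem_powerset.1 T.2)).mem_sqrtField
  obtain ⟨t, ht, y, hy⟩ := exists_eq_mul_sqrt_prod hl hn hw n (by rw [← h]; simp)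
  rw [Finset.toList_toFinset] at ht
  have key := sqrt_prod_linearIndependent hl hn
    (fun T => (if hT : T ∈ S.powerset then (ε ⟨T, hT⟩ : ℚ) else 0) - if T = t then y else 0) (by
      simp only [Finset.toList_toFinset]
      rw [← Finset.sum_coe_sort]
      have h1 : ∀ T : S.powerset, ((((if hT : T.1 ∈ S.powerset then (ε ⟨T.1, hT⟩ : ℚ) else 0)
          - if T.1 = t then y else 0 : ℚ) : ℝ)) * √((∏ p ∈ T.1, p : ℕ) : ℝ) =
          ε T * √((∏ p ∈ T.1, p : ℕ) : ℝ) -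
          if T = ⟨t, ht⟩ then (y : ℝ) * √((∏ p ∈ t, p : ℕ) : ℝ) else 0 := by
        intro T
        by_cases hT : T = ⟨t, ht⟩
        · subst hT
          rw [dif_pos ht, if_pos rfl, if_pos rfl]
          push_cast; ring
        · have hT' : T.1 ≠ t := fun h => hT (Subtype.ext h)
          rw [dif_pos T.2, if_neg hT', if_neg hT]
          push_cast; ring
      rw [Finset.sum_congr rfl fun T _ => h1 T, Finset.sum_sub_distrib, hy]
      simp)
  rw [Finset.toList_toFinset] at key
  have h0 : ∀ T : S.powerset, T ≠ ⟨t, ht⟩ → ε T = 0 := by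
    intro T hT
    have hT' : T.1 ≠ t := fun h => hT (Subtype.ext h)
    have := key T.1 T.2
    rw [dif_pos T.2, if_neg hT', sub_zero] at this
    exact_mod_cast this
  have h2 : ε = Pi.single ⟨t, ht⟩ (ε ⟨t, ht⟩) := by
    funext T
    by_cases hT : T = ⟨t, ht⟩
    · subst hT; simp
    · rw [h0 T hT, Pi.single_eq_of_ne hT]
  have h3 := abs_le.1 (hε ⟨t, ht⟩)
  obtain h4 | h4 | h4 : ε ⟨t, ht⟩ = 0 ∨ ε ⟨t, ht⟩ = 1 ∨ ε ⟨t, ht⟩ = -1 := by omega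
  · left; rw [h2, h4]; simp
  · right; exact ⟨_, Or.inl (by rw [← h4]; exact h2)⟩
  · right; exact ⟨_, Or.inr (by rw [← h4]; exact h2)⟩

/-- Integers stay away from the squares of signed sums of the `√q`, `q ∣ ∏ S`, except for the
trivial coincidences. -/
theorem gap_sq_sum {S : Finset ℕ} (hS : ∀ p ∈ S, p.Prime) {W : ℝ}
    (hW : ∑ T : S.powerset, √((∏ p ∈ T.1, p : ℕ) : ℝ) ≤ W) (hW1 : 1 ≤ W) (ε : S.powerset → ℤ)
    (hε : ∀ T, |ε T| ≤ 1) (n : ℕ) :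
    ((3 * W ^ 2) ^ (2 ^ S.card + 1))⁻¹ * (1 + n) ≤
        |(n : ℝ) - (∑ T, ε T * √((∏ p ∈ T.1, p : ℕ) : ℝ)) ^ 2| ∨
      (n : ℝ) = (∑ T, ε T * √((∏ p ∈ T.1, p : ℕ) : ℝ)) ^ 2 ∧
        (ε = 0 ∨ ∃ T, ε = Pi.single T 1 ∨ ε = Pi.single T (-1)) := by
  by_cases h : (n : ℝ) = (∑ T, ε T * √((∏ p ∈ T.1, p : ℕ) : ℝ)) ^ 2
  · exact Or.inr ⟨h, exists_single_of_sq_eq hS ε hε n h⟩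
  left
  set w := ∑ T, ε T * √((∏ p ∈ T.1, p : ℕ) : ℝ) with hwdef
  have hl : ∀ p ∈ S.toList, p.Prime := fun p hp => hS p (Finset.mem_toList.1 hp)
  have hn := S.nodup_toList
  have hw : SqrtRep S.toList w W := by
    refine (SqrtRep.sum Finset.univ _ _ fun T _ => ?_).mono hW
    have h1 := SqrtRep.sqrt_prod hn T.1 (by simpa using Finset.mem_powerset.1 T.2)
    refine ((SqrtRep.intCast S.toList (ε T)).mul h1).mono ?_
    refine mul_le_of_le_one_left (Real.sqrt_nonneg _) ?_
    exact_mod_cast hε T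
  have hrep : SqrtRep S.toList (n - w ^ 2) (n + W ^ 2) := by
    have h1 := (SqrtRep.intCast S.toList n).add (hw.mul hw).neg
    simpa [sq, sub_eq_add_neg] using h1
  have hX : (1 : ℝ) ≤ 3 * W ^ 2 := by nlinarith
  have hX0 : (0 : ℝ) < 3 * W ^ 2 := by linarith
  have hpow : 3 * W ^ 2 ≤ (3 * W ^ 2) ^ (2 ^ S.card + 1) := le_self_pow₀ hX (Nat.succ_ne_zero _)
  have hw2 : w ^ 2 ≤ W ^ 2 := sq_le_sq' (by linarith [abs_le.1 hw.abs_le])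
    (abs_le.1 hw.abs_le).2
  by_cases hn2 : (n : ℝ) ≤ 2 * W ^ 2
  · have h1 := hrep.one_le_abs_mul_pow hl hn (sub_ne_zero.2 h)
    rw [Finset.length_toList] at h1
    have h2 : (n + W ^ 2) ^ (2 ^ S.card - 1) ≤ (3 * W ^ 2) ^ (2 ^ S.card) :=
      (pow_le_pow_left₀ (by positivity) (by linarith) _).trans
        (pow_le_pow_right₀ hX (Nat.sub_le _ _))
    rw [inv_mul_le_iff₀ (by positivity)]
    calc (1 : ℝ) + n ≤ (3 * W ^ 2) * 1 := by nlinarith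
      _ ≤ (3 * W ^ 2) * (|(n : ℝ) - w ^ 2| * (3 * W ^ 2) ^ (2 ^ S.card)) := by
          gcongr
          exact h1.trans (by gcongr)
      _ = _ := by ring
  · push Not at hn2
    refine le_trans ?_ (le_abs_self _)
    have h3 : ((3 * W ^ 2) ^ (2 ^ S.card + 1))⁻¹ ≤ 1 / 3 := by
      rw [inv_le_comm₀ (by positivity) (by norm_num)]
      refine le_trans ?_ hpow
      nlinarith
    have h4 : ((3 * W ^ 2) ^ (2 ^ S.card + 1))⁻¹ * (1 + n) ≤ 1 / 3 * (1 + (n : ℝ)) := by gcongr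
    nlinarith

open ArithmeticFunction.vonMangoldt in
theorem frequently_lt_sum_residueClass :
    ∃ᶠ N : ℕ in atTop, (N : ℝ) / 8 < ∑ k ∈ Finset.Icc 1 N, residueClass (1 : ZMod 4) k := by
  intro hcon
  obtain ⟨N₀, hN₀⟩ := eventually_atTop.1 hcon
  set f : ℕ → ℝ := residueClass (1 : ZMod 4) with hf
  have hf0 : ∀ n, 0 ≤ f n := residueClass_nonneg _
  set C₀ : ℝ := ∑ k ∈ Finset.Icc 1 N₀, f k with hC₀
  have hC₀0 : 0 ≤ C₀ := Finset.sum_nonneg fun k _ => hf0 k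
  have hbd : ∀ N : ℕ, ∑ k ∈ Finset.Icc 1 N, f k ≤ C₀ + N / 8 := by
    intro N
    rcases le_total N₀ N with h | h
    · have := hN₀ N h
      rw [not_lt] at this
      linarith
    · have : ∑ k ∈ Finset.Icc 1 N, f k ≤ C₀ :=
        Finset.sum_le_sum_of_subset_of_nonneg (Finset.Icc_subset_Icc_right h) fun k _ _ => hf0 k
      have : (0 : ℝ) ≤ N / 8 := by positivity
      linarith
  obtain ⟨C, hC⟩ := LSeries_residueClass_lower_bound (q := 4) (a := 1) isUnit_one
  have hO : (fun n : ℕ ↦ ∑ k ∈ Finset.Icc 1 n, f k) =O[atTop] fun n ↦ (n : ℝ) ^ (1 : ℝ) := by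
    refine Asymptotics.IsBigO.of_bound (C₀ + 1) ?_
    filter_upwards [eventually_ge_atTop 1] with n hn
    have hn' : (1 : ℝ) ≤ n := by exact_mod_cast hn
    rw [Real.rpow_one, Real.norm_of_nonneg (Finset.sum_nonneg fun k _ => hf0 k),
      Real.norm_of_nonneg (by positivity)]
    have := hbd n
    nlinarith
  have key : ∀ x : ℝ, x ∈ Set.Ioc 1 2 → (1 / 4) / (x - 1) ≤ C + C₀ := by
    intro x hx
    have hx1 : 1 < x := hx.1
    have h1 := hC hx
    have htot : ((4 : ℕ).totient : ℝ) = 2 := by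
      have : Nat.totient 4 = 2 := by decide
      rw [this]; norm_num
    rw [htot] at h1
    have h2 := LSeries_eq_mul_integral_of_nonneg f zero_le_one (s := x) (by simpa using hx1) hO hf0
    have h3 : LSeries (fun n ↦ f n) x = ((∑' n, f n / (n : ℝ) ^ x : ℝ) : ℂ) := by
      rw [Complex.ofReal_tsum, LSeries]
      refine tsum_congr fun n => ?_
      rw [LSeries.term_def]
      split_ifs with hn
      · simp [hn, hf]
      · rw [Complex.ofReal_div, Complex.ofReal_cpow (Nat.cast_nonneg _)]
        simp
    have hi1 : MeasureTheory.IntegrableOn (fun t : ℝ => C₀ * t ^ (-(x + 1)) + 1 / 8 * t ^ (-x))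
        (Set.Ioi 1) :=
      ((integrableOn_Ioi_rpow_of_lt (by linarith) one_pos).const_mul C₀).add
        ((integrableOn_Ioi_rpow_of_lt (by linarith) one_pos).const_mul (1 / 8))
    have h4 : ‖∫ t in Set.Ioi (1 : ℝ), (∑ k ∈ Finset.Icc 1 ⌊t⌋₊, (f k : ℂ)) *
        (t : ℂ) ^ (-((x : ℂ) + 1))‖ ≤
        ∫ t in Set.Ioi (1 : ℝ), (C₀ * t ^ (-(x + 1)) + 1 / 8 * t ^ (-x)) := by
      refine MeasureTheory.norm_integral_le_of_norm_le hi1 ?_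
      filter_upwards [MeasureTheory.ae_restrict_mem measurableSet_Ioi] with t ht
      have ht0 : (0 : ℝ) < t := one_pos.trans ht
      rw [norm_mul, ← Complex.ofReal_sum, Complex.norm_real,
        Real.norm_of_nonneg (Finset.sum_nonneg fun k _ => hf0 k),
        Complex.norm_cpow_eq_rpow_re_of_pos ht0]
      simp only [Complex.neg_re, Complex.add_re, Complex.ofReal_re, Complex.one_re]
      have h5 : t ^ (-x) = t * t ^ (-(x + 1)) := by
        rw [← Real.rpow_one_add' ht0.le (by linarith)]; congr 1; ring
      rw [h5]
      have h6 := hbd ⌊t⌋₊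
      have h7 := Nat.floor_le ht0.le
      have h8 : 0 ≤ t ^ (-(x + 1)) := by positivity
      calc _ ≤ (C₀ + t / 8) * t ^ (-(x + 1)) := by
            refine mul_le_mul_of_nonneg_right ?_ h8
            linarith
        _ = _ := by ring
    have h5 : ∫ t in Set.Ioi (1 : ℝ), (C₀ * t ^ (-(x + 1)) + 1 / 8 * t ^ (-x)) =
        C₀ / x + 1 / 8 / (x - 1) := by
      rw [MeasureTheory.integral_add
        ((integrableOn_Ioi_rpow_of_lt (by linarith) one_pos).const_mul C₀)
        ((integrableOn_Ioi_rpow_of_lt (by linarith) one_pos).const_mul (1 / 8)),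
        MeasureTheory.integral_const_mul, MeasureTheory.integral_const_mul,
        integral_Ioi_rpow_of_lt (by linarith) one_pos,
        integral_Ioi_rpow_of_lt (by linarith) one_pos]
      have : x - 1 ≠ 0 := by linarith
      have : -x + 1 ≠ 0 := by linarith
      have : -(x + 1) + 1 ≠ 0 := by linarith
      have : x ≠ 0 := by linarith
      simp only [Real.one_rpow]
      field_simp
      ring
    have h6 : ∑' n, f n / (n : ℝ) ^ x ≤ x * (C₀ / x + 1 / 8 / (x - 1)) := by
      have h7 : ‖LSeries (fun n ↦ (f n : ℂ)) x‖ ≤ x * (C₀ / x + 1 / 8 / (x - 1)) := by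
        rw [h2, norm_mul, Complex.norm_real, Real.norm_of_nonneg (by linarith)]
        rw [← h5]
        exact mul_le_mul_of_nonneg_left h4 (by linarith)
      rw [h3, Complex.norm_real] at h7
      exact (le_abs_self _).trans h7
    have h7 := h1.trans h6
    have h8 : x * (C₀ / x + 1 / 8 / (x - 1)) = C₀ + x / 8 / (x - 1) := by field_simp
    rw [h8] at h7
    have h9 : x / 8 / (x - 1) ≤ 2 / 8 / (x - 1) := by
      have := hx.2
      have : 0 < x - 1 := by linarith
      gcongr
    have h10 : (1 / 4) / (x - 1) = 2⁻¹ / (x - 1) - 2 / 8 / (x - 1) := by ring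
    rw [h10]
    linarith
  have h1 := key 2 (by norm_num)
  norm_num at h1
  set D := C + C₀
  have hD : 0 < D := by linarith
  have h2 := key (1 + 1 / (8 * D)) ⟨by have : 0 < 1 / (8 * D) := by positivity
                                       linarith, by
    have : 1 / (8 * D) ≤ 1 := by
      rw [div_le_one (by positivity)]; linarith
    linarith⟩
  rw [add_sub_cancel_left] at h2
  have h3 : 1 / 4 / (1 / (8 * D)) = 2 * D := by field_simp; norm_num
  rw [h3] at h2
  linarith

open ArithmeticFunction.vonMangoldt in
/-- Infinitely often, the first primes congruent to one modulo four are as dense as the prime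
number theorem predicts, up to a constant. -/
theorem frequently_primes_one_mod_four :
    ∃ᶠ M : ℕ in atTop, ∃ S : Finset ℕ, S.card = M ∧
      ∀ p ∈ S, p.Prime ∧ p % 4 = 1 ∧ (p : ℝ) ≤ 32 * M * Real.log M := by
  obtain ⟨C, hC⟩ := Chebyshev.psi_sub_theta_le_mul_sqrt
  have hlog : Tendsto (fun N : ℕ => Real.log N / (N : ℝ) ^ (1 / 2 : ℝ)) atTop (nhds 0) :=
    (isLittleO_log_rpow_atTop (by norm_num : (0 : ℝ) < 1 / 2)).tendsto_div_nhds_zero.comp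
      tendsto_natCast_atTop_atTop
  have hsq : Tendsto (fun N : ℕ => √(N : ℝ)) atTop atTop :=
    tendsto_sqrt_atTop.comp tendsto_natCast_atTop_atTop
  rw [frequently_atTop]
  intro M₀
  have hev : ∀ᶠ N : ℕ in atTop, Real.log N / (N : ℝ) ^ (1 / 2 : ℝ) < 1 / 16 ∧
      16 * |C| ≤ √(N : ℝ) ∧ (M₀ : ℝ) ≤ √(N : ℝ) ∧ 2 ≤ N :=
    (hlog.eventually_lt_const (by norm_num)).and ((hsq.eventually_ge_atTop _).and
      ((hsq.eventually_ge_atTop _).and (eventually_ge_atTop 2)))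
  obtain ⟨N, hN, h1, h2, h3, h4⟩ := (frequently_lt_sum_residueClass.and_eventually hev).exists
  have hN1 : (1 : ℝ) < N := by exact_mod_cast (by omega : 1 < N)
  have hlogN : 0 < Real.log N := Real.log_pos hN1
  rw [← Real.sqrt_eq_rpow, div_lt_iff₀ (by positivity)] at h1
  have hss : √(N : ℝ) * √(N : ℝ) = N := Real.mul_self_sqrt (by positivity)
  set S := (Finset.Icc 1 N).filter (fun p => p.Prime ∧ p % 4 = 1) with hS
  have hcard : (N : ℝ) / 8 ≤ S.card * Real.log N + C * √(N : ℝ) := by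
    refine hN.le.trans ?_
    rw [← Finset.sum_filter_add_sum_filter_not _ Nat.Prime]
    refine add_le_add ?_ ?_
    · rw [← nsmul_eq_mul, ← Finset.sum_const, hS, Finset.sum_filter, Finset.sum_filter]
      refine Finset.sum_le_sum fun p hp => ?_
      rw [Finset.mem_Icc] at hp
      by_cases hpp : p.Prime
      · by_cases hp4 : p % 4 = 1
        · simp only [hpp, hp4, if_true, and_self]
          refine (residueClass_le _ _).trans ?_
          rw [ArithmeticFunction.vonMangoldt_apply_prime hpp]
          exact Real.log_le_log (by exact_mod_cast hpp.pos) (by exact_mod_cast hp.2)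
        · have : ¬ ((p : ZMod 4) = 1) := by
            intro h
            apply hp4
            have : (p : ZMod 4) = ((1 : ℕ) : ZMod 4) := by simpa using h
            exact (ZMod.natCast_eq_natCast_iff' _ _ _).1 this
          simp [hpp, hp4, residueClass, this]
      · simp [hpp]
    · refine le_trans ?_ (hC N)
      rw [Chebyshev.psi_sub_theta_eq_sum_not_prime, Nat.floor_natCast]
      have : Finset.Icc 1 N = Finset.Ioc 0 N := by ext; simp [Nat.succ_le_iff]
      rw [this]
      exact Finset.sum_le_sum fun p _ => residueClass_le _ _
  have hC2 : C * √(N : ℝ) ≤ N / 16 := by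
    calc C * √(N : ℝ) ≤ |C| * √(N : ℝ) := by gcongr; exact le_abs_self _
      _ ≤ √(N : ℝ) / 16 * √(N : ℝ) := by gcongr; linarith
      _ = N / 16 := by rw [div_mul_eq_mul_div, hss]
  have hM1 : (N : ℝ) ≤ 16 * (S.card * Real.log N) := by linarith
  have hM2 : √(N : ℝ) ≤ S.card := by
    by_contra! h
    have h5 : 0 < √(N : ℝ) := by positivity
    have : (S.card : ℝ) * Real.log N ≤ √(N : ℝ) * Real.log N := by gcongr
    nlinarith
  have hM3 : Real.log N ≤ 2 * Real.log S.card := by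
    have h5 : 0 < √(N : ℝ) := by positivity
    have := Real.log_le_log h5 hM2
    rw [Real.log_sqrt (by positivity)] at this
    linarith
  refine ⟨S.card, by exact_mod_cast h3.trans hM2, S, rfl, fun p hp => ?_⟩
  rw [hS, Finset.mem_filter, Finset.mem_Icc] at hp
  refine ⟨hp.2.1, hp.2.2, ?_⟩
  have h5 : (p : ℝ) ≤ N := by exact_mod_cast hp.1.2
  have h6 : (S.card : ℝ) * Real.log N ≤ S.card * (2 * Real.log S.card) := by gcongr
  linarith

/-- The squared Euclidean norm of a lattice point. -/
def sqNorm (m : ℤ × ℤ) : ℝ := (m.1 : ℝ) ^ 2 + (m.2 : ℝ) ^ 2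

theorem sqNorm_nonneg (m : ℤ × ℤ) : 0 ≤ sqNorm m := by unfold sqNorm; positivity

open MeasureTheory in
theorem integrableOn_exp_neg_sq_sub_inv_sq {s : ℝ} (hs : 0 < s) (r : ℝ) :
    IntegrableOn (fun y : ℝ => rexp (-(s ^ 2 / 4) * y ^ 2 - r ^ 2 / y ^ 2)) (Set.Ioi 0) := by
  refine Integrable.mono' (integrable_exp_neg_mul_sq (b := s ^ 2 / 4) (by positivity)).integrableOn
    (by fun_prop) (ae_of_all _ fun y => ?_)
  rw [Real.norm_of_nonneg (Real.exp_pos _).le]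
  apply Real.exp_le_exp.2
  have : 0 ≤ r ^ 2 / y ^ 2 := by positivity
  linarith

open MeasureTheory in
theorem integral_exp_neg_sq_sub_inv_sq {s r : ℝ} (hs : 0 < s) (hr : 0 ≤ r) :
    ∫ y in Set.Ioi (0 : ℝ), rexp (-(s ^ 2 / 4) * y ^ 2 - r ^ 2 / y ^ 2) =
      √π / s * rexp (-(s * r)) := by
  rcases hr.eq_or_lt with rfl | hr
  · simp only [ne_eq, OfNat.ofNat_ne_zero, not_false_eq_true, zero_pow, zero_div, sub_zero,
      mul_zero, neg_zero, Real.exp_zero, mul_one]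
    rw [integral_gaussian_Ioi, show π / (s ^ 2 / 4) = π * (2 / s) ^ 2 by field_simp; norm_num,
      Real.sqrt_mul Real.pi_pos.le, Real.sqrt_sq (by positivity)]
    field_simp
  set a := s / 2 with ha_def
  have ha : 0 < a := by positivity
  set φ : ℝ → ℝ := fun y => a * y - r * y⁻¹ with hφ
  set g : ℝ → ℝ := fun t => rexp (-1 * t ^ 2) with hg
  have hI := (integrableOn_exp_neg_sq_sub_inv_sq hs r)
  have hexp : ∀ y ∈ Set.Ioi (0 : ℝ), rexp (-(s ^ 2 / 4) * y ^ 2 - r ^ 2 / y ^ 2) =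
      rexp (-(s * r)) * g (φ y) := by
    intro y hy
    have hy' : y ≠ 0 := ne_of_gt hy
    rw [hg, ← Real.exp_add]
    congr 1
    simp only [hφ, ha_def]
    field_simp
    ring
  have hgI : IntegrableOn (fun y => g (φ y)) (Set.Ioi 0) := by
    have := (integrableOn_congr_fun hexp measurableSet_Ioi).1 hI
    have h2 := this.const_mul (rexp (s * r))
    refine h2.congr (ae_of_all _ fun y => ?_)
    simp only [← mul_assoc, ← Real.exp_add]
    simp
  rw [setIntegral_congr_fun measurableSet_Ioi hexp, integral_const_mul]
  have hd : ∀ y ∈ Set.Ioi (0 : ℝ), HasDerivWithinAt φ (a + r / y ^ 2) (Set.Ioi 0) y := by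
    intro y hy
    have hy' : y ≠ 0 := ne_of_gt hy
    have h1 := ((hasDerivAt_id y).const_mul a).sub ((hasDerivAt_inv hy').const_mul r)
    exact (h1.congr_deriv (by field_simp; ring)).hasDerivWithinAt
  have hmono : StrictMonoOn φ (Set.Ioi 0) := by
    intro x hx y hy hxy
    have hx' : 0 < x := hx
    have h1 : a * x < a * y := by gcongr
    have h2 : r * y⁻¹ ≤ r * x⁻¹ := by gcongr
    simp only [hφ]
    linarith
  have himg : φ '' Set.Ioi 0 = Set.univ := by
    rw [Set.eq_univ_iff_forall]
    intro t
    have h0 : 0 ≤ t ^ 2 + 4 * a * r := by positivity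
    have h1 := Real.sq_sqrt h0
    have h2 : |t| < √(t ^ 2 + 4 * a * r) := by
      rw [← Real.sqrt_sq_eq_abs]
      apply Real.sqrt_lt_sqrt (by positivity)
      have : 0 < 4 * a * r := by positivity
      linarith
    have h3 := (abs_lt.1 h2).1
    refine ⟨(t + √(t ^ 2 + 4 * a * r)) / (2 * a), ?_, ?_⟩
    · refine Set.mem_Ioi.2 (div_pos (by linarith) (by positivity))
    · have h4 : t + √(t ^ 2 + 4 * a * r) ≠ 0 := by linarith
      simp only [hφ]
      generalize √(t ^ 2 + 4 * a * r) = q at h1 h4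
      rw [inv_div]
      field_simp
      linear_combination h1
  have h1 := integral_image_eq_integral_abs_deriv_smul measurableSet_Ioi hd hmono.injOn g
  rw [himg, setIntegral_univ, integral_gaussian] at h1
  set ψ : ℝ → ℝ := fun y => r / a * y⁻¹ with hψ
  have hd2 : ∀ y ∈ Set.Ioi (0 : ℝ), HasDerivWithinAt ψ (-(r / a / y ^ 2)) (Set.Ioi 0) y := by
    intro y hy
    have hy' : y ≠ 0 := ne_of_gt hy
    have h1 := ((hasDerivAt_inv hy').const_mul (r / a))
    exact (h1.congr_deriv (by field_simp)).hasDerivWithinAt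
  have hinv : ∀ y ∈ Set.Ioi (0 : ℝ), ψ (ψ y) = y := by
    intro y hy
    have hy' : y ≠ 0 := ne_of_gt hy
    simp only [hψ]; field_simp
  have hpos : ∀ y ∈ Set.Ioi (0 : ℝ), ψ y ∈ Set.Ioi (0 : ℝ) := by
    intro y hy
    have : 0 < y := hy
    exact Set.mem_Ioi.2 (by simp only [hψ]; positivity)
  have hinj : Set.InjOn ψ (Set.Ioi 0) := fun x hx y hy hxy => by
    rw [← hinv x hx, hxy, hinv y hy]
  have himg2 : ψ '' Set.Ioi 0 = Set.Ioi 0 := by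
    ext y
    exact ⟨by rintro ⟨x, hx, rfl⟩; exact hpos x hx, fun hy => ⟨ψ y, hpos y hy, hinv y hy⟩⟩
  have hcomp : ∀ y ∈ Set.Ioi (0 : ℝ), |-(r / a / y ^ 2)| • g (φ (ψ y)) =
      1 / a * (r / y ^ 2 * g (φ y)) := by
    intro y hy
    have hy' : y ≠ 0 := ne_of_gt hy
    have : φ (ψ y) = - φ y := by simp only [hφ, hψ]; field_simp; ring
    rw [this, abs_neg, abs_of_nonneg (by positivity), smul_eq_mul]
    simp only [hg, neg_sq]
    ring
  have h2 := integral_image_eq_integral_abs_deriv_smul measurableSet_Ioi hd2 hinj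
    (fun y => g (φ y))
  have hI2 := (integrableOn_image_iff_integrableOn_abs_deriv_smul measurableSet_Ioi hd2 hinj
    (fun y => g (φ y))).1 (by rw [himg2]; exact hgI)
  rw [himg2, setIntegral_congr_fun measurableSet_Ioi hcomp, integral_const_mul] at h2
  rw [integrableOn_congr_fun hcomp measurableSet_Ioi] at hI2
  have hI3 : IntegrableOn (fun y => r / y ^ 2 * g (φ y)) (Set.Ioi 0) := by
    have := hI2.const_mul a
    refine this.congr (ae_of_all _ fun y => ?_)
    field_simp
  have h3 : ∫ y in Set.Ioi (0 : ℝ), |a + r / y ^ 2| • g (φ y) =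
      ∫ y in Set.Ioi (0 : ℝ), (a * g (φ y) + r / y ^ 2 * g (φ y)) := by
    refine integral_congr_ae (ae_of_all _ fun y => ?_)
    simp only [smul_eq_mul]
    rw [abs_of_nonneg (by positivity)]
    ring
  rw [h3, integral_add (hgI.const_mul a) hI3, integral_const_mul] at h1
  set I := ∫ y in Set.Ioi (0 : ℝ), g (φ y)
  set J := ∫ y in Set.Ioi (0 : ℝ), r / y ^ 2 * g (φ y)
  have h4 : J = a * I := by rw [h2]; field_simp
  rw [h4, div_one] at h1
  have : I = √π / s := by
    rw [h1]
    field_simp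
    rw [ha_def]; ring
  rw [this]; ring

theorem summable_int_exp_neg_mul_sq {a : ℝ} (ha : 0 < a) :
    Summable fun n : ℤ => rexp (-π * a * (n : ℝ) ^ 2) := by
  have h := ((summable_jacobiTheta₂_term_iff 0 (Complex.I * a)).2 (by simpa using ha)).norm
  refine h.congr fun n => ?_
  rw [norm_jacobiTheta₂_term]
  congr 1
  simp
  ring

theorem tsum_exp_neg_mul_sqNorm {a : ℝ} (ha : 0 < a) :
    ∑' m : ℤ × ℤ, rexp (-π * a * sqNorm m) = 1 / a * ∑' m : ℤ × ℤ, rexp (-π / a * sqNorm m) := by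
  have key : ∀ b : ℝ, 0 < b → ∑' m : ℤ × ℤ, rexp (-π * b * sqNorm m) =
      (∑' n : ℤ, rexp (-π * b * (n : ℝ) ^ 2)) * ∑' n : ℤ, rexp (-π * b * (n : ℝ) ^ 2) := by
    intro b hb
    have h := summable_int_exp_neg_mul_sq hb
    rw [h.tsum_mul_tsum h (h.mul_of_nonneg h (fun _ => (Real.exp_pos _).le)
      (fun _ => (Real.exp_pos _).le))]
    refine tsum_congr fun m => ?_
    rw [← Real.exp_add, sqNorm]
    congr 1; ring
  have h1 := key (1 / a) (by positivity)
  have h2 : -π * (1 / a) = -π / a := by ring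
  rw [h2] at h1
  rw [key a ha, h1, Real.tsum_exp_neg_mul_int_sq ha, mul_mul_mul_comm, div_mul_div_comm,
    ← Real.rpow_add ha]
  norm_num

theorem summable_one_add_sqNorm : Summable fun m : ℤ × ℤ => (1 + sqNorm m) ^ (-(3 / 2) : ℝ) := by
  have h1 : Summable fun n : ℤ => (1 + (n : ℝ) ^ 2) ^ (-(3 / 4) : ℝ) := by
    refine Summable.of_norm_bounded_eventually
      (Real.summable_abs_int_rpow (b := 3 / 2) (by norm_num)) ?_
    have : ∀ᶠ n : ℤ in cofinite, n ≠ 0 := by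
      rw [eventually_cofinite]
      simp
    filter_upwards [this] with n hn
    rw [Real.norm_of_nonneg (by positivity)]
    have hn' : 0 < |(n : ℝ)| := by simpa using hn
    rw [show (-(3 / 2) : ℝ) = (2 : ℕ) * (-(3 / 4)) by norm_num, Real.rpow_mul hn'.le,
      Real.rpow_natCast, sq_abs]
    refine Real.rpow_le_rpow_of_nonpos (by positivity) (by linarith) (by norm_num)
  refine Summable.of_nonneg_of_le (fun m => ?_) (fun m => ?_)
    (h1.mul_of_nonneg h1 (fun _ => by positivity) (fun _ => by positivity))
  · have := sqNorm_nonneg m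
    positivity
  · rw [← Real.mul_rpow (by positivity) (by positivity),
      show (-(3 / 2) : ℝ) = (2 : ℕ) * (-(3 / 4)) by norm_num, Real.rpow_mul
        (by have := sqNorm_nonneg m; positivity), Real.rpow_natCast]
    refine Real.rpow_le_rpow_of_nonpos (by positivity) ?_ (by norm_num)
    unfold sqNorm
    nlinarith [sq_nonneg (m.1 : ℝ), sq_nonneg (m.2 : ℝ),
      mul_nonneg (sq_nonneg (m.1 : ℝ)) (sq_nonneg (m.2 : ℝ)), sq_nonneg ((m.1 : ℝ) ^ 2),
      sq_nonneg ((m.2 : ℝ) ^ 2)]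

theorem exists_exp_neg_mul_sqrt_sqNorm_le {s : ℝ} (hs : 0 < s) :
    ∃ C : ℝ, ∀ m : ℤ × ℤ, rexp (-(s * √(sqNorm m))) ≤ C * (1 + sqNorm m) ^ (-(3 / 2) : ℝ) := by
  set d := min 1 (s / 4) with hd_def
  have hd : 0 < d := by positivity
  refine ⟨(d ^ 4)⁻¹, fun m => ?_⟩
  set r := √(sqNorm m) with hr
  have hr0 : 0 ≤ r := Real.sqrt_nonneg _
  have hN : sqNorm m = r ^ 2 := (Real.sq_sqrt (sqNorm_nonneg m)).symm
  have h1 : d * (1 + r) ≤ rexp (s * r / 4) := by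
    have h2 : d ≤ 1 := min_le_left _ _
    have h3 : d * r ≤ s / 4 * r := by gcongr; exact min_le_right _ _
    have := Real.add_one_le_exp (s * r / 4)
    linarith
  have h2 : d ^ 4 * (1 + r) ^ 4 ≤ rexp (s * r) := by
    calc d ^ 4 * (1 + r) ^ 4 = (d * (1 + r)) ^ 4 := by ring
      _ ≤ rexp (s * r / 4) ^ 4 := by gcongr
      _ = rexp (s * r) := by rw [← Real.exp_nat_mul]; congr 1; push_cast; ring
  have h3 : (1 + r ^ 2) ^ (3 / 2 : ℝ) ≤ (1 + r) ^ 4 := by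
    calc (1 + r ^ 2) ^ (3 / 2 : ℝ) ≤ (1 + r ^ 2) ^ (2 : ℝ) :=
          Real.rpow_le_rpow_of_exponent_le (by nlinarith) (by norm_num)
      _ = (1 + r ^ 2) ^ 2 := by norm_cast
      _ ≤ ((1 + r) ^ 2) ^ 2 := by gcongr; nlinarith
      _ = _ := by ring
  rw [hN, Real.rpow_neg (by positivity), Real.exp_neg, ← mul_inv]
  refine inv_anti₀ (by positivity) (le_trans ?_ h2)
  gcongr

theorem summable_exp_neg_mul_sqrt_sqNorm {s : ℝ} (hs : 0 < s) :
    Summable fun m : ℤ × ℤ => rexp (-(s * √(sqNorm m))) := by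
  obtain ⟨C, hC⟩ := exists_exp_neg_mul_sqrt_sqNorm_le hs
  exact Summable.of_nonneg_of_le (fun _ => (Real.exp_pos _).le) hC
    (summable_one_add_sqNorm.mul_left C)

theorem summable_sq_add_sqNorm {s : ℝ} (hs : 0 < s) :
    Summable fun m : ℤ × ℤ => (s ^ 2 + 4 * π ^ 2 * sqNorm m) ^ (-(3 / 2) : ℝ) := by
  set d := min 1 (s ^ 2) with hd_def
  have hd : 0 < d := by positivity
  refine Summable.of_nonneg_of_le (fun m => ?_) (fun m => ?_)
    (summable_one_add_sqNorm.mul_left (d ^ (-(3 / 2) : ℝ)))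
  · have := sqNorm_nonneg m
    positivity
  · have h0 := sqNorm_nonneg m
    rw [← Real.mul_rpow hd.le (by positivity)]
    refine Real.rpow_le_rpow_of_nonpos (by positivity) ?_ (by norm_num)
    have h1 : d ≤ s ^ 2 := min_le_right _ _
    have h2 : d * sqNorm m ≤ 4 * π ^ 2 * sqNorm m := by
      gcongr
      have : d ≤ 1 := min_le_left _ _
      have := Real.pi_gt_three
      nlinarith
    linarith

open MeasureTheory in
theorem integral_sq_mul_exp_neg_mul_sq {b : ℝ} (hb : 0 < b) :
    IntegrableOn (fun y : ℝ => y ^ 2 * rexp (-b * y ^ 2)) (Set.Ioi 0) ∧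
    ∫ y in Set.Ioi (0 : ℝ), y ^ 2 * rexp (-b * y ^ 2) = √π / 4 * b ^ (-(3 / 2) : ℝ) := by
  have h1 := integrableOn_rpow_mul_exp_neg_mul_rpow (p := 2) (s := 2) (b := b) (by norm_num)
    (by norm_num) hb
  have h2 := integral_rpow_mul_exp_neg_mul_rpow (p := 2) (q := 2) (b := b) (by norm_num)
    (by norm_num) hb
  simp only [Real.rpow_ofNat] at h1 h2
  refine ⟨h1, h2.trans ?_⟩
  have h3 : Real.Gamma ((2 + 1) / 2) = √π / 2 := by
    rw [show ((2 : ℝ) + 1) / 2 = 1 / 2 + 1 by norm_num, Real.Gamma_add_one (by norm_num),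
      Real.Gamma_one_half_eq]; ring
  rw [h3, show (-(2 + 1) / 2 : ℝ) = -(3 / 2) by norm_num]
  ring

open MeasureTheory in
/-- Hardy's identity for real arguments. -/
theorem tsum_exp_neg_mul_sqrt_sqNorm {s : ℝ} (hs : 0 < s) :
    ∑' m : ℤ × ℤ, rexp (-(s * √(sqNorm m))) =
      2 * π * s * ∑' m : ℤ × ℤ, (s ^ 2 + 4 * π ^ 2 * sqNorm m) ^ (-(3 / 2) : ℝ) := by
  have hsqrt : 0 < √π := Real.sqrt_pos.2 Real.pi_pos
  have h1 : ∀ m : ℤ × ℤ, ∫ y in Set.Ioi (0 : ℝ),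
      rexp (-(s ^ 2 / 4) * y ^ 2 - √(sqNorm m) ^ 2 / y ^ 2) =
      √π / s * rexp (-(s * √(sqNorm m))) :=
    fun m => integral_exp_neg_sq_sub_inv_sq hs (Real.sqrt_nonneg _)
  have h2 := integral_tsum_of_summable_integral_norm (μ := volume.restrict (Set.Ioi (0 : ℝ)))
    (F := fun (m : ℤ × ℤ) (y : ℝ) => rexp (-(s ^ 2 / 4) * y ^ 2 - √(sqNorm m) ^ 2 / y ^ 2))
    (fun m => integrableOn_exp_neg_sq_sub_inv_sq hs _) (by
      simp only [Real.norm_of_nonneg (Real.exp_pos _).le, h1]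
      exact (summable_exp_neg_mul_sqrt_sqNorm hs).mul_left _)
  simp only [h1] at h2
  set B : ℤ × ℤ → ℝ := fun m => s ^ 2 / 4 + π ^ 2 * sqNorm m with hB
  have hB0 : ∀ m, 0 < B m := fun m => by
    have := sqNorm_nonneg m
    simp only [hB]; positivity
  have hBe : ∀ m, B m ^ (-(3 / 2) : ℝ) = 8 * (s ^ 2 + 4 * π ^ 2 * sqNorm m) ^ (-(3 / 2) : ℝ) := by
    intro m
    have h0 := sqNorm_nonneg m
    have : B m = (1 / 4) * (s ^ 2 + 4 * π ^ 2 * sqNorm m) := by simp only [hB]; ring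
    rw [this, Real.mul_rpow (by norm_num) (by positivity)]
    congr 1
    rw [show (1 / 4 : ℝ) = 2 ^ (-2 : ℝ) by rw [Real.rpow_neg (by norm_num)]; norm_num,
      ← Real.rpow_mul (by norm_num)]
    norm_num
  have h3 : ∀ m : ℤ × ℤ, ∫ y in Set.Ioi (0 : ℝ), π * (y ^ 2 * rexp (-(B m) * y ^ 2)) =
      π * (√π / 4 * (8 * (s ^ 2 + 4 * π ^ 2 * sqNorm m) ^ (-(3 / 2) : ℝ))) := by
    intro m
    rw [integral_const_mul, (integral_sq_mul_exp_neg_mul_sq (hB0 m)).2, hBe]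
  have h4 := integral_tsum_of_summable_integral_norm (μ := volume.restrict (Set.Ioi (0 : ℝ)))
    (F := fun (m : ℤ × ℤ) (y : ℝ) => π * (y ^ 2 * rexp (-(B m) * y ^ 2)))
    (fun m => (integral_sq_mul_exp_neg_mul_sq (hB0 m)).1.const_mul π) (by
      have : ∀ (m : ℤ × ℤ) (y : ℝ), ‖π * (y ^ 2 * rexp (-(B m) * y ^ 2))‖ =
          π * (y ^ 2 * rexp (-(B m) * y ^ 2)) := fun m y => Real.norm_of_nonneg (by positivity)
      simp only [this, h3]
      exact (((summable_sq_add_sqNorm hs).mul_left 8).mul_left (√π / 4)).mul_left π)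
  simp only [h3] at h4
  have h5 : ∀ y ∈ Set.Ioi (0 : ℝ),
      ∑' m : ℤ × ℤ, rexp (-(s ^ 2 / 4) * y ^ 2 - √(sqNorm m) ^ 2 / y ^ 2) =
      ∑' m : ℤ × ℤ, π * (y ^ 2 * rexp (-(B m) * y ^ 2)) := by
    intro y hy
    have hy' : 0 < y := hy
    have hpi := Real.pi_pos
    have h6 := tsum_exp_neg_mul_sqNorm (a := 1 / (π * y ^ 2)) (by positivity)
    have e1 : ∀ m : ℤ × ℤ, rexp (-(s ^ 2 / 4) * y ^ 2 - √(sqNorm m) ^ 2 / y ^ 2) =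
        rexp (-(s ^ 2 / 4) * y ^ 2) * rexp (-π * (1 / (π * y ^ 2)) * sqNorm m) := by
      intro m
      rw [← Real.exp_add, Real.sq_sqrt (sqNorm_nonneg m)]
      congr 1
      field_simp
      ring
    have e2 : ∀ m : ℤ × ℤ, π * (y ^ 2 * rexp (-(B m) * y ^ 2)) =
        rexp (-(s ^ 2 / 4) * y ^ 2) * (1 / (1 / (π * y ^ 2)) *
          rexp (-π / (1 / (π * y ^ 2)) * sqNorm m)) := by
      intro m
      have e3 : rexp (-(B m) * y ^ 2) = rexp (-(s ^ 2 / 4) * y ^ 2) *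
          rexp (-π / (1 / (π * y ^ 2)) * sqNorm m) := by
        rw [← Real.exp_add]
        congr 1
        simp only [hB]
        field_simp
        ring
      rw [e3, one_div_one_div]
      ring
    rw [tsum_congr e1, tsum_congr e2, tsum_mul_left, tsum_mul_left, tsum_mul_left, h6]
  rw [setIntegral_congr_fun measurableSet_Ioi h5, ← h4, tsum_mul_left, tsum_mul_left,
    tsum_mul_left, tsum_mul_left] at h2
  have h6 : √π / s ≠ 0 := by positivity
  apply mul_left_cancel₀ h6
  rw [h2]
  field_simp
  norm_num

theorem one_le_sqNorm {m : ℤ × ℤ} (hm : m ≠ 0) : 1 ≤ sqNorm m := by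
  have h : (0 : ℤ) < m.1 ^ 2 + m.2 ^ 2 := by
    by_cases h1 : m.1 = 0
    · have h2 : m.2 ≠ 0 := fun h2 => hm (Prod.ext h1 h2)
      positivity
    · positivity
  have h2 : (1 : ℤ) ≤ m.1 ^ 2 + m.2 ^ 2 := h
  unfold sqNorm
  exact_mod_cast h2

/-- The general term of the series for the Laplace transform of the discrepancy. -/
noncomputable def laplaceTerm (s : ℂ) (m : ℤ × ℤ) : ℂ :=
  if m = 0 then 0 else (s ^ 2 + (4 * π ^ 2 * sqNorm m : ℝ)) ^ ((-(3 / 2) : ℝ) : ℂ)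

theorem sq_add_mem_slitPlane {s : ℂ} (hs : 0 < s.re) {r : ℝ} (hr : 0 ≤ r) :
    s ^ 2 + (r : ℂ) ∈ Complex.slitPlane := by
  rw [Complex.mem_slitPlane_iff]
  by_cases h : s.im = 0
  · left
    simp only [sq, Complex.add_re, Complex.mul_re, h, Complex.ofReal_re]
    nlinarith
  · right
    simp only [sq, Complex.add_im, Complex.mul_im, Complex.ofReal_im]
    have := mul_ne_zero hs.ne' h
    intro h'
    apply this
    linarith

theorem le_norm_sq_add {s : ℂ} {δ R : ℝ} (hδ : 0 < δ) (hs : δ ≤ s.re) (hR : ‖s‖ ≤ R)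
    {m : ℤ × ℤ} (hm : m ≠ 0) :
    δ ^ 2 / (1 + R ^ 2) * (1 + sqNorm m) ≤ ‖s ^ 2 + (4 * π ^ 2 * sqNorm m : ℝ)‖ := by
  have h1 := one_le_sqNorm hm
  have hδR : δ ≤ R := hs.trans ((Complex.re_le_norm s).trans hR)
  have hpi : 9 ≤ π ^ 2 := by have := Real.pi_gt_three; nlinarith
  by_cases h : R ^ 2 ≤ 2 * π ^ 2 * sqNorm m
  · have h2 : (4 * π ^ 2 * sqNorm m) - R ^ 2 ≤ ‖s ^ 2 + (4 * π ^ 2 * sqNorm m : ℝ)‖ := by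
      have h3 := norm_sub_le_norm_add ((4 * π ^ 2 * sqNorm m : ℝ) : ℂ) (s ^ 2)
      rw [Complex.norm_real, Real.norm_of_nonneg (by positivity), norm_pow] at h3
      rw [add_comm (s ^ 2)]
      have : ‖s‖ ^ 2 ≤ R ^ 2 := by gcongr
      linarith
    have h3 : δ ^ 2 / (1 + R ^ 2) ≤ 1 := by
      rw [div_le_one (by positivity)]
      nlinarith
    have h4 : δ ^ 2 / (1 + R ^ 2) * (1 + sqNorm m) ≤ 1 * (1 + sqNorm m) := by gcongr
    nlinarith
  · push Not at h
    have h2 : s ^ 2 + (4 * π ^ 2 * sqNorm m : ℝ) =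
        (s + Complex.I * (2 * π * √(sqNorm m) : ℝ)) *
          (s - Complex.I * (2 * π * √(sqNorm m) : ℝ)) := by
      have h3 : ((√(sqNorm m) : ℝ) : ℂ) ^ 2 = (sqNorm m : ℂ) := by
        rw [← Complex.ofReal_pow, Real.sq_sqrt (sqNorm_nonneg m)]
      push_cast
      linear_combination (-4 * (π : ℂ) ^ 2) * h3 + 4 * π ^ 2 * (√(sqNorm m) : ℂ) ^ 2 * Complex.I_sq
    have h3 : δ ≤ ‖s + Complex.I * (2 * π * √(sqNorm m) : ℝ)‖ := by
      refine hs.trans (le_trans (le_of_eq ?_) (Complex.re_le_norm _))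
      simp
    have h4 : δ ≤ ‖s - Complex.I * (2 * π * √(sqNorm m) : ℝ)‖ := by
      refine hs.trans (le_trans (le_of_eq ?_) (Complex.re_le_norm _))
      simp
    rw [h2, norm_mul]
    calc δ ^ 2 / (1 + R ^ 2) * (1 + sqNorm m) ≤ δ ^ 2 / (1 + R ^ 2) * (1 + R ^ 2) := by
          gcongr
          nlinarith
      _ = δ * δ := by field_simp
      _ ≤ _ := by gcongr

theorem norm_laplaceTerm_le {s : ℂ} {δ R : ℝ} (hδ : 0 < δ) (hs : δ ≤ s.re) (hR : ‖s‖ ≤ R)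
    (m : ℤ × ℤ) : ‖laplaceTerm s m‖ ≤
      (δ ^ 2 / (1 + R ^ 2)) ^ (-(3 / 2) : ℝ) * (1 + sqNorm m) ^ (-(3 / 2) : ℝ) := by
  have h0 := sqNorm_nonneg m
  unfold laplaceTerm
  split_ifs with hm
  · rw [norm_zero]; positivity
  · rw [Complex.norm_cpow_real, ← Real.mul_rpow (by positivity) (by positivity)]
    exact Real.rpow_le_rpow_of_nonpos (by positivity) (le_norm_sq_add hδ hs hR hm) (by norm_num)

theorem summable_laplaceTerm {s : ℂ} (hs : 0 < s.re) : Summable (laplaceTerm s) :=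
  Summable.of_norm_bounded (summable_one_add_sqNorm.mul_left _)
    (norm_laplaceTerm_le hs le_rfl le_rfl)

theorem differentiableOn_of_local {f : ℂ → ℂ}
    (h : ∀ δ R : ℝ, 0 < δ → DifferentiableOn ℂ f {s | δ < s.re ∧ ‖s‖ < R}) :
    DifferentiableOn ℂ f {s | 0 < s.re} := by
  intro s hs
  have hs' : 0 < s.re := hs
  have ho : IsOpen {z : ℂ | s.re / 2 < z.re ∧ ‖z‖ < ‖s‖ + 1} :=
    (isOpen_lt continuous_const Complex.continuous_re).inter
      (isOpen_lt continuous_norm continuous_const)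
  exact ((h (s.re / 2) (‖s‖ + 1) (by positivity)).differentiableAt
    (ho.mem_nhds ⟨by linarith, by linarith⟩)).differentiableWithinAt

theorem isOpen_strip (δ R : ℝ) : IsOpen {z : ℂ | δ < z.re ∧ ‖z‖ < R} :=
  (isOpen_lt continuous_const Complex.continuous_re).inter
    (isOpen_lt continuous_norm continuous_const)

theorem differentiableOn_tsum_laplaceTerm :
    DifferentiableOn ℂ (fun s => ∑' m, laplaceTerm s m) {s | 0 < s.re} := by
  refine differentiableOn_of_local fun δ R hδ => ?_
  refine Complex.differentiableOn_tsum_of_summable_norm (summable_one_add_sqNorm.mul_left _)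
    (fun m => ?_) (isOpen_strip δ R) (fun m s hs => norm_laplaceTerm_le hδ hs.1.le hs.2.le m)
  unfold laplaceTerm
  split_ifs with hm
  · exact differentiableOn_const _
  · refine DifferentiableOn.cpow (by fun_prop) (differentiableOn_const _) fun s hs => ?_
    exact sq_add_mem_slitPlane (hδ.trans hs.1) (by have := sqNorm_nonneg m; positivity)

theorem norm_exp_neg_mul_sqrt (s : ℂ) (m : ℤ × ℤ) :
    ‖Complex.exp (-(s * √(sqNorm m)))‖ = rexp (-(s.re * √(sqNorm m))) := by
  rw [Complex.norm_exp]; simp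

theorem differentiableOn_tsum_exp :
    DifferentiableOn ℂ (fun s => ∑' m : ℤ × ℤ, Complex.exp (-(s * √(sqNorm m))))
      {s | 0 < s.re} := by
  refine differentiableOn_of_local fun δ R hδ => ?_
  refine Complex.differentiableOn_tsum_of_summable_norm (summable_exp_neg_mul_sqrt_sqNorm hδ)
    (fun m => by fun_prop) (isOpen_strip δ R) (fun m s hs => ?_)
  rw [norm_exp_neg_mul_sqrt]
  have := hs.1.le
  gcongr

theorem frequently_ofReal_nhdsNE_one {p : ℂ → Prop} (h : ∀ x : ℝ, 0 < x → p x) :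
    ∃ᶠ z in nhdsWithin (1 : ℂ) {1}ᶜ, p z := by
  have h1 : Tendsto (fun x : ℝ => (x : ℂ)) (nhdsWithin 1 {1}ᶜ) (nhdsWithin 1 {1}ᶜ) := by
    refine tendsto_nhdsWithin_iff.2 ⟨?_, ?_⟩
    · exact (Complex.continuous_ofReal.tendsto' 1 1 (by simp)).mono_left nhdsWithin_le_nhds
    · filter_upwards [self_mem_nhdsWithin] with x hx
      simpa using hx
  refine h1.frequently (Eventually.frequently ?_)
  filter_upwards [nhdsWithin_le_nhds (lt_mem_nhds (zero_lt_one' ℝ))] with x hx using h x hx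

/-- Hardy's identity in the right half plane, with the term of the origin moved to the left. -/
theorem tsum_exp_eq_tsum_laplaceTerm {s : ℂ} (hs : 0 < s.re) :
    (∑' m : ℤ × ℤ, Complex.exp (-(s * √(sqNorm m)))) / s - 2 * π / s ^ 3 =
      2 * π * ∑' m, laplaceTerm s m := by
  have hne : ∀ s : ℂ, 0 < s.re → s ≠ 0 := by rintro s hs rfl; simp at hs
  have ho : IsOpen {s : ℂ | 0 < s.re} := isOpen_lt continuous_const Complex.continuous_re
  refine AnalyticOnNhd.eqOn_of_preconnected_of_frequently_eq (𝕜 := ℂ) (z₀ := 1)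
    (f := fun s => (∑' m : ℤ × ℤ, Complex.exp (-(s * √(sqNorm m)))) / s - 2 * π / s ^ 3)
    (g := fun s => 2 * π * ∑' m, laplaceTerm s m) (U := {s | 0 < s.re}) ?_ ?_
    (convex_halfSpace_re_gt 0).isPreconnected (by simp) ?_ hs
  · refine DifferentiableOn.analyticOnNhd ?_ ho
    refine (differentiableOn_tsum_exp.div differentiableOn_id hne).sub
      ((differentiableOn_const _).div (by fun_prop) fun s hs => pow_ne_zero _ (hne s hs))
  · exact DifferentiableOn.analyticOnNhd (differentiableOn_tsum_laplaceTerm.const_mul _) ho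
  · refine frequently_ofReal_nhdsNE_one fun x hx => ?_
    have h1 : ∑' m : ℤ × ℤ, Complex.exp (-((x : ℂ) * √(sqNorm m))) =
        ((∑' m : ℤ × ℤ, rexp (-(x * √(sqNorm m))) : ℝ) : ℂ) := by
      rw [Complex.ofReal_tsum]; push_cast; rfl
    have h2 : ∑' m, laplaceTerm x m = ((∑' m : ℤ × ℤ, if m = 0 then 0 else
        (x ^ 2 + 4 * π ^ 2 * sqNorm m) ^ (-(3 / 2) : ℝ) : ℝ) : ℂ) := by
      rw [Complex.ofReal_tsum]
      refine tsum_congr fun m => ?_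
      unfold laplaceTerm
      split_ifs with hm
      · simp
      · have := sqNorm_nonneg m
        rw [Complex.ofReal_cpow (by positivity)]
        push_cast; rfl
    rw [h1, h2, tsum_exp_neg_mul_sqrt_sqNorm hx,
      (summable_sq_add_sqNorm hx).tsum_eq_add_tsum_ite 0]
    have h3 : (x ^ 2 + 4 * π ^ 2 * sqNorm 0) ^ (-(3 / 2) : ℝ) = (x ^ 3)⁻¹ := by
      have : sqNorm 0 = 0 := by simp [sqNorm]
      rw [this, mul_zero, add_zero, ← Real.rpow_natCast x 2, ← Real.rpow_mul hx.le,
        ← Real.rpow_natCast x 3, ← Real.rpow_neg hx.le]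
      norm_num
    rw [h3]
    have hx0 : (x : ℂ) ≠ 0 := by exact_mod_cast hx.ne'
    push_cast
    field_simp
    ring

open MeasureTheory in
theorem integrableOn_pow_mul_exp_neg_mul {σ : ℝ} (hσ : 0 < σ) (n : ℕ) :
    IntegrableOn (fun u : ℝ => u ^ n * rexp (-(σ * u))) (Set.Ioi 0) := by
  have h := integrableOn_rpow_mul_exp_neg_mul_rpow (p := 1) (s := n) (b := σ)
    (by have : (0 : ℝ) ≤ n := Nat.cast_nonneg n
        linarith) one_pos hσ
  refine h.congr_fun (fun u _ => ?_) measurableSet_Ioi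
  simp

theorem norm_cexp_neg_mul (s : ℂ) (u : ℝ) : ‖Complex.exp (-(s * u))‖ = rexp (-(s.re * u)) := by
  rw [Complex.norm_exp]; simp

open MeasureTheory in
theorem integrableOn_pow_mul_cexp_neg_mul {s : ℂ} (hs : 0 < s.re) (n : ℕ) :
    IntegrableOn (fun u : ℝ => (u : ℂ) ^ n * Complex.exp (-(s * u))) (Set.Ioi 0) := by
  refine (integrableOn_pow_mul_exp_neg_mul hs n).mono' (by fun_prop) ?_
  filter_upwards [ae_restrict_mem measurableSet_Ioi] with u hu
  rw [norm_mul, norm_cexp_neg_mul, norm_pow, Complex.norm_real, Real.norm_of_nonneg (le_of_lt hu)]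

open MeasureTheory in
theorem integral_pow_mul_cexp_neg_mul {s : ℂ} (hs : 0 < s.re) (n : ℕ) :
    ∫ u : ℝ in Set.Ioi 0, (u : ℂ) ^ n * Complex.exp (-(s * u)) = n.factorial / s ^ (n + 1) := by
  have hs0 : s ≠ 0 := by rintro rfl; simp at hs
  induction n with
  | zero =>
    have h := integral_exp_mul_complex_Ioi (a := -s) (by simpa using hs) 0
    simpa [neg_mul] using h
  | succ n ih =>
    have hI := integrableOn_pow_mul_cexp_neg_mul hs n
    have hI' := integrableOn_pow_mul_cexp_neg_mul hs (n + 1)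
    have h := integral_Ioi_of_hasDerivAt_of_tendsto' (a := 0) (m := 0)
      (f := fun u : ℝ => (u : ℂ) ^ (n + 1) * Complex.exp (-(s * u)))
      (f' := fun u : ℝ => (n + 1) * ((u : ℂ) ^ n * Complex.exp (-(s * u))) -
        s * ((u : ℂ) ^ (n + 1) * Complex.exp (-(s * u)))) ?_ ?_ ?_
    · rw [integral_sub (hI.const_mul _) (hI'.const_mul _), integral_const_mul,
        integral_const_mul, ih] at h
      rw [Nat.factorial_succ]
      push_cast
      simp only [Complex.ofReal_zero, ne_eq, Nat.add_eq_zero_iff, one_ne_zero, and_false,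
        not_false_eq_true, zero_pow, zero_mul, sub_zero] at h
      rw [sub_eq_zero] at h
      rw [pow_succ s (n + 1), ← div_div, eq_div_iff hs0, mul_comm _ s, ← h]
      ring
    · intro u _
      have h1 : HasDerivAt (fun z : ℂ => z ^ (n + 1) * Complex.exp (-(s * z)))
          ((n + 1) * ((u : ℂ) ^ n * Complex.exp (-(s * u))) -
            s * ((u : ℂ) ^ (n + 1) * Complex.exp (-(s * u)))) (u : ℂ) := by
        have h2 := (hasDerivAt_pow (n + 1) (u : ℂ)).mul
          (((hasDerivAt_id (u : ℂ)).const_mul s).neg.cexp)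
        refine h2.congr_deriv ?_
        simp only [add_tsub_cancel_right, Pi.neg_apply, id]
        push_cast
        ring
      exact h1.comp_ofReal
    · exact (hI.const_mul _).sub (hI'.const_mul _)
    · rw [tendsto_zero_iff_norm_tendsto_zero]
      have h1 := tendsto_rpow_mul_exp_neg_mul_atTop_nhds_zero (n + 1 : ℕ) s.re hs
      refine h1.congr' ?_
      filter_upwards [eventually_ge_atTop 0] with u hu
      rw [norm_mul, norm_cexp_neg_mul, norm_pow, Complex.norm_real, Real.norm_of_nonneg hu,
        Real.rpow_natCast, neg_mul]

theorem finite_sqNorm_le (x : ℝ) : {m : ℤ × ℤ | sqNorm m ≤ x}.Finite := by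
  obtain ⟨K, hK⟩ := exists_nat_ge x
  refine ((Set.finite_Icc (-(K : ℤ)) K).prod (Set.finite_Icc (-(K : ℤ)) K)).subset ?_
  rintro ⟨a, b⟩ h
  have h1 : (a : ℝ) ^ 2 + (b : ℝ) ^ 2 ≤ K := le_trans h hK
  have h2 : a ^ 2 + b ^ 2 ≤ (K : ℤ) := by exact_mod_cast h1
  have h3 : |a| ≤ a ^ 2 := by rw [← sq_abs]; exact Int.le_self_sq _
  have h4 : |b| ≤ b ^ 2 := by rw [← sq_abs]; exact Int.le_self_sq _
  have h5 := sq_nonneg a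
  have h6 := sq_nonneg b
  simp only [Set.mem_prod, Set.mem_Icc]
  exact ⟨abs_le.1 (by linarith), abs_le.1 (by linarith)⟩

theorem monotone_latticeA : Monotone latticeA := fun _ y h =>
  Set.ncard_le_ncard (fun _ hm => le_trans hm h) (finite_sqNorm_le y)

theorem latticeA_sq_le {u : ℝ} (hu : 0 ≤ u) : (latticeA (u ^ 2) : ℝ) ≤ (2 * u + 1) ^ 2 := by
  set K := ⌊u⌋₊ with hK
  have h1 : latticeA (u ^ 2) ≤ (2 * K + 1) ^ 2 := by
    have h2 : {p : ℤ × ℤ | (p.1 : ℝ) ^ 2 + (p.2 : ℝ) ^ 2 ≤ u ^ 2} ⊆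
        ((Finset.Icc (-(K : ℤ)) K ×ˢ Finset.Icc (-(K : ℤ)) K : Finset (ℤ × ℤ)) : Set (ℤ × ℤ)) := by
      have h4 : ∀ a : ℤ, (a : ℝ) ^ 2 ≤ u ^ 2 → -(K : ℤ) ≤ a ∧ a ≤ K := by
        intro a ha
        have h5 : |(a : ℝ)| ≤ u := abs_le_of_sq_le_sq ha hu
        have h6 : a.natAbs ≤ K := Nat.le_floor (by rwa [Nat.cast_natAbs, Int.cast_abs])
        omega
      rintro ⟨a, b⟩ h
      simp only [Set.mem_ofPred_eq] at h
      simp only [Finset.coe_product, Set.mem_prod, Finset.coe_Icc, Set.mem_Icc]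
      exact ⟨h4 a (by nlinarith [sq_nonneg (b : ℝ)]), h4 b (by nlinarith [sq_nonneg (a : ℝ)])⟩
    refine (Set.ncard_le_ncard h2 (Finset.finite_toSet _)).trans (le_of_eq ?_)
    rw [Set.ncard_coe_finset, Finset.card_product, Int.card_Icc]
    have : ((K : ℤ) + 1 - -K).toNat = 2 * K + 1 := by omega
    rw [this, sq]
  have h2 : (K : ℝ) ≤ u := Nat.floor_le hu
  calc (latticeA (u ^ 2) : ℝ) ≤ (2 * K + 1) ^ 2 := by exact_mod_cast h1
    _ ≤ _ := by gcongr

theorem abs_latticeP_sq_le {u : ℝ} (hu : 0 ≤ u) : |latticeP (u ^ 2)| ≤ 4 * (1 + u) ^ 2 := by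
  have h1 := latticeA_sq_le hu
  have h2 : (0 : ℝ) ≤ latticeA (u ^ 2) := Nat.cast_nonneg _
  have h3 := Real.pi_le_four
  have h4 := Real.pi_pos
  have h5 : π * u ^ 2 ≤ 4 * u ^ 2 := by gcongr
  have h6 : 0 ≤ π * u ^ 2 := by positivity
  unfold latticeP
  rw [abs_le]
  constructor <;> nlinarith

theorem latticeA_eq_tsum (x : ℝ) :
    (latticeA x : ℂ) = ∑' m : ℤ × ℤ, if sqNorm m ≤ x then 1 else 0 := by
  rw [tsum_eq_sum (s := (finite_sqNorm_le x).toFinset) (by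
    intro m hm
    rw [if_neg]
    simpa using hm)]
  rw [Finset.sum_congr rfl (fun m hm => if_pos (by simpa using hm)), Finset.sum_const,
    nsmul_eq_mul, mul_one, ← Set.ncard_eq_toFinset_card _ (finite_sqNorm_le x)]
  rfl

theorem measurable_latticeP_sq : Measurable fun u : ℝ => latticeP (u ^ 2) := by
  have h1 : Measurable fun x : ℝ => (latticeA x : ℝ) := by
    refine Monotone.measurable fun x y h => ?_
    exact_mod_cast monotone_latticeA h
  unfold latticeP
  exact (h1.comp (by fun_prop)).sub (by fun_prop)

open MeasureTheory in
theorem integrableOn_latticeP_mul_exp {σ : ℝ} (hσ : 0 < σ) :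
    IntegrableOn (fun u : ℝ => latticeP (u ^ 2) * rexp (-(σ * u))) (Set.Ioi 0) := by
  have h := (((integrableOn_pow_mul_exp_neg_mul hσ 0).const_mul 4).add
    ((integrableOn_pow_mul_exp_neg_mul hσ 1).const_mul 8)).add
    ((integrableOn_pow_mul_exp_neg_mul hσ 2).const_mul 4)
  refine h.mono' (measurable_latticeP_sq.mul (by fun_prop)).aestronglyMeasurable ?_
  filter_upwards [ae_restrict_mem measurableSet_Ioi] with u hu
  have h1 := abs_latticeP_sq_le (le_of_lt hu)
  rw [norm_mul, Real.norm_of_nonneg (Real.exp_pos _).le, Real.norm_eq_abs]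
  calc |latticeP (u ^ 2)| * rexp (-(σ * u)) ≤ (4 * (1 + u) ^ 2) * rexp (-(σ * u)) := by gcongr
    _ = _ := by simp only [Pi.add_apply]; ring

open MeasureTheory in
theorem integrableOn_latticeP_mul_cexp {s : ℂ} (hs : 0 < s.re) :
    IntegrableOn (fun u : ℝ => (latticeP (u ^ 2) : ℂ) * Complex.exp (-(s * u))) (Set.Ioi 0) := by
  refine (integrableOn_latticeP_mul_exp hs).norm.mono' ?_ (ae_of_all _ fun u => ?_)
  · exact ((Complex.measurable_ofReal.comp measurable_latticeP_sq).mul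
      (by fun_prop)).aestronglyMeasurable
  · rw [norm_mul, norm_cexp_neg_mul, Complex.norm_real, norm_mul,
      Real.norm_of_nonneg (Real.exp_pos _).le]

open MeasureTheory in
theorem integral_latticeA_mul_cexp {s : ℂ} (hs : 0 < s.re) :
    ∫ u : ℝ in Set.Ioi 0, (latticeA (u ^ 2) : ℂ) * Complex.exp (-(s * u)) =
      (∑' m : ℤ × ℤ, Complex.exp (-(s * √(sqNorm m)))) / s := by
  set F : ℤ × ℤ → ℝ → ℂ := fun m =>
    (Set.Ici √(sqNorm m)).indicator fun u : ℝ => Complex.exp (-(s * u)) with hF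
  have hset : ∀ c : ℝ, 0 ≤ c → (Set.Ioi 0 ∩ Set.Ici c : Set ℝ) =ᵐ[volume] Set.Ioi c := by
    intro c hc
    have := (ae_eq_refl (Set.Ioi (0 : ℝ))).inter (Ioi_ae_eq_Ici (μ := volume) (a := c)).symm
    rwa [Set.Ioi_inter_Ioi, sup_of_le_right hc] at this
  have hfi : ∀ m, IntegrableOn (F m) (Set.Ioi 0) := fun m => by
    have := integrableOn_pow_mul_cexp_neg_mul hs 0
    simp only [pow_zero, one_mul] at this
    exact this.indicator measurableSet_Ici
  have hval : ∀ m, ∫ u in Set.Ioi 0, F m u = Complex.exp (-(s * √(sqNorm m))) / s := fun m => by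
    rw [hF, setIntegral_indicator measurableSet_Ici, setIntegral_congr_set
      (hset _ (Real.sqrt_nonneg _))]
    have := integral_exp_mul_complex_Ioi (a := -s) (by simpa using hs) √(sqNorm m)
    simp only [neg_mul] at this
    rw [this, neg_div_neg_eq]
  have hnorm : ∀ m, ∫ u in Set.Ioi 0, ‖F m u‖ = rexp (-(s.re * √(sqNorm m))) / s.re := fun m => by
    have h1 : ∀ u, ‖F m u‖ = (Set.Ici √(sqNorm m)).indicator (fun u => rexp (-(s.re * u))) u := by
      intro u
      rw [hF, norm_indicator_eq_indicator_norm]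
      simp only [norm_cexp_neg_mul]
    simp_rw [h1]
    rw [setIntegral_indicator measurableSet_Ici, setIntegral_congr_set
      (hset _ (Real.sqrt_nonneg _))]
    have := integral_exp_mul_Ioi (a := -s.re) (by simpa using hs) √(sqNorm m)
    simp only [neg_mul] at this
    rw [this, neg_div_neg_eq]
  have h := hasSum_integral_of_summable_integral_norm (μ := volume.restrict (Set.Ioi 0)) hfi
    (by simp_rw [hnorm]; exact (summable_exp_neg_mul_sqrt_sqNorm hs).div_const _)
  simp_rw [hval] at h
  rw [← tsum_div_const, h.tsum_eq]
  refine setIntegral_congr_fun measurableSet_Ioi fun u hu => ?_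
  simp only [latticeA_eq_tsum]
  rw [← tsum_mul_right]
  refine tsum_congr fun m => ?_
  simp only [hF, Set.indicator_apply, Set.mem_Ici]
  simp only [Real.sqrt_le_left (le_of_lt hu)]
  split_ifs <;> simp

open MeasureTheory in
/-- The Laplace transform of `u ↦ P(u²)`. -/
theorem integral_latticeP_mul_cexp {s : ℂ} (hs : 0 < s.re) :
    ∫ u : ℝ in Set.Ioi 0, (latticeP (u ^ 2) : ℂ) * Complex.exp (-(s * u)) =
      2 * π * ∑' m, laplaceTerm s m := by
  have hA := integral_latticeA_mul_cexp hs
  have h2 := integral_pow_mul_cexp_neg_mul hs 2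
  have hI2 := (integrableOn_pow_mul_cexp_neg_mul hs 2).const_mul (π : ℂ)
  rw [← tsum_exp_eq_tsum_laplaceTerm hs, ← hA]
  have h3 : 2 * π / s ^ 3 = ∫ u : ℝ in Set.Ioi 0, π * ((u : ℂ) ^ 2 * Complex.exp (-(s * u))) := by
    rw [integral_const_mul, h2]
    norm_num
    ring
  rw [h3, ← integral_sub _ hI2]
  · refine setIntegral_congr_fun measurableSet_Ioi fun u _ => ?_
    simp only [latticeP]
    push_cast
    ring
  · refine ((integrableOn_latticeP_mul_cexp hs).add hI2).congr (ae_of_all _ fun u => ?_)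
    simp only [latticeP, Pi.add_apply]
    push_cast
    ring

/-- The Fourier coefficients of `θ ↦ 1 + cos (θ - 3 * π / 4)`. -/
noncomputable def rieszCoeff (e : ℤ) : ℂ :=
  (1 / 2) ^ e.natAbs * Complex.exp (-(3 * π / 4 * e : ℝ) * Complex.I)

theorem rieszCoeff_zero : rieszCoeff 0 = 1 := by simp [rieszCoeff]

theorem norm_rieszCoeff (e : ℤ) : ‖rieszCoeff e‖ = (1 / 2) ^ e.natAbs := by
  unfold rieszCoeff
  rw [norm_mul, ← Complex.ofReal_neg, Complex.norm_exp_ofReal_mul_I]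
  simp

theorem one_add_cos_eq_sum (θ : ℝ) : ((1 + cos (θ - 3 * π / 4) : ℝ) : ℂ) =
    ∑ e ∈ ({-1, 0, 1} : Finset ℤ), rieszCoeff e * Complex.exp ((e * θ : ℝ) * Complex.I) := by
  rw [Finset.sum_insert (by decide), Finset.sum_insert (by decide), Finset.sum_singleton]
  unfold rieszCoeff
  push_cast
  rw [Complex.cos]
  simp only [pow_one, pow_zero, one_mul, mul_assoc,
    ← Complex.exp_add]
  simp only [mul_zero, neg_zero, zero_mul, add_zero, Complex.exp_zero]
  ring_nf

theorem re_rieszCoeff_one_mul_cpow {σ r : ℝ} (hσ : 0 < σ) (hσ1 : σ ≤ 1) (hr : 1 ≤ r) :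
    1 / 8 * (14 * σ * r) ^ (-(3 / 2) : ℝ) ≤ (rieszCoeff 1 *
      ((σ ^ 2 : ℝ) - (4 * π * σ * r : ℝ) * Complex.I) ^ ((-(3 / 2) : ℝ) : ℂ)).re := by
  set z : ℂ := (σ ^ 2 : ℝ) - (4 * π * σ * r : ℝ) * Complex.I with hz
  have hpi := Real.pi_gt_three
  have hpi' := Real.pi_lt_d2
  have hre : z.re = σ ^ 2 := by simp [hz, sq]
  have him : z.im = -(4 * π * σ * r) := by simp [hz, sq]
  have hσr : σ ≤ σ * r := le_mul_of_one_le_right hσ.le hr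
  have hσr0 : 0 < σ * r := by positivity
  have hz0 : z ≠ 0 := by
    intro h
    rw [h] at hre
    exact (by positivity : 0 < σ ^ 2).ne (by simpa using hre)
  have hnorm : ‖z‖ ≤ 14 * σ * r := by
    refine (Complex.norm_le_abs_re_add_abs_im z).trans ?_
    rw [hre, him, abs_neg, abs_of_nonneg (by positivity), abs_of_nonneg (by positivity)]
    nlinarith
  have harg1 : -(π / 2) ≤ z.arg := by
    have := (Complex.abs_arg_le_pi_div_two_iff (z := z)).2 (by rw [hre]; positivity)
    exact (abs_le.1 this).1
  have harg2 : z.arg ≤ -(π / 4) := by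
    rw [Complex.arg_of_re_nonneg (by rw [hre]; positivity)]
    rw [Real.arcsin_le_iff_le_sin' ⟨by linarith, by linarith⟩, Real.sin_neg, Real.sin_pi_div_four,
      div_le_iff₀ (norm_pos_iff.2 hz0), him]
    have h1 : √2 * ‖z‖ ≤ 2 * (4 * π * σ * r) := by
      rw [Complex.norm_def, ← Real.sqrt_mul (by norm_num)]
      refine Real.sqrt_le_iff.2 ⟨by positivity, ?_⟩
      rw [Complex.normSq_apply, hre, him]
      have : (σ ^ 2) * (σ ^ 2) ≤ (4 * π * σ * r) * (4 * π * σ * r) := by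
        gcongr <;> nlinarith
      nlinarith
    linarith
  have key : (rieszCoeff 1 * z ^ ((-(3 / 2) : ℝ) : ℂ)).re =
      1 / 2 * ‖z‖ ^ (-(3 / 2) : ℝ) * cos (-(3 * π / 4) - 3 / 2 * z.arg) := by
    have h1 : z ^ ((-(3 / 2) : ℝ) : ℂ) = (‖z‖ ^ (-(3 / 2) : ℝ) : ℝ) *
        Complex.exp ((-(3 / 2) * z.arg : ℝ) * Complex.I) := by
      conv_lhs => rw [← Complex.norm_mul_exp_arg_mul_I z]
      rw [Complex.norm_mul_exp_arg_mul_I, Complex.cpow_def_of_ne_zero hz0, Complex.log,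
        Real.rpow_def_of_pos (norm_pos_iff.2 hz0), Complex.ofReal_exp, ← Complex.exp_add]
      congr 1
      push_cast
      ring
    rw [h1]
    unfold rieszCoeff
    have h2 : (1 / 2 : ℂ) ^ (1 : ℤ).natAbs * Complex.exp (-(3 * π / 4 * (1 : ℤ) : ℝ) * Complex.I) *
        ((‖z‖ ^ (-(3 / 2) : ℝ) : ℝ) * Complex.exp ((-(3 / 2) * z.arg : ℝ) * Complex.I)) =
        (1 / 2 * ‖z‖ ^ (-(3 / 2) : ℝ) : ℝ) *
          Complex.exp ((-(3 * π / 4) - 3 / 2 * z.arg : ℝ) * Complex.I) := by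
      have : ((-(3 * π / 4) - 3 / 2 * z.arg : ℝ) : ℂ) * Complex.I =
          -(3 * π / 4 * (1 : ℤ) : ℝ) * Complex.I + (-(3 / 2) * z.arg : ℝ) * Complex.I := by
        push_cast; ring
      rw [this, Complex.exp_add]
      push_cast
      simp
      ring
    rw [h2, Complex.re_ofReal_mul, Complex.exp_ofReal_mul_I_re]
  rw [key]
  have hcos : 1 / 4 ≤ cos (-(3 * π / 4) - 3 / 2 * z.arg) := by
    rw [← Real.cos_neg]
    refine le_trans ?_ (Real.one_sub_mul_le_cos (by linarith) (by linarith))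
    rw [div_mul_eq_mul_div, le_sub_comm, div_le_iff₀ (by positivity)]
    linarith
  have hpow : (14 * σ * r) ^ (-(3 / 2) : ℝ) ≤ ‖z‖ ^ (-(3 / 2) : ℝ) :=
    Real.rpow_le_rpow_of_nonpos (norm_pos_iff.2 hz0) hnorm (by norm_num)
  calc 1 / 8 * (14 * σ * r) ^ (-(3 / 2) : ℝ) = 1 / 2 * (14 * σ * r) ^ (-(3 / 2) : ℝ) * (1 / 4) := by
        ring
    _ ≤ _ := by gcongr

theorem re_rieszCoeff_mul_cpow {σ r : ℝ} (hσ : 0 < σ) (hσ1 : σ ≤ 1) (hr : 1 ≤ r) {e : ℤ}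
    (he : e = 1 ∨ e = -1) :
    1 / 8 * (14 * σ * r) ^ (-(3 / 2) : ℝ) ≤ (rieszCoeff e *
      ((σ ^ 2 : ℝ) - (4 * π * σ * (e * r) : ℝ) * Complex.I) ^ ((-(3 / 2) : ℝ) : ℂ)).re := by
  rcases he with rfl | rfl
  · simpa using re_rieszCoeff_one_mul_cpow hσ hσ1 hr
  · refine (re_rieszCoeff_one_mul_cpow hσ hσ1 hr).trans (le_of_eq ?_)
    rw [← Complex.conj_re, map_mul]
    congr 2
    · simp only [rieszCoeff, map_mul, ← Complex.exp_conj]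
      simp [map_ofNat]
    · rw [← Complex.conj_ofReal (-(3 / 2)), ← Complex.conj_cpow, Complex.conj_ofReal]
      · simp [map_ofNat]
      · intro h
        have h1 := (Complex.arg_eq_pi_iff.1 h).1
        have h2 : 0 < σ ^ 2 := by positivity
        simp [sq] at h1
        nlinarith

section Riesz

variable {ι : Type*} [Fintype ι]

/-- A Riesz product with frequencies `r i`. -/
noncomputable def rieszProd (r : ι → ℝ) (u : ℝ) : ℝ :=
  ∏ i, (1 + cos (2 * π * r i * u - 3 * π / 4))

/-- The coefficients of a Riesz product. -/
noncomputable def rieszProdCoeff (ε : ι → ℤ) : ℂ := ∏ i, rieszCoeff (ε i)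

/-- The frequencies in the expansion of a Riesz product. -/
def signSum (r : ι → ℝ) (ε : ι → ℤ) : ℝ := ∑ i, ε i * r i

theorem rieszProd_nonneg (r : ι → ℝ) (u : ℝ) : 0 ≤ rieszProd r u :=
  Finset.prod_nonneg fun i _ => by linarith [Real.neg_one_le_cos (2 * π * r i * u - 3 * π / 4)]

theorem rieszProd_le (r : ι → ℝ) (u : ℝ) : rieszProd r u ≤ 2 ^ Fintype.card ι := by
  unfold rieszProd
  refine (Finset.prod_le_prod (fun i _ => ?_) (fun i _ => ?_)).trans_eq
    ((Finset.prod_const (2 : ℝ)).trans (by rw [Finset.card_univ]))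
  · linarith [Real.neg_one_le_cos (2 * π * r i * u - 3 * π / 4)]
  · linarith [Real.cos_le_one (2 * π * r i * u - 3 * π / 4)]

theorem continuous_rieszProd (r : ι → ℝ) : Continuous (rieszProd r) := by
  unfold rieszProd
  fun_prop

theorem rieszProdCoeff_zero : rieszProdCoeff (0 : ι → ℤ) = 1 := by
  simp [rieszProdCoeff, rieszCoeff_zero]

variable [DecidableEq ι]

/-- The vectors with entries in `{-1, 0, 1}`. -/
def signBox (ι : Type*) [Fintype ι] [DecidableEq ι] : Finset (ι → ℤ) :=
  Fintype.piFinset fun _ => {-1, 0, 1}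

theorem abs_le_one_of_mem_signBox {ε : ι → ℤ} (hε : ε ∈ signBox ι) (i : ι) : |ε i| ≤ 1 := by
  have := Fintype.mem_piFinset.1 hε i
  simp only [Finset.mem_insert, Finset.mem_singleton] at this
  rcases this with h | h | h <;> simp [h]

theorem single_mem_signBox (i : ι) : Pi.single i 1 ∈ signBox ι := by
  refine Fintype.mem_piFinset.2 fun j => ?_
  by_cases h : j = i
  · subst h; simp
  · simp [Pi.single_eq_of_ne h]

theorem zero_mem_signBox : (0 : ι → ℤ) ∈ signBox ι := Fintype.mem_piFinset.2 fun j => by simp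

theorem rieszProd_eq_sum (r : ι → ℝ) (u : ℝ) : (rieszProd r u : ℂ) =
    ∑ ε ∈ signBox ι, rieszProdCoeff ε *
      Complex.exp ((2 * π * signSum r ε * u : ℝ) * Complex.I) := by
  unfold rieszProd
  rw [Complex.ofReal_prod]
  simp_rw [one_add_cos_eq_sum]
  rw [Finset.prod_univ_sum]
  refine Finset.sum_congr rfl fun ε _ => ?_
  rw [Finset.prod_mul_distrib, ← Complex.exp_sum]
  unfold rieszProdCoeff signSum
  congr 2
  rw [← Finset.sum_mul, ← Complex.ofReal_sum, Finset.mul_sum, Finset.sum_mul]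
  congr 2
  exact Finset.sum_congr rfl fun i _ => by ring

theorem sum_norm_rieszProdCoeff :
    ∑ ε ∈ signBox ι, ‖rieszProdCoeff ε‖ = 2 ^ Fintype.card ι := by
  unfold rieszProdCoeff signBox
  simp_rw [norm_prod, norm_rieszCoeff]
  rw [← Finset.prod_univ_sum (fun _ : ι => ({-1, 0, 1} : Finset ℤ))
    (fun _ e => (1 / 2 : ℝ) ^ e.natAbs), Finset.prod_const, Finset.card_univ]
  congr 1
  rw [Finset.sum_insert (by decide), Finset.sum_insert (by decide), Finset.sum_singleton]
  norm_num

theorem rieszProdCoeff_single (i : ι) (e : ℤ) : rieszProdCoeff (Pi.single i e) = rieszCoeff e := by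
  unfold rieszProdCoeff
  rw [Fintype.prod_eq_single i (fun j hj => by rw [Pi.single_eq_of_ne hj, rieszCoeff_zero]),
    Pi.single_eq_same]

theorem signSum_single (r : ι → ℝ) (i : ι) (e : ℤ) : signSum r (Pi.single i e) = e * r i := by
  unfold signSum
  rw [Fintype.sum_eq_single i (fun j hj => by rw [Pi.single_eq_of_ne hj]; simp),
    Pi.single_eq_same]

open MeasureTheory in
theorem integral_mul_rieszProd {f : ℝ → ℝ} {F : ℂ → ℂ}
    (hfi : ∀ s : ℂ, 0 < s.re →
      IntegrableOn (fun u : ℝ => (f u : ℂ) * Complex.exp (-(s * u))) (Set.Ioi 0))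
    (hF : ∀ s : ℂ, 0 < s.re →
      ∫ u : ℝ in Set.Ioi 0, (f u : ℂ) * Complex.exp (-(s * u)) = F s)
    (r : ι → ℝ) {σ : ℝ} (hσ : 0 < σ) :
    ((∫ u in Set.Ioi 0, f u * rexp (-(σ * u)) * rieszProd r u : ℝ) : ℂ) =
      ∑ ε ∈ signBox ι, rieszProdCoeff ε * F (σ - (2 * π * signSum r ε : ℝ) * Complex.I) := by
  have hre : ∀ ε : ι → ℤ, 0 < ((σ : ℂ) - (2 * π * signSum r ε : ℝ) * Complex.I).re := by
    intro ε
    rw [Complex.sub_re, Complex.re_ofReal_mul]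
    simpa using hσ
  rw [← integral_complex_ofReal]
  simp_rw [← hF _ (hre _), ← integral_const_mul]
  rw [← integral_finsetSum _ fun ε _ => (hfi _ (hre ε)).const_mul _]
  refine setIntegral_congr_fun measurableSet_Ioi fun u _ => ?_
  rw [Complex.ofReal_mul, Complex.ofReal_mul, rieszProd_eq_sum, Finset.mul_sum]
  refine Finset.sum_congr rfl fun ε _ => ?_
  have : -(((σ : ℂ) - (2 * π * signSum r ε : ℝ) * Complex.I) * u) =
      ((-(σ * u) : ℝ) : ℂ) + (2 * π * signSum r ε * u : ℝ) * Complex.I := by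
    push_cast; ring
  rw [this, Complex.exp_add, Complex.ofReal_exp]
  push_cast
  ring

theorem exists_nat_sqNorm_eq (m : ℤ × ℤ) : ∃ n : ℕ, sqNorm m = n := by
  refine ⟨(m.1 ^ 2 + m.2 ^ 2).natAbs, ?_⟩
  have h : (0 : ℤ) ≤ m.1 ^ 2 + m.2 ^ 2 := by positivity
  unfold sqNorm
  rw [Nat.cast_natAbs, abs_of_nonneg h]
  push_cast
  rfl

/-- The only near coincidences between squares of signed sums of the `r i` and integers are the
trivial ones. -/
def SignSumGap (r : ι → ℝ) (g : ℝ) : Prop :=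
  ∀ ε : ι → ℤ, (∀ i, |ε i| ≤ 1) → ∀ n : ℕ, g * (1 + n) ≤ |(n : ℝ) - signSum r ε ^ 2| ∨
    (n : ℝ) = signSum r ε ^ 2 ∧ (ε = 0 ∨ ∃ i, ε = Pi.single i 1 ∨ ε = Pi.single i (-1))

theorem re_mul_laplaceTerm_single {r : ι → ℝ} {σ : ℝ} (hσ : 0 < σ) (hσ1 : σ ≤ 1) {i : ι}
    (hr : 1 ≤ r i) {e : ℤ} (he : e = 1 ∨ e = -1) {m : ℤ × ℤ} (hm : sqNorm m = r i ^ 2) :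
    1 / 8 * (14 * σ * r i) ^ (-(3 / 2) : ℝ) ≤ (rieszProdCoeff (Pi.single i e : ι → ℤ) *
      laplaceTerm (σ - (2 * π * signSum r (Pi.single i e) : ℝ) * Complex.I) m).re := by
  have hm0 : m ≠ 0 := by
    rintro rfl
    have : sqNorm 0 = 0 := by simp [sqNorm]
    nlinarith
  rw [rieszProdCoeff_single, signSum_single, laplaceTerm, if_neg hm0]
  refine (re_rieszCoeff_mul_cpow hσ hσ1 hr he).trans (le_of_eq ?_)
  congr 3
  have he2 : (e : ℂ) ^ 2 = 1 := by rcases he with rfl | rfl <;> simp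
  rw [hm]
  push_cast
  linear_combination (-4 * (π : ℂ) ^ 2 * e ^ 2 * (r i : ℂ) ^ 2) * Complex.I_sq +
    4 * (π : ℂ) ^ 2 * (r i : ℂ) ^ 2 * he2

theorem neg_le_re_mul_laplaceTerm {r : ι → ℝ} (hr : ∀ i, 1 ≤ r i) {g σ : ℝ} (hg : 0 < g)
    (hgap : SignSumGap r g) (hσ : 0 < σ) (hσ1 : σ ≤ 1) (hσg : σ ^ 2 ≤ g) {ε : ι → ℤ}
    (hε : ∀ i, |ε i| ≤ 1) (m : ℤ × ℤ) :
    -(‖rieszProdCoeff ε‖ * g ^ (-(3 / 2) : ℝ) * (1 + sqNorm m) ^ (-(3 / 2) : ℝ)) ≤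
      (rieszProdCoeff ε *
        laplaceTerm (σ - (2 * π * signSum r ε : ℝ) * Complex.I) m).re := by
  have hN := sqNorm_nonneg m
  have hneg : -(‖rieszProdCoeff ε‖ * g ^ (-(3 / 2) : ℝ) * (1 + sqNorm m) ^ (-(3 / 2) : ℝ)) ≤ 0 := by
    rw [neg_nonpos]; positivity
  by_cases hm0 : m = 0
  · rw [laplaceTerm, if_pos hm0]; simpa using hneg
  obtain ⟨n, hn⟩ := exists_nat_sqNorm_eq m
  rcases hgap ε hε n with h | ⟨h, h' | ⟨i, h' | h'⟩⟩
  · refine le_trans (neg_le_neg ?_) (neg_le_of_abs_le (Complex.abs_re_le_norm _))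
    rw [norm_mul, mul_assoc ‖rieszProdCoeff ε‖]
    refine mul_le_mul_of_nonneg_left ?_ (norm_nonneg (rieszProdCoeff ε))
    rw [laplaceTerm, if_neg hm0, Complex.norm_cpow_real, ← Real.mul_rpow hg.le (by positivity)]
    refine Real.rpow_le_rpow_of_nonpos (by positivity) ?_ (by norm_num)
    refine le_trans ?_ (Complex.abs_re_le_norm _)
    have hre : (((σ : ℂ) - (2 * π * signSum r ε : ℝ) * Complex.I) ^ 2 +
        (4 * π ^ 2 * sqNorm m : ℝ)).re = σ ^ 2 + 4 * π ^ 2 * (n - signSum r ε ^ 2) := by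
      rw [Complex.add_re, Complex.ofReal_re, hn, sq, Complex.mul_re]
      simp only [Complex.sub_re, Complex.sub_im, Complex.re_ofReal_mul, Complex.im_ofReal_mul,
        Complex.ofReal_re, Complex.ofReal_im, Complex.I_re, Complex.I_im]
      ring
    rw [hre]
    have h1 := abs_sub_abs_le_abs_sub (4 * π ^ 2 * ((n : ℝ) - signSum r ε ^ 2)) (-(σ ^ 2))
    rw [sub_neg_eq_add, abs_neg, abs_mul, abs_of_pos (by positivity : 0 < 4 * π ^ 2),
      abs_of_nonneg (sq_nonneg σ)] at h1
    rw [add_comm (σ ^ 2), hn]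
    refine le_trans ?_ h1
    have hpi := Real.pi_gt_three
    have h2 : 36 * (g * (1 + n)) ≤ 4 * π ^ 2 * |(n : ℝ) - signSum r ε ^ 2| := by
      gcongr; nlinarith
    have h3 : g ≤ g * (1 + n) := le_mul_of_one_le_right hg.le (by simp)
    linarith
  · exfalso
    have h1 := one_le_sqNorm hm0
    rw [hn, h, h'] at h1
    simp [signSum] at h1
    linarith
  all_goals
    subst h'
    refine le_trans (hneg.trans ?_) (re_mul_laplaceTerm_single hσ hσ1 (hr i) (by simp) ?_)
    · have := hr i
      positivity
    · rw [hn, h, signSum_single]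
      simp

end Riesz

section Bounds

variable {ι : Type*} [DecidableEq ι]

theorem single_one_inj {i j : ι} (h : (Pi.single i 1 : ι → ℤ) = Pi.single j 1) : i = j := by
  by_contra hij
  have := congrFun h i
  rw [Pi.single_eq_same, Pi.single_eq_of_ne hij] at this
  exact one_ne_zero this

variable [Fintype ι]

theorem re_sub_mul_I (σ x : ℝ) : ((σ : ℂ) - (x : ℝ) * Complex.I).re = σ := by
  rw [Complex.sub_re, Complex.re_ofReal_mul]
  simp

theorem le_re_mul_tsum_laplaceTerm {r : ι → ℝ} (hr : ∀ i, 1 ≤ r i)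
    (hrm : ∀ i, ∃ m, sqNorm m = r i ^ 2) {g σ : ℝ} (hg : 0 < g)
    (hgap : SignSumGap r g) (hσ : 0 < σ) (hσ1 : σ ≤ 1) (hσg : σ ^ 2 ≤ g) {ε : ι → ℤ}
    (hε : ∀ i, |ε i| ≤ 1) :
    (∑ i, if ε = Pi.single i 1 then 1 / 8 * (14 * σ * r i) ^ (-(3 / 2) : ℝ) else 0) -
      ‖rieszProdCoeff ε‖ * (g ^ (-(3 / 2) : ℝ) * ∑' m, (1 + sqNorm m) ^ (-(3 / 2) : ℝ)) ≤
      (rieszProdCoeff ε * ∑' m,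
        laplaceTerm (σ - (2 * π * signSum r ε : ℝ) * Complex.I) m).re := by
  set s : ℂ := σ - (2 * π * signSum r ε : ℝ) * Complex.I with hs
  have hsum := (summable_laplaceTerm (s := s) (by rwa [hs, re_sub_mul_I])).mul_left
    (rieszProdCoeff ε)
  have hre := Complex.hasSum_re hsum.hasSum
  have hZ := (summable_one_add_sqNorm.mul_left (‖rieszProdCoeff ε‖ * g ^ (-(3 / 2) : ℝ)))
  have h := hre.add hZ.hasSum
  rw [tsum_mul_left, tsum_mul_left] at h
  have hnn : ∀ m, 0 ≤ (rieszProdCoeff ε * laplaceTerm s m).re +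
      ‖rieszProdCoeff ε‖ * g ^ (-(3 / 2) : ℝ) * (1 + sqNorm m) ^ (-(3 / 2) : ℝ) := fun m => by
    linarith [neg_le_re_mul_laplaceTerm hr hg hgap hσ hσ1 hσg hε m]
  rw [sub_le_iff_le_add, ← mul_assoc]
  by_cases hi : ∃ i, ε = Pi.single i 1
  · obtain ⟨i, rfl⟩ := hi
    obtain ⟨m, hm⟩ := hrm i
    rw [Fintype.sum_eq_single i (fun j hj => if_neg fun h => hj (single_one_inj h).symm),
      if_pos rfl]
    refine le_trans ?_ (le_hasSum h m fun m' _ => hnn m')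
    have := re_mul_laplaceTerm_single hσ hσ1 (hr i) (Or.inl rfl) hm
    have h2 := sqNorm_nonneg m
    have h3 : 0 ≤ ‖rieszProdCoeff (Pi.single i 1 : ι → ℤ)‖ * g ^ (-(3 / 2) : ℝ) *
      (1 + sqNorm m) ^ (-(3 / 2) : ℝ) := by positivity
    linarith
  · push Not at hi
    rw [Finset.sum_eq_zero fun i _ => if_neg (hi i)]
    exact h.nonneg hnn

open MeasureTheory in
theorem le_integral_latticeP_mul_rieszProd {r : ι → ℝ} (hr : ∀ i, 1 ≤ r i)
    (hrm : ∀ i, ∃ m, sqNorm m = r i ^ 2) {g σ : ℝ} (hg : 0 < g)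
    (hgap : SignSumGap r g) (hσ : 0 < σ) (hσ1 : σ ≤ 1) (hσg : σ ^ 2 ≤ g) :
    2 * π * ((∑ i, 1 / 8 * (14 * σ * r i) ^ (-(3 / 2) : ℝ)) -
      2 ^ Fintype.card ι * (g ^ (-(3 / 2) : ℝ) * ∑' m, (1 + sqNorm m) ^ (-(3 / 2) : ℝ))) ≤
      ∫ u in Set.Ioi 0, latticeP (u ^ 2) * rexp (-(σ * u)) * rieszProd r u := by
  have h := integral_mul_rieszProd (f := fun u => latticeP (u ^ 2))
    (fun s hs => integrableOn_latticeP_mul_cexp hs) (fun s hs => integral_latticeP_mul_cexp hs) r hσ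
  have h2 := congrArg Complex.re h
  rw [Complex.ofReal_re] at h2
  rw [h2, Complex.re_sum]
  have h3 : ∀ ε ∈ signBox ι, (rieszProdCoeff ε * (2 * π *
      ∑' m, laplaceTerm (σ - (2 * π * signSum r ε : ℝ) * Complex.I) m)).re =
      2 * π * (rieszProdCoeff ε *
        ∑' m, laplaceTerm (σ - (2 * π * signSum r ε : ℝ) * Complex.I) m).re := fun ε _ => by
    rw [← Complex.re_ofReal_mul]
    congr 1
    push_cast
    ring
  rw [Finset.sum_congr rfl h3, ← Finset.mul_sum (signBox ι)]
  refine mul_le_mul_of_nonneg_left ?_ (by positivity : (0 : ℝ) ≤ 2 * π)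
  refine le_trans (le_of_eq ?_) (Finset.sum_le_sum fun ε hε =>
    le_re_mul_tsum_laplaceTerm hr hrm hg hgap hσ hσ1 hσg (abs_le_one_of_mem_signBox hε))
  rw [Finset.sum_sub_distrib, ← Finset.sum_mul, sum_norm_rieszProdCoeff, Finset.sum_comm]
  congr 1
  refine Finset.sum_congr rfl fun i _ => ?_
  rw [Finset.sum_ite_eq' , if_pos (single_mem_signBox i)]

theorem gap_le_sq_signSum {r : ι → ℝ} (hr : ∀ i, 1 ≤ r i) {g : ℝ} (hg1 : g ≤ 1)
    (hgap : SignSumGap r g) {ε : ι → ℤ} (hε : ∀ i, |ε i| ≤ 1) (h0 : ε ≠ 0) :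
    g ≤ signSum r ε ^ 2 := by
  rcases hgap ε hε 0 with h | ⟨h, h' | ⟨i, h' | h'⟩⟩
  · simpa using h
  · exact absurd h' h0
  all_goals
    rw [h', signSum_single]
    have := hr i
    push_cast
    nlinarith

open MeasureTheory in
theorem integral_one_add_mul_rieszProd_le {r : ι → ℝ} (hr : ∀ i, 1 ≤ r i) {g σ : ℝ} (hg : 0 < g)
    (hg1 : g ≤ 1) (hgap : SignSumGap r g) (hσ : 0 < σ) (hσ1 : σ ≤ 1) :
    ∫ u in Set.Ioi 0, (1 + σ * u) * rexp (-(σ * u)) * rieszProd r u ≤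
      2 / σ + 2 ^ Fintype.card ι * (2 / g) := by
  have hI : ∀ s : ℂ, 0 < s.re → IntegrableOn (fun u : ℝ => ((1 + σ * u : ℝ) : ℂ) *
      Complex.exp (-(s * u))) (Set.Ioi 0) := fun s hs => by
    refine ((integrableOn_pow_mul_cexp_neg_mul hs 0).add
      ((integrableOn_pow_mul_cexp_neg_mul hs 1).const_mul (σ : ℂ))).congr
        (ae_of_all _ fun u => ?_)
    simp only [Pi.add_apply]
    push_cast
    ring
  have hF : ∀ s : ℂ, 0 < s.re → ∫ u : ℝ in Set.Ioi 0, ((1 + σ * u : ℝ) : ℂ) *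
      Complex.exp (-(s * u)) = 1 / s + σ / s ^ 2 := fun s hs => by
    have h0 := integral_pow_mul_cexp_neg_mul hs 0
    have h1 := integral_pow_mul_cexp_neg_mul hs 1
    norm_num at h0 h1
    rw [one_div, div_eq_mul_inv, ← h0, ← h1, ← integral_const_mul, ← integral_add]
    · refine setIntegral_congr_fun measurableSet_Ioi fun u _ => ?_
      push_cast
      ring
    · have := integrableOn_pow_mul_cexp_neg_mul hs 0
      simp only [pow_zero, one_mul] at this
      exact this
    · have := (integrableOn_pow_mul_cexp_neg_mul hs 1).const_mul (σ : ℂ)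
      simp only [pow_one] at this
      exact this
  have h := integral_mul_rieszProd hI hF r hσ
  have h2 := congrArg Complex.re h
  rw [Complex.ofReal_re] at h2
  rw [h2, ← Finset.add_sum_erase _ _ zero_mem_signBox, Complex.add_re, rieszProdCoeff_zero]
  have hs0 : signSum r 0 = 0 := by simp [signSum]
  refine add_le_add (le_of_eq ?_) ?_
  · rw [hs0]
    have : (1 : ℂ) * (1 / (σ - (2 * π * 0 : ℝ) * Complex.I) + σ / (σ - (2 * π * 0 : ℝ) *
        Complex.I) ^ 2) = ((2 / σ : ℝ) : ℂ) := by
      have : (σ : ℂ) ≠ 0 := by exact_mod_cast hσ.ne'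
      push_cast
      simp
      field_simp
      norm_num
    rw [this, Complex.ofReal_re]
  · refine (Complex.re_le_norm _).trans ((norm_sum_le _ _).trans ?_)
    rw [← sum_norm_rieszProdCoeff, Finset.sum_mul]
    refine (Finset.sum_le_sum fun ε hε => ?_).trans (Finset.sum_le_sum_of_subset_of_nonneg
      (Finset.erase_subset 0 _) fun ε _ _ => by positivity)
    rw [norm_mul]
    refine mul_le_mul_of_nonneg_left ?_ (norm_nonneg _)
    have hw := gap_le_sq_signSum hr hg1 hgap
      (abs_le_one_of_mem_signBox (Finset.mem_of_mem_erase hε)) (Finset.ne_of_mem_erase hε)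
    set s : ℂ := σ - (2 * π * signSum r ε : ℝ) * Complex.I with hs
    have him : s.im = -(2 * π * signSum r ε) := by
      rw [hs, Complex.sub_im, Complex.im_ofReal_mul]
      simp
    have h3 : g ≤ ‖s‖ ^ 2 := by
      have h4 := Complex.abs_im_le_norm s
      have h5 : s.im ^ 2 ≤ ‖s‖ ^ 2 := by
        rw [← sq_abs s.im]; gcongr
      rw [him] at h5
      have := Real.pi_gt_three
      have h6 : signSum r ε ^ 2 ≤ 4 * π ^ 2 * signSum r ε ^ 2 :=
        le_mul_of_one_le_left (sq_nonneg _) (by nlinarith)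
      nlinarith
    have h4 : g ≤ ‖s‖ := by
      by_contra! h5
      have := norm_nonneg s
      nlinarith
    refine (norm_add_le _ _).trans ?_
    rw [norm_div, norm_div, norm_one, norm_pow, Complex.norm_real, Real.norm_of_nonneg hσ.le]
    calc 1 / ‖s‖ + σ / ‖s‖ ^ 2 ≤ 1 / g + 1 / g := by gcongr
      _ = 2 / g := by ring

end Bounds

theorem latticeP_sq_le {σ U K : ℝ} (hσ : 0 < σ) (hσ1 : σ ≤ 1) (hU : 0 ≤ U) (hK : 0 ≤ K)
    (hP : ∀ u, U ≤ u → u ≤ 1 / σ ^ 2 → latticeP (u ^ 2) ≤ K * √u) {u : ℝ} (hu : 0 < u) :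
    latticeP (u ^ 2) ≤ (4 * (1 + U) ^ 2 + K / (2 * √σ)) * (1 + σ * u) +
      16 * σ ^ 6 * u ^ 5 := by
  have h1 := (le_abs_self _).trans (abs_latticeP_sq_le hu.le)
  have hσs : 0 < √σ := Real.sqrt_pos.2 hσ
  have hσu : 0 < σ * u := by positivity
  have hK' : 0 ≤ K / (2 * √σ) := by positivity
  have h5 : 0 ≤ 16 * σ ^ 6 * u ^ 5 := by positivity
  rcases lt_or_ge u U with h | h
  · have : 4 * (1 + u) ^ 2 ≤ 4 * (1 + U) ^ 2 := by gcongr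
    nlinarith [mul_nonneg hK' hσu.le, mul_nonneg (sq_nonneg (1 + U)) hσu.le]
  rcases le_or_gt u (1 / σ ^ 2) with h' | h'
  · have h2 := hP u h h'
    have h3 : K * √u ≤ K / (2 * √σ) * (1 + σ * u) := by
      rw [div_mul_eq_mul_div, le_div_iff₀ (by positivity), mul_assoc]
      refine mul_le_mul_of_nonneg_left ?_ hK
      have e1 := Real.sq_sqrt hσ.le
      have e2 := Real.sq_sqrt hu.le
      have e3 : σ * u = (√σ * √u) ^ 2 := by rw [mul_pow, e1, e2]
      rw [e3]
      nlinarith [sq_nonneg (√σ * √u - 1)]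
    nlinarith [mul_nonneg (sq_nonneg (1 + U)) hσu.le, sq_nonneg (1 + U)]
  · have h3 : 1 < σ ^ 2 * u := by
      rw [div_lt_iff₀ (by positivity)] at h'
      linarith
    have h4 : 1 ≤ u := by
      have : σ ^ 2 ≤ 1 := pow_le_one₀ hσ.le hσ1
      nlinarith
    have h6 : 16 * u ^ 2 ≤ 16 * σ ^ 6 * u ^ 5 := by
      have : (1 : ℝ) ≤ (σ ^ 2 * u) ^ 3 := one_le_pow₀ h3.le
      calc 16 * u ^ 2 ≤ 16 * u ^ 2 * (σ ^ 2 * u) ^ 3 := le_mul_of_one_le_right (by positivity) this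
        _ = 16 * σ ^ 6 * u ^ 5 := by ring
    have h7 : 0 ≤ (4 * (1 + U) ^ 2 + K / (2 * √σ)) * (1 + σ * u) := by positivity
    nlinarith

section Main

variable {ι : Type*} [Fintype ι]

open MeasureTheory in
theorem integral_pow_mul_exp_neg_mul {σ : ℝ} (hσ : 0 < σ) (n : ℕ) :
    ∫ u in Set.Ioi 0, u ^ n * rexp (-(σ * u)) = n.factorial / σ ^ (n + 1) := by
  have h := integral_pow_mul_cexp_neg_mul (s := (σ : ℂ)) (by simpa using hσ) n
  have h2 : ∀ u : ℝ, (u : ℂ) ^ n * Complex.exp (-((σ : ℂ) * u)) =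
    ((u ^ n * rexp (-(σ * u)) : ℝ) : ℂ) := fun u => by push_cast; rfl
  simp_rw [h2] at h
  rw [integral_complex_ofReal] at h
  exact_mod_cast h

open MeasureTheory in
theorem IntegrableOn.mul_rieszProd {f : ℝ → ℝ} {s : Set ℝ} (hf : IntegrableOn f s) (r : ι → ℝ) :
    IntegrableOn (fun u => f u * rieszProd r u) s := by
  refine Integrable.mul_bdd (c := 2 ^ Fintype.card ι) hf
    (continuous_rieszProd r).aestronglyMeasurable ?_
  exact ae_of_all _ fun u => by
    rw [Real.norm_of_nonneg (rieszProd_nonneg r u)]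
    exact rieszProd_le r u

variable [DecidableEq ι]

open MeasureTheory in
theorem integral_latticeP_mul_rieszProd_le {r : ι → ℝ} (hr : ∀ i, 1 ≤ r i) {g σ : ℝ} (hg : 0 < g)
    (hg1 : g ≤ 1) (hgap : SignSumGap r g) (hσ : 0 < σ) (hσ1 : σ ≤ 1) {U K : ℝ} (hU : 0 ≤ U)
    (hK : 0 ≤ K) (hP : ∀ u, U ≤ u → u ≤ 1 / σ ^ 2 → latticeP (u ^ 2) ≤ K * √u) :
    ∫ u in Set.Ioi 0, latticeP (u ^ 2) * rexp (-(σ * u)) * rieszProd r u ≤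
      (4 * (1 + U) ^ 2 + K / (2 * √σ)) * (2 / σ + 2 ^ Fintype.card ι * (2 / g)) +
        2 ^ Fintype.card ι * 1920 := by
  set B := 4 * (1 + U) ^ 2 + K / (2 * √σ) with hB
  have hB0 : 0 ≤ B := by positivity
  have i1 : IntegrableOn (fun u => (1 + σ * u) * rexp (-(σ * u))) (Set.Ioi 0) := by
    refine ((integrableOn_pow_mul_exp_neg_mul hσ 0).add
      ((integrableOn_pow_mul_exp_neg_mul hσ 1).const_mul σ)).congr (ae_of_all _ fun u => ?_)
    simp only [Pi.add_apply]
    ring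
  have i2 := integrableOn_pow_mul_exp_neg_mul hσ 5
  have j1 := (IntegrableOn.mul_rieszProd i1 r).const_mul B
  have j2 := i2.const_mul (2 ^ Fintype.card ι * 16 * σ ^ 6)
  calc ∫ u in Set.Ioi 0, latticeP (u ^ 2) * rexp (-(σ * u)) * rieszProd r u
      ≤ ∫ u in Set.Ioi 0, (B * ((1 + σ * u) * rexp (-(σ * u)) * rieszProd r u) +
          2 ^ Fintype.card ι * 16 * σ ^ 6 * (u ^ 5 * rexp (-(σ * u)))) := by
        refine setIntegral_mono_on (IntegrableOn.mul_rieszProd (integrableOn_latticeP_mul_exp hσ) r)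
          (j1.add j2) measurableSet_Ioi fun u hu => ?_
        have hu' : 0 < u := hu
        have h := latticeP_sq_le hσ hσ1 hU hK hP hu'
        have hT := rieszProd_le r u
        have hT0 := rieszProd_nonneg r u
        calc latticeP (u ^ 2) * rexp (-(σ * u)) * rieszProd r u
            ≤ (B * (1 + σ * u) + 16 * σ ^ 6 * u ^ 5) * rexp (-(σ * u)) * rieszProd r u := by
              gcongr
          _ = B * ((1 + σ * u) * rexp (-(σ * u)) * rieszProd r u) +
              rieszProd r u * 16 * σ ^ 6 * (u ^ 5 * rexp (-(σ * u))) := by ring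
          _ ≤ _ := by gcongr
    _ = B * (∫ u in Set.Ioi 0, (1 + σ * u) * rexp (-(σ * u)) * rieszProd r u) +
          2 ^ Fintype.card ι * 1920 := by
        rw [integral_add j1 j2, integral_const_mul, integral_const_mul,
          integral_pow_mul_exp_neg_mul hσ]
        congr 1
        have : Nat.factorial 5 = 120 := rfl
        rw [this]
        field_simp
        ring
    _ ≤ _ := by
        gcongr
        exact integral_one_add_mul_rieszProd_le hr hg hg1 hgap hσ hσ1

theorem sum_rpow_le {r : ι → ℝ} (hr : ∀ i, 1 ≤ r i) (hrm : ∀ i, ∃ m, sqNorm m = r i ^ 2)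
    {g σ : ℝ} (hg : 0 < g) (hg1 : g ≤ 1) (hgap : SignSumGap r g) (hσ : 0 < σ)
    (hσg : σ ≤ (g / 2 ^ Fintype.card ι) ^ 2) {U K : ℝ} (hU : 0 ≤ U) (hK : 0 ≤ K)
    (hP : ∀ u, U ≤ u → u ≤ 1 / σ ^ 2 → latticeP (u ^ 2) ≤ K * √u) :
    2 * π * (1 / 8 * 14 ^ (-(3 / 2) : ℝ)) * ∑ i, r i ^ (-(3 / 2) : ℝ) ≤
      2 * π * ∑' m, (1 + sqNorm m) ^ (-(3 / 2) : ℝ) + 1920 + 16 * (1 + U) ^ 2 + 2 * K := by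
  set q : ℝ := 2 ^ Fintype.card ι with hq
  set Z := ∑' m, (1 + sqNorm m) ^ (-(3 / 2) : ℝ) with hZ
  have hZ0 : 0 ≤ Z := tsum_nonneg fun m => by
    have := sqNorm_nonneg m
    positivity
  have hq1 : 1 ≤ q := one_le_pow₀ (by norm_num)
  have hgq : 0 < g / q := by positivity
  have hgq1 : g / q ≤ 1 := (div_le_one (by positivity)).2 (by linarith)
  have hσgq : σ ≤ g / q := hσg.trans (by nlinarith)
  have hgqg : g / q ≤ g := div_le_self hg.le hq1
  have hσ1 : σ ≤ 1 := by linarith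
  have hσ2 : σ ^ 2 ≤ g := by nlinarith
  have e1 : q / g ≤ 1 / σ := by
    rw [← one_div_div g q]
    exact one_div_le_one_div_of_le hσ hσgq
  have e2 : q ≤ 1 / σ := le_trans (by rw [le_div_iff₀ hg]; nlinarith) e1
  have e3 : q * g ^ (-(3 / 2) : ℝ) ≤ 1 / σ := by
    have h1 : g ^ (-(3 / 2) : ℝ) ≤ g ^ (-2 : ℝ) :=
      Real.rpow_le_rpow_of_exponent_ge hg hg1 (by norm_num)
    have h2 : g ^ (-2 : ℝ) = 1 / g ^ 2 := by
      rw [Real.rpow_neg hg.le, one_div]; norm_num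
    have h3 : 1 / (g / q) ^ 2 ≤ 1 / σ := one_div_le_one_div_of_le hσ hσg
    calc q * g ^ (-(3 / 2) : ℝ) ≤ q ^ 2 * (1 / g ^ 2) := by
          rw [h2] at h1
          gcongr
          nlinarith
      _ = 1 / (g / q) ^ 2 := by field_simp
      _ ≤ _ := h3
  have hlow := le_integral_latticeP_mul_rieszProd hr hrm hg hgap hσ hσ1 hσ2
  have hup := integral_latticeP_mul_rieszProd_le hr hg hg1 hgap hσ hσ1 hU hK hP
  have h := hlow.trans hup
  rw [← hZ, ← hq] at h
  have hs : ∑ i, 1 / 8 * (14 * σ * r i) ^ (-(3 / 2) : ℝ) =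
      σ ^ (-(3 / 2) : ℝ) * ((1 / 8 * 14 ^ (-(3 / 2) : ℝ)) * ∑ i, r i ^ (-(3 / 2) : ℝ)) := by
    rw [Finset.mul_sum, Finset.mul_sum]
    refine Finset.sum_congr rfl fun i _ => ?_
    rw [Real.mul_rpow (by positivity) (by linarith [hr i]), Real.mul_rpow (by norm_num) hσ.le]
    ring
  rw [hs] at h
  set R := 1 / 8 * 14 ^ (-(3 / 2) : ℝ) * ∑ i, r i ^ (-(3 / 2) : ℝ) with hR
  set t := σ ^ (-(3 / 2) : ℝ) with ht
  have ht0 : 0 < t := by positivity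
  have hσs : 0 < √σ := Real.sqrt_pos.2 hσ
  have ht1 : 1 / σ = √σ * t := by
    rw [ht, Real.sqrt_eq_rpow, ← Real.rpow_add hσ, one_div, ← Real.rpow_neg_one]
    norm_num
  have hs1 : √σ ≤ 1 := Real.sqrt_le_one.2 hσ1
  have ht2 : 1 / σ ≤ t := by rw [ht1]; nlinarith
  have b1 : q * (g ^ (-(3 / 2) : ℝ) * Z) ≤ t * Z := by
    rw [← mul_assoc]
    gcongr
    exact e3.trans ht2
  have b2 : (4 * (1 + U) ^ 2 + K / (2 * √σ)) * (2 / σ + q * (2 / g)) ≤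
      t * (16 * (1 + U) ^ 2 + 2 * K) := by
    have c1 : 2 / σ + q * (2 / g) ≤ 4 * (√σ * t) := by
      have : 2 / σ + q * (2 / g) = 2 * (1 / σ) + 2 * (q / g) := by ring
      rw [this, ← ht1]
      linarith
    calc (4 * (1 + U) ^ 2 + K / (2 * √σ)) * (2 / σ + q * (2 / g))
        ≤ (4 * (1 + U) ^ 2 + K / (2 * √σ)) * (4 * (√σ * t)) := by gcongr
      _ = t * (√σ * (16 * (1 + U) ^ 2) + 2 * K) := by field_simp; ring
      _ ≤ _ := by
        refine mul_le_mul_of_nonneg_left (add_le_add ?_ le_rfl) ht0.le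
        exact mul_le_of_le_one_left (by positivity) hs1
  have b3 : q * 1920 ≤ t * 1920 := by linarith [e2.trans ht2]
  have key : t * (2 * π * R) ≤ t * (2 * π * Z + 1920 + 16 * (1 + U) ^ 2 + 2 * K) := by
    have := Real.pi_pos
    nlinarith [mul_le_mul_of_nonneg_left b1 Real.two_pi_pos.le]
  have := le_of_mul_le_mul_left key ht0
  calc _ = 2 * π * R := by rw [hR]; ring
    _ ≤ _ := this

end Main

theorem exp_half_le_one_add {x : ℝ} (h0 : 0 ≤ x) (h1 : x ≤ 1) : rexp (x / 2) ≤ 1 + x := by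
  have h := Real.one_sub_le_exp_neg (x / 2)
  rw [Real.exp_neg] at h
  have h2 : rexp (x / 2) ≤ (1 - x / 2)⁻¹ := by
    rw [← inv_inv (rexp (x / 2))]
    exact inv_anti₀ (by linarith) h
  refine h2.trans ?_
  rw [inv_le_iff_one_le_mul₀ (by linarith)]
  nlinarith

theorem exists_sqNorm_eq_prod {T : Finset ℕ} (hT : ∀ p ∈ T, p.Prime ∧ p % 4 = 1) :
    ∃ m, sqNorm m = ((∏ p ∈ T, p : ℕ) : ℝ) := by
  suffices h : ∃ a b : ℕ, ∏ p ∈ T, p = a ^ 2 + b ^ 2 by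
    obtain ⟨a, b, h⟩ := h
    refine ⟨(a, b), ?_⟩
    rw [h, sqNorm]
    push_cast
    rfl
  refine Finset.prod_induction (fun p => p) (fun n => ∃ a b : ℕ, n = a ^ 2 + b ^ 2) ?_ ?_ ?_
  · rintro _ _ ⟨a, b, rfl⟩ ⟨c, d, rfl⟩
    obtain ⟨e, f, h⟩ := Nat.sq_add_sq_mul (a := a ^ 2 + b ^ 2) (b := c ^ 2 + d ^ 2) rfl rfl
    exact ⟨e, f, h⟩
  · exact ⟨1, 0, rfl⟩
  · intro p hp
    have : Fact p.Prime := ⟨(hT p hp).1⟩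
    obtain ⟨a, b, h⟩ := Nat.Prime.sq_add_sq (p := p) (by have := (hT p hp).2; omega)
    exact ⟨a, b, h.symm⟩

theorem sum_powerset_prod_sqrt_le {S : Finset ℕ} {N : ℝ} (hN : 1 ≤ N) (hS : ∀ p ∈ S, (p : ℝ) ≤ N) :
    ∑ T : S.powerset, √((∏ p ∈ T.1, p : ℕ) : ℝ) ≤ (2 * N) ^ S.card := by
  rw [Finset.sum_coe_sort S.powerset fun T => √((∏ p ∈ T, p : ℕ) : ℝ)]
  have h : ∀ T ∈ S.powerset, √((∏ p ∈ T, p : ℕ) : ℝ) = ∏ p ∈ T, √(p : ℝ) := fun T _ => by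
    rw [Nat.cast_prod, Real.sqrt_prod _ fun _ _ => by positivity]
  rw [Finset.sum_congr rfl h, ← Finset.prod_one_add, ← Finset.prod_const]
  refine Finset.prod_le_prod (fun _ _ => by positivity) fun p hp => ?_
  have h1 : √(p : ℝ) ≤ N := Real.sqrt_le_iff.2 ⟨by linarith, (hS p hp).trans (by nlinarith)⟩
  linarith

theorem exp_le_sum_powerset_rpow {S : Finset ℕ} {N : ℝ} (hS : ∀ p ∈ S, p.Prime ∧ (p : ℝ) ≤ N) :
    rexp (S.card * N ^ (-(3 / 4) : ℝ) / 2) ≤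
      ∑ T : S.powerset, √((∏ p ∈ T.1, p : ℕ) : ℝ) ^ (-(3 / 2) : ℝ) := by
  rw [Finset.sum_coe_sort S.powerset fun T => √((∏ p ∈ T, p : ℕ) : ℝ) ^ (-(3 / 2) : ℝ)]
  have h : ∀ T ∈ S.powerset, √((∏ p ∈ T, p : ℕ) : ℝ) ^ (-(3 / 2) : ℝ) =
      ∏ p ∈ T, (p : ℝ) ^ (-(3 / 4) : ℝ) := fun T _ => by
    rw [Nat.cast_prod, Real.finsetProd_rpow _ _ fun _ _ => by positivity, Real.sqrt_eq_rpow,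
      ← Real.rpow_mul (by positivity)]
    norm_num
  rw [Finset.sum_congr rfl h, ← Finset.prod_one_add]
  have h2 : rexp (S.card * N ^ (-(3 / 4) : ℝ) / 2) =
      ∏ p ∈ S, rexp (N ^ (-(3 / 4) : ℝ) / 2) := by
    rw [Finset.prod_const, ← Real.exp_nat_mul, mul_div_assoc]
  rw [h2]
  refine Finset.prod_le_prod (fun _ _ => by positivity) fun p hp => ?_
  have hp1 : (1 : ℝ) ≤ p := by exact_mod_cast (hS p hp).1.one_le
  have h3 : N ^ (-(3 / 4) : ℝ) ≤ (p : ℝ) ^ (-(3 / 4) : ℝ) :=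
    Real.rpow_le_rpow_of_nonpos (by linarith) (hS p hp).2 (by norm_num)
  have h4 : (p : ℝ) ^ (-(3 / 4) : ℝ) ≤ 1 := Real.rpow_le_one_of_one_le_of_nonpos hp1 (by norm_num)
  refine le_trans ?_ (exp_half_le_one_add (by positivity) h4)
  gcongr

theorem exp_le_of_latticeP_sq_le {S : Finset ℕ} {N : ℝ} (hN : 1 ≤ N)
    (hS : ∀ p ∈ S, p.Prime ∧ p % 4 = 1 ∧ (p : ℝ) ≤ N) {σ : ℝ} (hσ : 0 < σ)
    (hσS : σ ≤ (((3 * ((2 * N) ^ S.card) ^ 2) ^ (2 ^ S.card + 1))⁻¹ / 2 ^ 2 ^ S.card) ^ 2)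
    {U K : ℝ} (hU : 0 ≤ U) (hK : 0 ≤ K)
    (hP : ∀ u, U ≤ u → u ≤ 1 / σ ^ 2 → latticeP (u ^ 2) ≤ K * √u) :
    2 * π * (1 / 8 * 14 ^ (-(3 / 2) : ℝ)) * rexp (S.card * N ^ (-(3 / 4) : ℝ) / 2) ≤
      2 * π * ∑' m, (1 + sqNorm m) ^ (-(3 / 2) : ℝ) + 1920 + 16 * (1 + U) ^ 2 + 2 * K := by
  set r : S.powerset → ℝ := fun T => √((∏ p ∈ T.1, p : ℕ) : ℝ) with hr
  have hW : (1 : ℝ) ≤ (2 * N) ^ S.card := one_le_pow₀ (by linarith)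
  have hgap : SignSumGap r ((3 * ((2 * N) ^ S.card) ^ 2) ^ (2 ^ S.card + 1))⁻¹ :=
    fun ε hε n => gap_sq_sum (fun p hp => (hS p hp).1)
      (sum_powerset_prod_sqrt_le hN fun p hp => (hS p hp).2.2) hW ε hε n
  have hT : ∀ T : S.powerset, ∀ p ∈ T.1, p ∈ S := fun T => Finset.mem_powerset.1 T.2
  have hr1 : ∀ T, 1 ≤ r T := fun T => by
    rw [hr, Real.one_le_sqrt]
    exact_mod_cast Finset.one_le_prod' fun p hp => (hS p (hT T p hp)).1.one_le
  have hrm : ∀ T, ∃ m, sqNorm m = r T ^ 2 := fun T => by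
    rw [hr, Real.sq_sqrt (by positivity)]
    exact exists_sqNorm_eq_prod fun p hp => ⟨(hS p (hT T p hp)).1, (hS p (hT T p hp)).2.1⟩
  have hcard : Fintype.card S.powerset = 2 ^ S.card := by
    rw [Fintype.card_coe, Finset.card_powerset]
  refine le_trans ?_ (sum_rpow_le hr1 hrm (by positivity) ?_ hgap hσ (by rwa [hcard]) hU hK hP)
  · refine mul_le_mul_of_nonneg_left ?_ (by positivity)
    exact exp_le_sum_powerset_rpow fun p hp => ⟨(hS p hp).1, (hS p hp).2.2⟩
  · refine inv_le_one_of_one_le₀ (one_le_pow₀ ?_)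
    nlinarith [one_le_pow₀ hW (n := 2)]

theorem exp_neg_exp_le {M : ℕ} (hM : 3000 ≤ M) :
    rexp (-rexp (5 * M)) ≤ (((3 * ((2 * (32 * M * log M)) ^ M) ^ 2) ^ (2 ^ M + 1))⁻¹ /
      2 ^ 2 ^ M) ^ 2 := by
  have hM' : (3000 : ℝ) ≤ M := by exact_mod_cast hM
  have hl : 0 < log M := Real.log_pos (by linarith)
  have hl2 : log M ≤ M := (Real.log_le_sub_one_of_pos (by linarith)).trans (by linarith)
  set N := 32 * M * log M with hN
  have hN0 : 0 < N := by positivity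
  have hN1 : log (2 * N) ≤ 64 * (M : ℝ) ^ 2 := by
    refine (Real.log_le_sub_one_of_pos (by positivity)).trans ?_
    rw [hN]
    nlinarith
  rw [Real.exp_neg]
  have hpos : 0 < (3 * ((2 * N) ^ M) ^ 2) ^ (2 ^ M + 1) := by positivity
  have e : (((3 * ((2 * N) ^ M) ^ 2) ^ (2 ^ M + 1))⁻¹ / 2 ^ 2 ^ M) ^ 2 =
      (((3 * ((2 * N) ^ M) ^ 2) ^ (2 ^ M + 1) * 2 ^ 2 ^ M) ^ 2)⁻¹ := by
    rw [div_eq_mul_inv, ← mul_inv, inv_pow]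
  rw [e]
  refine inv_anti₀ (by positivity) ?_
  rw [← Real.log_le_iff_le_exp (by positivity), Real.log_pow,
    Real.log_mul (by positivity) (by positivity), Real.log_pow, Real.log_mul (by positivity)
    (by positivity), Real.log_pow, Real.log_pow, Real.log_pow]
  push_cast
  have h3 : log 3 ≤ 2 := (Real.log_le_sub_one_of_pos (by norm_num)).trans (by norm_num)
  have h2 : log 2 ≤ 1 := (Real.log_le_sub_one_of_pos (by norm_num)).trans (by norm_num)
  have hq : (1 : ℝ) ≤ 2 ^ M := one_le_pow₀ (by norm_num)
  have h4 : log 3 + 2 * (M * log (2 * N)) ≤ 129 * (M : ℝ) ^ 3 := by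
    have : (M : ℝ) * log (2 * N) ≤ M * (64 * (M : ℝ) ^ 2) := by gcongr
    nlinarith [pow_le_pow_left₀ (by norm_num) hM' 3]
  have hM3 : (1 : ℝ) ≤ (M : ℝ) ^ 3 := one_le_pow₀ (by linarith)
  have hqe : (2 : ℝ) ^ M ≤ rexp M := by
    rw [← Real.exp_one_pow]
    gcongr
    linarith [Real.add_one_le_exp 1]
  have hMe : (M : ℝ) ≤ rexp M := by linarith [Real.add_one_le_exp (M : ℝ)]
  calc 2 * ((2 ^ M + 1) * (log 3 + 2 * (M * log (2 * N))) + 2 ^ M * log 2)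
      ≤ 2 * ((2 ^ M + 1) * (129 * (M : ℝ) ^ 3) + 2 ^ M * (M : ℝ) ^ 3) := by
        gcongr
        linarith
    _ ≤ 2 * ((2 ^ M + 2 ^ M) * (129 * (M : ℝ) ^ 3) + 2 ^ M * (M : ℝ) ^ 3) := by gcongr
    _ = 518 * (2 ^ M * (M : ℝ) ^ 3) := by ring
    _ ≤ rexp M * (rexp M * rexp M ^ 3) := by
        gcongr
        linarith
    _ = rexp (5 * M) := by
        rw [← pow_succ', ← pow_succ', ← Real.exp_nat_mul]
        norm_num

theorem rpow_mul_log_rpow_le {x y : ℝ} (hx : rexp 3 ≤ x) (hxy : x ≤ y) :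
    x ^ ((1 : ℝ) / 4) * log x ^ (-(3 : ℝ) / 4) ≤ y ^ ((1 : ℝ) / 4) * log y ^ (-(3 : ℝ) / 4) := by
  have hx3 : 4 ≤ rexp 3 := by linarith [Real.add_one_le_exp (3 : ℝ)]
  have key : ∀ z : ℝ, 4 ≤ z → z ^ ((1 : ℝ) / 4) * log z ^ (-(3 : ℝ) / 4) =
      (log z / z ^ ((1 : ℝ) / 3)) ^ (-(3 : ℝ) / 4) := fun z hz => by
    have hl : 0 ≤ log z := Real.log_nonneg (by linarith)
    have h : z ^ ((1 : ℝ) / 4) = (z ^ ((1 : ℝ) / 3 * (-(3 : ℝ) / 4)))⁻¹ := by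
      rw [← Real.rpow_neg (by linarith)]
      norm_num
    rw [Real.div_rpow hl (by positivity), ← Real.rpow_mul (by linarith), h]
    exact (div_eq_inv_mul _ _).symm
  rw [key x (by linarith), key y (by linarith)]
  refine Real.rpow_le_rpow_of_nonpos ?_ ?_ (by norm_num)
  · have : 0 < log y := Real.log_pos (by linarith)
    have : 0 < y := by linarith
    positivity
  · refine Real.log_div_self_rpow_antitoneOn (a := 1 / 3) (by norm_num) ?_ ?_ hxy
    · rw [Set.mem_Ici]
      norm_num
      exact hx
    · rw [Set.mem_Ici]
      norm_num
      exact hx.trans hxy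

theorem tendsto_rpow_mul_log_rpow :
    Tendsto (fun x : ℝ => x ^ ((1 : ℝ) / 4) * log x ^ (-(3 : ℝ) / 4)) atTop atTop := by
  have h : Tendsto (fun x : ℝ => (6 : ℝ) ^ (-(3 : ℝ) / 4) * x ^ ((1 : ℝ) / 8)) atTop atTop :=
    (tendsto_rpow_atTop (by norm_num)).const_mul_atTop (by positivity)
  refine tendsto_atTop_mono' _ ?_ h
  filter_upwards [eventually_ge_atTop 2] with x hx
  have hx0 : 0 < x := by linarith
  have hl : 0 < log x := Real.log_pos (by linarith)
  have h1 : log x ≤ 6 * x ^ ((1 : ℝ) / 6) := by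
    refine (Real.log_le_rpow_div hx0.le (by norm_num : (0 : ℝ) < 1 / 6)).trans_eq ?_
    ring
  have h2 := Real.rpow_le_rpow_of_nonpos hl h1 (by norm_num : (-(3 : ℝ) / 4) ≤ 0)
  rw [Real.mul_rpow (by norm_num) (by positivity), ← Real.rpow_mul hx0.le] at h2
  calc (6 : ℝ) ^ (-(3 : ℝ) / 4) * x ^ ((1 : ℝ) / 8)
      = x ^ ((1 : ℝ) / 4) * (6 ^ (-(3 : ℝ) / 4) * x ^ (1 / 6 * (-(3 : ℝ) / 4))) := by
        rw [mul_left_comm, ← Real.rpow_add hx0]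
        norm_num
    _ ≤ _ := by gcongr

theorem exp_le_mul_log_log {M : ℕ} (hM : 3000 ≤ M) {u : ℝ} (hu : rexp (rexp (rexp 3)) ≤ u)
    (hu' : u ≤ 1 / rexp (-rexp (5 * M)) ^ 2) :
    log (log (u ^ 2)) ^ ((1 : ℝ) / 4) * log (log (log (u ^ 2))) ^ (-(3 : ℝ) / 4) ≤
      2 * ((M : ℝ) ^ ((1 : ℝ) / 4) * log M ^ (-(3 : ℝ) / 4)) := by
  have hM' : (3000 : ℝ) ≤ M := by exact_mod_cast hM
  have hu0 : 0 < u := (Real.exp_pos _).trans_le hu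
  have hlu : rexp (rexp 3) ≤ log u := (Real.le_log_iff_exp_le hu0).2 hu
  have hlu2 : log (u ^ 2) = 2 * log u := by rw [Real.log_pow]; norm_num
  have hl0 : 0 < log u := (Real.exp_pos _).trans_le hlu
  have h1 : rexp 3 ≤ log (log (u ^ 2)) := by
    rw [Real.le_log_iff_exp_le (by rw [hlu2]; positivity), hlu2]
    linarith
  have h2 : log u ≤ 2 * rexp (5 * M) := by
    refine (Real.log_le_log hu0 hu').trans_eq ?_
    rw [one_div, Real.log_inv, Real.log_pow, Real.log_exp]
    push_cast
    ring
  have h3 : log (log (u ^ 2)) ≤ 6 * M := by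
    rw [Real.log_le_iff_le_exp (by rw [hlu2]; positivity), hlu2]
    have : rexp (6 * M) = rexp M * rexp (5 * M) := by rw [← Real.exp_add]; ring_nf
    rw [this]
    have h4 : 4 ≤ rexp M := by linarith [Real.add_one_le_exp (M : ℝ)]
    nlinarith [Real.exp_pos (5 * M : ℝ)]
  refine (rpow_mul_log_rpow_le h1 h3).trans ?_
  have hl : 0 < log M := Real.log_pos (by linarith)
  have hl6 : 0 < log (6 * M) := Real.log_pos (by linarith)
  have h5 : log (6 * M) ^ (-(3 : ℝ) / 4) ≤ log M ^ (-(3 : ℝ) / 4) :=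
    Real.rpow_le_rpow_of_nonpos hl (Real.log_le_log (by linarith) (by linarith)) (by norm_num)
  have h6 : (6 : ℝ) ^ ((1 : ℝ) / 4) ≤ 2 := by
    refine (Real.rpow_le_rpow (by norm_num) (by norm_num : (6 : ℝ) ≤ 2 ^ (4 : ℝ))
      (by norm_num)).trans_eq ?_
    rw [← Real.rpow_mul (by norm_num)]
    norm_num
  rw [Real.mul_rpow (by norm_num) (by linarith)]
  calc (6 : ℝ) ^ ((1 : ℝ) / 4) * (M : ℝ) ^ ((1 : ℝ) / 4) * log (6 * M) ^ (-(3 : ℝ) / 4)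
      ≤ 2 * (M : ℝ) ^ ((1 : ℝ) / 4) * log M ^ (-(3 : ℝ) / 4) := by gcongr
    _ = _ := by ring

theorem div_le_mul_rpow {M : ℕ} (hM : 3000 ≤ M) :
    (M : ℝ) ^ ((1 : ℝ) / 4) * log M ^ (-(3 : ℝ) / 4) / 16 ≤
      M * (32 * M * log M) ^ (-(3 / 4) : ℝ) := by
  have hM' : (3000 : ℝ) ≤ M := by exact_mod_cast hM
  have hM0 : (0 : ℝ) < M := by linarith
  have hl : 0 < log M := Real.log_pos (by linarith)
  have h1 : (M : ℝ) ^ ((1 : ℝ) / 4) = M * (M : ℝ) ^ (-(3 / 4) : ℝ) := by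
    nth_rewrite 2 [← Real.rpow_one (M : ℝ)]
    rw [← Real.rpow_add hM0]
    norm_num
  have h2 : (1 / 16 : ℝ) ≤ 32 ^ (-(3 / 4) : ℝ) := by
    have : (1 / 16 : ℝ) = 2 ^ (-4 : ℝ) := by
      rw [Real.rpow_neg (by norm_num)]; norm_num
    have h32 : (32 : ℝ) = 2 ^ (5 : ℝ) := by norm_num
    rw [this, h32, ← Real.rpow_mul (by norm_num)]
    exact Real.rpow_le_rpow_of_exponent_le (by norm_num) (by norm_num)
  rw [Real.mul_rpow (by positivity) hl.le, Real.mul_rpow (by norm_num) hM0.le, h1, neg_div]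
  calc (M : ℝ) * (M : ℝ) ^ (-(3 / 4) : ℝ) * log M ^ (-(3 / 4) : ℝ) / 16
      = (1 / 16) * (M * ((M : ℝ) ^ (-(3 / 4) : ℝ) * log M ^ (-(3 / 4) : ℝ))) := by ring
    _ ≤ 32 ^ (-(3 / 4) : ℝ) * (M * ((M : ℝ) ^ (-(3 / 4) : ℝ) * log M ^ (-(3 / 4) : ℝ))) := by
        gcongr
    _ = _ := by ring

theorem corradi_katai_omega_plus :
    ∃ c' : ℝ, 0 < c' ∧ ∃ c : ℝ, 0 < c ∧ ∃ᶠ x : ℝ in atTop,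
      c * (x ^ ((1 : ℝ) / 4) * Real.exp (c' * Real.log (Real.log x) ^ ((1 : ℝ) / 4) *
          Real.log (Real.log (Real.log x)) ^ (-(3 : ℝ) / 4))) ≤ latticeP x := by
  set a : ℝ := 2 * π * (1 / 8 * 14 ^ (-(3 / 2) : ℝ)) with ha
  have ha0 : 0 < a := by positivity
  refine ⟨1 / 64, by norm_num, a / 4, by positivity, fun hev => ?_⟩
  obtain ⟨x₀, hx₀⟩ := eventually_atTop.1 hev
  set U : ℝ := max (max x₀ 1) (rexp (rexp (rexp 3))) with hU
  have hU1 : 1 ≤ U := (le_max_right _ _).trans (le_max_left _ _)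
  have hUx : x₀ ≤ U := (le_max_left _ _).trans (le_max_left _ _)
  have hUe : rexp (rexp (rexp 3)) ≤ U := le_max_right _ _
  set C : ℝ := 2 * π * ∑' m, (1 + sqNorm m) ^ (-(3 / 2) : ℝ) + 1920 + 16 * (1 + U) ^ 2 with hC
  have hlim : Tendsto (fun M : ℕ => a / 2 * rexp ((M : ℝ) ^ ((1 : ℝ) / 4) *
      log M ^ (-(3 : ℝ) / 4) / 32)) atTop atTop :=
    (Real.tendsto_exp_atTop.comp ((tendsto_rpow_mul_log_rpow.comp
      tendsto_natCast_atTop_atTop).atTop_div_const (by norm_num))).const_mul_atTop (by positivity)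
  obtain ⟨M, ⟨S, rfl, hS⟩, hMC, hM⟩ := (frequently_primes_one_mod_four.and_eventually
    ((hlim.eventually_gt_atTop C).and (eventually_ge_atTop 3000))).exists
  have hM' : (3000 : ℝ) ≤ S.card := by exact_mod_cast hM
  set L : ℝ := (S.card : ℝ) ^ ((1 : ℝ) / 4) * log S.card ^ (-(3 : ℝ) / 4) with hL
  have hl : 1 ≤ log S.card := by
    rw [Real.le_log_iff_exp_le (by linarith)]
    linarith [Real.exp_one_lt_d9]
  have h := exp_le_of_latticeP_sq_le (N := 32 * S.card * log S.card) (by nlinarith) hS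
    (Real.exp_pos _) (exp_neg_exp_le hM) (U := U) (K := a / 4 * rexp (L / 32)) (by linarith)
    (by positivity) fun u hu hu' => by
      have hu0 : 0 < u := by linarith
      have h1 := (not_le.1 (hx₀ (u ^ 2) (by nlinarith))).le
      have h2 := exp_le_mul_log_log hM (hUe.trans hu) hu'
      refine h1.trans ?_
      have h3 : (u ^ 2) ^ ((1 : ℝ) / 4) = √u := by
        rw [Real.sqrt_eq_rpow, ← Real.rpow_natCast, ← Real.rpow_mul hu0.le]
        norm_num
      rw [h3, mul_comm (√u), mul_assoc (a / 4)]
      refine mul_le_mul_of_nonneg_left (mul_le_mul_of_nonneg_right (Real.exp_le_exp.2 ?_)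
        (Real.sqrt_nonneg u)) (by positivity : (0 : ℝ) ≤ a / 4)
      rw [mul_assoc]
      linarith
  have h2 : rexp (L / 32) ≤
      rexp (S.card * (32 * S.card * log S.card) ^ (-(3 / 4) : ℝ) / 2) := by
    refine Real.exp_le_exp.2 ?_
    have := div_le_mul_rpow hM
    linarith
  rw [← ha, ← hC] at h
  have h3 := mul_le_mul_of_nonneg_left h2 ha0.le
  linarith
end

section
/- Soundararajan's Lemma: Let (f(n))_{n≥1} and (λ_n)_{n≥1} be sequences of nonnegative real numbers with (λ_n) non-decreasing and Σ_{n=1}^∞ f(n) < ∞. Let L ≥ 2 and Y ≥ 1 be integers with λ_Y > 0, and let γ be a fixed real number. Put S(t) = Σ_{n=1}^∞ f(n) cos(2π λ_n t + γ). Suppose M is a finite set of positive integers such that λ_m ∈ [λ_Y/2, 3λ_Y/2] for every m ∈ M. Then for any real T ≥ 2 there exists t ∈ [T/2, (6L)^{|M|+1} T] such that |S(t)| ≥ (1/8) Σ_{m∈M} f(m) − (1/(L−1)) Σ_{n : λ_n ≤ 2λ_Y} f(n) − (4/(π² T λ_Y)) Σ_{n=1}^∞ f(n). Furthermore, if γ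 = wπ with w ∈ ℤ, then the conclusion holds with |S(t)| replaced by (−1)^w S(t). -/
open Real Filter MeasureTheory FourierTransform

/-- The Fejér kernel of the real line. -/
noncomputable def fejer (u : ℝ) : ℝ := sinc (π * u) ^ 2

/-- The triangle function, which is the Fourier transform of the Fejér kernel. -/
noncomputable def triangle (y : ℝ) : ℝ := max 0 (1 - |y|)

lemma continuous_fejer : Continuous fejer :=
  (continuous_sinc.comp (continuous_const.mul continuous_id)).pow 2

lemma continuous_triangle : Continuous triangle :=
  continuous_const.max (continuous_const.sub continuous_abs)

lemma fejer_nonneg (u : ℝ) : 0 ≤ fejer u := sq_nonneg _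

lemma fejer_neg (u : ℝ) : fejer (-u) = fejer u := by
  simp [fejer, sinc_neg]

lemma triangle_nonneg (y : ℝ) : 0 ≤ triangle y := le_max_left _ _

lemma triangle_neg (y : ℝ) : triangle (-y) = triangle y := by
  simp [triangle]

lemma triangle_le_one (y : ℝ) : triangle y ≤ 1 :=
  max_le zero_le_one (by linarith [abs_nonneg y])

lemma triangle_eq_zero {y : ℝ} (hy : 1 ≤ |y|) : triangle y = 0 :=
  max_eq_left (by linarith)

lemma fejer_mul_sq_le (u : ℝ) : fejer u * (π * u) ^ 2 ≤ 1 := by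
  rcases eq_or_ne (π * u) 0 with h | h
  · simp [h]
  · rw [fejer, sinc_of_ne_zero h, div_pow, div_mul_cancel₀ _ (pow_ne_zero 2 h)]
    exact sin_sq_le_one _

lemma fejer_le_one (u : ℝ) : fejer u ≤ 1 := by
  rw [fejer, sq_le_one_iff_abs_le_one]
  exact abs_sinc_le_one _

lemma integrable_fejer : Integrable fejer := by
  refine (integrable_inv_one_add_sq.const_mul 2).mono' continuous_fejer.aestronglyMeasurable
    (ae_of_all _ fun u ↦ ?_)
  rw [norm_of_nonneg (fejer_nonneg u), ← div_eq_mul_inv, le_div_iff₀ (by positivity)]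
  have h1 := fejer_mul_sq_le u
  have h2 := fejer_le_one u
  have h3 : fejer u * u ^ 2 ≤ fejer u * (π * u) ^ 2 := by
    refine mul_le_mul_of_nonneg_left ?_ (fejer_nonneg u)
    rw [mul_pow]
    have : (1 : ℝ) ≤ π ^ 2 := one_le_pow₀ (by linarith [pi_gt_three])
    nlinarith [sq_nonneg u]
  linarith

lemma integral_even_mul_sin {g : ℝ → ℝ} (hg : ∀ v, g (-v) = g v) (c : ℝ) :
    ∫ v, g v * sin (c * v) = 0 := by
  have h := integral_neg_eq_self (fun v ↦ g v * sin (c * v)) volume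
  simp only [hg, mul_neg, sin_neg, integral_neg] at h
  linarith

lemma integrable_mul_cos {g : ℝ → ℝ} (hi : Integrable g) (c φ : ℝ) :
    Integrable fun v ↦ g v * cos (c * v + φ) :=
  hi.mul_bdd (c := 1) (by fun_prop) (ae_of_all _ fun v ↦ by simpa using abs_cos_le_one _)

lemma integrable_mul_sin {g : ℝ → ℝ} (hi : Integrable g) (c : ℝ) :
    Integrable fun v ↦ g v * sin (c * v) :=
  hi.mul_bdd (c := 1) (by fun_prop) (ae_of_all _ fun v ↦ by simpa using abs_sin_le_one _)

lemma integral_exp_mul_even {g : ℝ → ℝ} (hg : ∀ v, g (-v) = g v) (hi : Integrable g) (c : ℝ) :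
    ∫ v : ℝ, Complex.exp (↑(c * v) * Complex.I) • (g v : ℂ) = ↑(∫ v, g v * cos (c * v)) := by
  have h : ∀ v : ℝ, Complex.exp (↑(c * v) * Complex.I) • (g v : ℂ) =
      ↑(g v * cos (c * v)) + ↑(g v * sin (c * v)) * Complex.I := fun v ↦ by
    rw [Complex.exp_mul_I, smul_eq_mul]
    push_cast
    ring
  simp_rw [h]
  have hc : Integrable fun v ↦ ((g v * cos (c * v) : ℝ) : ℂ) := by
    have h := (integrable_mul_cos hi c 0).ofReal (𝕜 := ℂ)
    simp only [add_zero] at h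
    exact h
  have hs := ((integrable_mul_sin hi c).ofReal (𝕜 := ℂ)).mul_const Complex.I
  have h0 : ∫ v, ((g v * sin (c * v) : ℝ) : ℂ) = 0 := by
    rw [integral_complex_ofReal, integral_even_mul_sin hg, Complex.ofReal_zero]
  refine (integral_add hc hs).trans ?_
  rw [integral_mul_const, integral_complex_ofReal]
  erw [h0]
  simp

lemma integrable_triangle : Integrable triangle := by
  refine continuous_triangle.integrable_of_hasCompactSupport ?_
  refine HasCompactSupport.intro (isCompact_Icc (a := (-1 : ℝ)) (b := 1)) fun y hy ↦ ?_
  refine triangle_eq_zero ?_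
  by_contra! h
  exact hy ⟨by linarith [neg_abs_le y], by linarith [le_abs_self y]⟩

lemma intervalIntegral_one_sub_mul_cos (u : ℝ) :
    ∫ y in (0 : ℝ)..1, (1 - y) * cos (2 * π * u * y) = fejer u / 2 := by
  rcases eq_or_ne u 0 with rfl | hu
  · rw [intervalIntegral.integral_congr (g := fun y ↦ 1 - y) (by intro y _; simp)]
    rw [intervalIntegral.integral_sub (by simp) (by simp)]
    norm_num [fejer]
  · have hb : π * u ≠ 0 := mul_ne_zero pi_ne_zero hu
    have hd : ∀ y ∈ Set.uIcc (0 : ℝ) 1, HasDerivAt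
        (fun y ↦ (1 - y) * sin (2 * π * u * y) / (2 * π * u) -
          cos (2 * π * u * y) / (2 * π * u) ^ 2) ((1 - y) * cos (2 * π * u * y)) y := fun y _ ↦ by
      have hl : HasDerivAt (fun y ↦ 2 * π * u * y) (2 * π * u) y := by
        simpa using (hasDerivAt_id y).const_mul (2 * π * u)
      convert! ((((hasDerivAt_id y).const_sub 1).mul hl.sin).div_const (2 * π * u)).sub
        (hl.cos.div_const ((2 * π * u) ^ 2)) using 1
      simp only [id]
      field_simp
      ring
    rw [intervalIntegral.integral_eq_sub_of_hasDerivAt hd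
      (Continuous.intervalIntegrable (by fun_prop) _ _), fejer, sinc_of_ne_zero hb]
    have h2 : cos (2 * π * u) = 1 - 2 * sin (π * u) ^ 2 := by
      rw [show 2 * π * u = 2 * (π * u) by ring, cos_two_mul, cos_sq']
      ring
    simp only [mul_one, mul_zero, sin_zero, cos_zero, h2]
    field_simp
    ring

lemma integral_triangle_mul_cos (u : ℝ) :
    ∫ y, triangle y * cos (2 * π * u * y) = fejer u := by
  have h : ∀ y : ℝ, triangle y * cos (2 * π * u * y) =
      (fun y ↦ triangle y * cos (2 * π * u * y)) |y| := fun y ↦ by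
    rcases abs_choice y with h | h <;> simp [h, triangle_neg]
  rw [integral_congr_ae (ae_of_all _ h),
    integral_comp_abs (f := fun y ↦ triangle y * cos (2 * π * u * y))]
  have h0 : ∫ y in Set.Ioi (0 : ℝ), triangle y * cos (2 * π * u * y) =
      ∫ y in Set.Ioc (0 : ℝ) 1, (1 - y) * cos (2 * π * u * y) := by
    rw [setIntegral_eq_of_subset_of_forall_sdiff_eq_zero (s := Set.Ioc 0 1) measurableSet_Ioi
      Set.Ioc_subset_Ioi_self]
    · refine setIntegral_congr_fun measurableSet_Ioc fun y hy ↦ ?_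
      simp only [triangle, abs_of_pos hy.1, max_eq_right (sub_nonneg.2 hy.2)]
    · rintro y ⟨hy, hy'⟩
      have h0 : 0 < y := hy
      have : 1 ≤ |y| := by
        rw [abs_of_pos h0]
        by_contra! h
        exact hy' ⟨h0, h.le⟩
      simp [triangle_eq_zero this]
  rw [h0, ← intervalIntegral.integral_of_le zero_le_one, intervalIntegral_one_sub_mul_cos]
  ring

lemma integral_fejer_mul_cos (y : ℝ) :
    ∫ u, fejer u * cos (2 * π * y * u) = triangle y := by
  have hF : 𝓕 (fun y ↦ (triangle y : ℂ)) = fun u ↦ (fejer u : ℂ) := by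
    ext u
    have h := integral_exp_mul_even triangle_neg integrable_triangle (-2 * π * u)
    rw [Real.fourier_real_eq_integral_exp_smul, ← integral_triangle_mul_cos u]
    convert! h using 3
    · congr 3
      ring_nf
    · ext v
      rw [← cos_neg]
      congr 2
      ring
  have hinv := Continuous.fourierInv_fourier_eq
    (Complex.continuous_ofReal.comp continuous_triangle) integrable_triangle.ofReal
    (by simp only [Function.comp_def, hF]; exact integrable_fejer.ofReal)
  have h := congrFun hinv y
  have h' := integral_exp_mul_even fejer_neg integrable_fejer (2 * π * y)
  simp only [Function.comp_def, hF] at h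
  rw [Real.fourierInv_eq'] at h
  rw [← Complex.ofReal_inj, ← h, ← h']
  congr 1
  ext v
  congr 4
  simp
  ring

lemma integral_scaled_fejer_mul_cos {a : ℝ} (ha : 0 < a) (y φ : ℝ) :
    ∫ u, a * fejer (a * u) * cos (2 * π * y * u + φ) = triangle (y / a) * cos φ := by
  have h1 : ∀ u, a * fejer (a * u) * cos (2 * π * y * u + φ) =
      a * (fun v ↦ fejer v * cos (2 * π * (y / a) * v + φ)) (a * u) := fun u ↦ by
    rw [mul_assoc, show 2 * π * y * u = 2 * π * (y / a) * (a * u) by field_simp]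
  simp_rw [h1]
  rw [integral_const_mul,
    Measure.integral_comp_mul_left (fun v ↦ fejer v * cos (2 * π * (y / a) * v + φ)) a,
    abs_of_pos (inv_pos.2 ha), smul_eq_mul, mul_inv_cancel_left₀ ha.ne']
  simp_rw [cos_add, mul_sub, ← mul_assoc]
  rw [integral_sub, integral_mul_const, integral_mul_const, integral_fejer_mul_cos,
    integral_even_mul_sin fejer_neg]
  · ring
  · simpa using (integrable_mul_cos integrable_fejer _ 0).mul_const _
  · exact (integrable_mul_sin integrable_fejer _).mul_const _

lemma integrable_scaled_fejer {a : ℝ} (ha : 0 < a) : Integrable fun u ↦ a * fejer (a * u) :=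
  (integrable_fejer.comp_mul_left' ha.ne').const_mul a

lemma integral_scaled_fejer {a : ℝ} (ha : 0 < a) : ∫ u, a * fejer (a * u) = 1 := by
  simpa [triangle] using integral_scaled_fejer_mul_cos ha 0 0

lemma scaled_fejer_le {a : ℝ} (ha : 0 < a) {u : ℝ} (hu : u ≠ 0) :
    a * fejer (a * u) ≤ 1 / (π ^ 2 * a) * (u ^ 2)⁻¹ := by
  have h := fejer_mul_sq_le (a * u)
  have : 0 < u ^ 2 := by positivity
  rw [← div_eq_mul_inv, div_div, le_div_iff₀ (by positivity)]
  calc _ = _ := by ring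
    _ ≤ 1 := h

/-- A function dominated by `s` times a scaled Fejér kernel near the origin, and by `s + C` times
it elsewhere, has integral at most `s` plus `C` times the tail mass of the kernel. -/
lemma integral_le_of_le_scaled_fejer {a R C s : ℝ} (ha : 0 < a) (hR : 0 < R) (hC : 0 ≤ C)
    {g : ℝ → ℝ} (hg : Integrable g)
    (h1 : ∀ u, |u| ≤ R → g u ≤ a * fejer (a * u) * s)
    (h2 : ∀ u, R < |u| → g u ≤ a * fejer (a * u) * (s + C)) :
    ∫ u, g u ≤ s + C * (2 / (π ^ 2 * a * R)) := by
  set τ : ℝ → ℝ := (Set.Ioi R).indicator fun u ↦ u ^ (-2 : ℝ) with hτ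
  have hτv : ∫ u, τ |u| = 2 / R := by
    rw [integral_comp_abs, hτ, setIntegral_indicator measurableSet_Ioi,
      Set.inter_eq_self_of_subset_right (Set.Ioi_subset_Ioi hR.le),
      integral_Ioi_rpow_of_lt (by norm_num) hR]
    norm_num [rpow_neg_one]
    rfl
  have hτi : Integrable fun u ↦ τ |u| :=
    not_imp_comm.1 integral_undef (hτv.trans_ne (by positivity))
  calc ∫ u, g u ≤ ∫ u, (a * fejer (a * u) * s + C * (1 / (π ^ 2 * a)) * τ |u|) := by
        refine integral_mono hg (((integrable_scaled_fejer ha).mul_const s).add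
          (hτi.const_mul _)) fun u ↦ ?_
        simp only [hτ, Set.indicator_apply, Set.mem_Ioi]
        split_ifs with h
        · have hu : u ≠ 0 := abs_pos.1 (hR.trans h)
          have hb := mul_le_mul_of_nonneg_left (scaled_fejer_le ha hu) hC
          have e : |u| ^ (-2 : ℝ) = (u ^ 2)⁻¹ := by
            rw [rpow_neg (abs_nonneg u)]
            norm_num
          have := h2 u h
          rw [e]
          linarith
        · simpa using h1 u (not_lt.1 h)
    _ = _ := by
        rw [integral_add ((integrable_scaled_fejer ha).mul_const s) (hτi.const_mul _),
          integral_mul_const, integral_scaled_fejer ha, integral_const_mul, hτv]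
        field_simp

/-- Dirichlet's theorem on simultaneous Diophantine approximation. -/
lemma exists_nat_simultaneous_approx {ι : Type*} (s : Finset ι) (α : ι → ℝ) {q : ℕ} (hq : 0 < q) :
    ∃ j : ℕ, 1 ≤ j ∧ j ≤ q ^ s.card ∧ ∀ i ∈ s, ∃ z : ℤ, |j * α i - z| ≤ 1 / q := by
  classical
  have hq' : (0 : ℝ) < q := Nat.cast_pos.2 hq
  let F : ℕ → s → ℕ := fun j i ↦ ⌊Int.fract (j * α i) * q⌋₊
  obtain ⟨a, ha, b, hb, hab, hF⟩ := Finset.exists_ne_map_eq_of_card_lt_of_maps_to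
    (s := Finset.range (q ^ s.card + 1)) (t := Fintype.piFinset fun _ : s ↦ Finset.range q)
    (f := F) (by simp) (by
      intro j _
      simp only [Finset.mem_coe, Fintype.mem_piFinset, Finset.mem_range, F]
      intro i
      rw [Nat.floor_lt (mul_nonneg (Int.fract_nonneg _) hq'.le)]
      exact mul_lt_of_lt_one_left hq' (Int.fract_lt_one _))
  wlog h : a < b generalizing a b
  · exact this b hb a ha hab.symm hF.symm (lt_of_le_of_ne (not_lt.1 h) hab.symm)
  rw [Finset.mem_range] at hb
  refine ⟨b - a, by omega, by omega, fun i hi ↦ ⟨⌊b * α i⌋ - ⌊a * α i⌋, ?_⟩⟩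
  have hi' : ⌊Int.fract (a * α i) * q⌋₊ = ⌊Int.fract (b * α i) * q⌋₊ := congrFun hF ⟨i, hi⟩
  have ha1 := Nat.floor_le (mul_nonneg (Int.fract_nonneg (a * α i)) hq'.le)
  have hb1 := Nat.floor_le (mul_nonneg (Int.fract_nonneg (b * α i)) hq'.le)
  have ha2 := Nat.lt_floor_add_one (Int.fract (a * α i) * q)
  have hb2 := Nat.lt_floor_add_one (Int.fract (b * α i) * q)
  rw [hi'] at ha1 ha2
  have e : ((b - a : ℕ) : ℝ) * α i - ((⌊b * α i⌋ - ⌊a * α i⌋ : ℤ) : ℝ) =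
      Int.fract (b * α i) - Int.fract (a * α i) := by
    rw [Nat.cast_sub h.le, Int.fract, Int.fract]
    push_cast
    ring
  rw [e, abs_le, ← neg_div, div_le_iff₀ hq', le_div_iff₀ hq']
  constructor <;> linarith

lemma sum_cos_sub_eq (L : ℕ) (θ : ℝ) :
    ∑ p ∈ Finset.range L ×ˢ Finset.range L, cos (((p.1 : ℝ) - p.2) * θ) =
      (∑ j ∈ Finset.range L, cos (j * θ)) ^ 2 + (∑ j ∈ Finset.range L, sin (j * θ)) ^ 2 := by
  rw [Finset.sum_product, sq, sq, Finset.sum_mul_sum, Finset.sum_mul_sum, ← Finset.sum_add_distrib]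
  refine Finset.sum_congr rfl fun i _ ↦ ?_
  rw [← Finset.sum_add_distrib]
  refine Finset.sum_congr rfl fun j _ ↦ ?_
  rw [sub_mul, cos_sub]

lemma sum_offDiag_cos_sub_eq (L : ℕ) (θ : ℝ) :
    ∑ p ∈ (Finset.range L).offDiag, cos (((p.1 : ℝ) - p.2) * θ) =
      (∑ j ∈ Finset.range L, cos (j * θ)) ^ 2 + (∑ j ∈ Finset.range L, sin (j * θ)) ^ 2 - L := by
  rw [← sum_cos_sub_eq, ← Finset.diag_union_offDiag,
    Finset.sum_union (Finset.disjoint_diag_offDiag _), Finset.sum_diag]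
  simp

lemma half_le_cos_of_approx {L : ℕ} (hL : 0 < L) {x : ℝ} {z : ℤ}
    (hx : |x - z| ≤ 1 / (6 * L : ℕ)) {j k : ℕ} (hj : j < L) (hk : k < L) :
    1 / 2 ≤ cos (((j : ℝ) - k) * (2 * π * x)) := by
  have hL' : (0 : ℝ) < L := Nat.cast_pos.2 hL
  have e : cos (((j : ℝ) - k) * (2 * π * x)) = cos |((j : ℝ) - k) * (2 * π * (x - z))| := by
    rw [cos_abs, ← cos_sub_int_mul_two_pi _ (((j : ℤ) - k) * z)]
    congr 1
    push_cast
    ring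
  have h1 : |(j : ℝ) - k| ≤ L := by
    have : (j : ℝ) < L := Nat.cast_lt.2 hj
    have : (k : ℝ) < L := Nat.cast_lt.2 hk
    rw [abs_le]
    constructor <;> linarith [j.cast_nonneg (α := ℝ), k.cast_nonneg (α := ℝ)]
  rw [e, ← cos_pi_div_three]
  refine cos_le_cos_of_nonneg_of_le_pi (abs_nonneg _) (by linarith [pi_pos]) ?_
  rw [abs_mul, abs_mul, abs_of_pos two_pi_pos]
  calc _ ≤ (L : ℝ) * (2 * π * (1 / (6 * L : ℕ))) := by gcongr
    _ = π / 3 := by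
      push_cast
      field_simp
      norm_num

/-- A cosine series with nonnegative coefficients takes a large value at some bounded multiple of a
simultaneous approximation denominator of the frequencies in `M`. -/
lemma exists_large_cos_sum {ι : Type*} {b lam : ι → ℝ} (hb : ∀ n, 0 ≤ b n) (hs : Summable b)
    {L : ℕ} (hL : 2 ≤ L) (M : Finset ι) {T : ℝ} (hT : 0 < T) :
    ∃ x : ℝ, T ≤ x ∧ x ≤ (L - 1 : ℝ) * ((6 * L : ℝ) ^ M.card * T) ∧
      1 / 2 * ∑ m ∈ M, b m - 1 / (L - 1 : ℝ) * ∑' n, b n ≤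
        ∑' n, b n * cos (2 * π * lam n * x) := by
  have hL1 : (1 : ℝ) ≤ L - 1 := by
    have : (2 : ℝ) ≤ L := by exact_mod_cast hL
    linarith
  obtain ⟨q, hq1, hq2, hq⟩ := exists_nat_simultaneous_approx M (fun n ↦ T * lam n)
    (q := 6 * L) (by omega)
  set H : ℝ → ℝ := fun x ↦ ∑' n, b n * cos (2 * π * lam n * x) with hH
  have hHs : ∀ x, Summable fun n ↦ b n * cos (2 * π * lam n * x) := fun x ↦
    hs.of_norm_bounded fun n ↦ by
      rw [norm_mul, norm_of_nonneg (hb n)]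
      exact mul_le_of_le_one_right (hb n) (abs_cos_le_one _)
  have hHneg : ∀ x, H (-x) = H x := fun x ↦ by simp [hH]
  set D : ι → ℝ := fun n ↦ ∑ p ∈ (Finset.range L).offDiag,
    cos (((p.1 : ℝ) - p.2) * (2 * π * (q * (T * lam n)))) with hD
  have hsum : HasSum (fun n ↦ b n * D n)
      (∑ p ∈ (Finset.range L).offDiag, H (((p.1 : ℝ) - p.2) * (q * T))) := by
    convert! hasSum_sum (s := (Finset.range L).offDiag) fun p _ ↦
      (hHs (((p.1 : ℝ) - p.2) * (q * T))).hasSum using 2 with n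
    rw [hD, Finset.mul_sum]
    refine Finset.sum_congr rfl fun p _ ↦ ?_
    congr 2
    ring
  have hDL : ∀ n, 0 ≤ D n + L := fun n ↦ by
    simp only [hD, sum_offDiag_cos_sub_eq]
    linarith [sq_nonneg (∑ j ∈ Finset.range L, cos (j * (2 * π * (q * (T * lam n))))),
      sq_nonneg (∑ j ∈ Finset.range L, sin (j * (2 * π * (q * (T * lam n)))))]
  have hcard : (((Finset.range L).offDiag.card : ℕ) : ℝ) = L * (L - 1) := by
    rw [Finset.offDiag_card, Finset.card_range, Nat.cast_sub (Nat.le_mul_self L)]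
    push_cast
    ring
  have hDM : ∀ m ∈ M, (L * (L - 1) : ℝ) / 2 ≤ D m + L := fun m hm ↦ by
    obtain ⟨z, hz⟩ := hq m hm
    have : ∑ p ∈ (Finset.range L).offDiag, (1 / 2 : ℝ) ≤ D m :=
      Finset.sum_le_sum fun p hp ↦ by
        simp only [Finset.mem_offDiag, Finset.mem_range] at hp
        exact half_le_cos_of_approx (by omega) hz hp.1 hp.2.1
    rw [Finset.sum_const, nsmul_eq_mul, hcard] at this
    linarith
  have hsum' : HasSum (fun n ↦ b n * (D n + L))
      (∑ p ∈ (Finset.range L).offDiag, H (((p.1 : ℝ) - p.2) * (q * T)) + (∑' n, b n) * L) := by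
    simpa only [mul_add] using hsum.add (hs.hasSum.mul_right (L : ℝ))
  have hlow : (L * (L - 1) : ℝ) / 2 * ∑ m ∈ M, b m ≤
      ∑ p ∈ (Finset.range L).offDiag, H (((p.1 : ℝ) - p.2) * (q * T)) + (∑' n, b n) * L := by
    refine le_trans ?_ (sum_le_hasSum M (fun n _ ↦ mul_nonneg (hb n) (hDL n)) hsum')
    rw [Finset.mul_sum]
    refine Finset.sum_le_sum fun m hm ↦ ?_
    rw [mul_comm]
    exact mul_le_mul_of_nonneg_left (hDM m hm) (hb m)
  obtain ⟨p, hp, hpH⟩ : ∃ p ∈ (Finset.range L).offDiag,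
      1 / 2 * ∑ m ∈ M, b m - 1 / (L - 1 : ℝ) * ∑' n, b n ≤ H (((p.1 : ℝ) - p.2) * (q * T)) := by
    refine Finset.exists_le_of_sum_le ⟨(0, 1), by
      simp only [Finset.mem_offDiag, Finset.mem_range]
      omega⟩ ?_
    rw [Finset.sum_const, nsmul_eq_mul, hcard]
    have : (L : ℝ) * (L - 1) * (1 / 2 * ∑ m ∈ M, b m - 1 / (L - 1 : ℝ) * ∑' n, b n) =
        (L * (L - 1) : ℝ) / 2 * ∑ m ∈ M, b m - (∑' n, b n) * L := by
      field_simp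
    linarith
  simp only [Finset.mem_offDiag, Finset.mem_range] at hp
  obtain ⟨j, k⟩ := p
  simp only at hp hpH
  wlog hjk : k < j generalizing j k
  · refine this k j ?_ ⟨hp.2.1, hp.1, hp.2.2.symm⟩ (lt_of_le_of_ne (not_lt.1 hjk) hp.2.2)
    rwa [← hHneg, ← neg_mul, neg_sub]
  have hq1' : (1 : ℝ) ≤ q := by exact_mod_cast hq1
  have hq2' : (q : ℝ) ≤ (6 * L : ℝ) ^ M.card := by exact_mod_cast hq2
  have h1 : (1 : ℝ) ≤ j - k := by
    have : (k : ℝ) + 1 ≤ j := by exact_mod_cast hjk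
    linarith
  have h2 : (j : ℝ) - k ≤ L - 1 := by
    have : (j : ℝ) + 1 ≤ L := by exact_mod_cast hp.1
    linarith [k.cast_nonneg (α := ℝ)]
  refine ⟨((j : ℝ) - k) * (q * T), ?_, by gcongr, hpH⟩
  calc T = 1 * (1 * T) := by ring
    _ ≤ _ := by gcongr

/-- Integrating a cosine series against a kernel that acts diagonally on its terms. -/
lemma integral_mul_cos_series {ι : Type*} [Countable ι] {f lam c : ι → ℝ} (hf : ∀ n, 0 ≤ f n)
    (hs : Summable f) {γ x : ℝ} {w : ℝ → ℝ} (hw : Integrable w)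
    (hc : ∀ n, ∫ u, w u * cos (2 * π * lam n * (x + u) + γ) = c n * cos (2 * π * lam n * x)) :
    ∫ u, w u * ∑' n, f n * cos (2 * π * lam n * (x + u) + γ) =
      ∑' n, f n * c n * cos (2 * π * lam n * x) := by
  have hi : ∀ n, Integrable fun u ↦ f n * (w u * cos (2 * π * lam n * (x + u) + γ)) := fun n ↦ by
    simp_rw [mul_add, add_assoc, add_comm (2 * π * lam n * x), add_assoc]
    simpa [add_assoc, add_comm, add_left_comm] using
      (integrable_mul_cos hw (2 * π * lam n) (γ + 2 * π * lam n * x)).const_mul (f n)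
  have h := hasSum_integral_of_summable_integral_norm hi (by
    refine (hs.mul_right (∫ u, ‖w u‖)).of_nonneg_of_le
      (fun n ↦ integral_nonneg fun u ↦ norm_nonneg _) fun n ↦ ?_
    rw [← integral_const_mul]
    refine integral_mono (hi n).norm (hw.norm.const_mul _) fun u ↦ ?_
    simp only [norm_mul, norm_of_nonneg (hf n)]
    exact mul_le_mul_of_nonneg_left (mul_le_of_le_one_right (norm_nonneg _) (abs_cos_le_one _))
      (hf n))
  simp_rw [integral_const_mul, hc, ← mul_assoc] at h
  rw [h.tsum_eq]
  congr 1 with u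
  rw [← tsum_mul_left]
  congr 1 with n
  ring

lemma exists_large_weighted_cos_sum {ι : Type*} {f lam c : ι → ℝ} (hf : ∀ n, 0 ≤ f n)
    (hs : Summable f) {L : ℕ} (hL : 2 ≤ L) (M : Finset ι) {T Λ : ℝ} (hT : 0 < T)
    (hc0 : ∀ n, 0 ≤ c n) (hc1 : ∀ n, c n ≤ 1) (hc2 : ∀ n, Λ < lam n → c n = 0)
    (hcM : ∀ m ∈ M, 1 / 4 ≤ c m) :
    ∃ x : ℝ, T ≤ x ∧ x ≤ (L - 1 : ℝ) * ((6 * L : ℝ) ^ M.card * T) ∧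
      1 / 8 * ∑ m ∈ M, f m - 1 / (L - 1 : ℝ) * ∑' n : {n // lam n ≤ Λ}, f n ≤
        ∑' n, f n * c n * cos (2 * π * lam n * x) := by
  have hL1 : (0 : ℝ) < L - 1 := by
    have : (2 : ℝ) ≤ L := by exact_mod_cast hL
    linarith
  have hb : ∀ n, 0 ≤ f n * c n := fun n ↦ mul_nonneg (hf n) (hc0 n)
  have hbs : Summable fun n ↦ f n * c n :=
    hs.of_nonneg_of_le hb fun n ↦ mul_le_of_le_one_right (hf n) (hc1 n)
  obtain ⟨x, hx1, hx2, hx⟩ := exists_large_cos_sum (lam := lam) hb hbs hL M hT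
  refine ⟨x, hx1, hx2, le_trans (sub_le_sub ?_ ?_) hx⟩
  · rw [Finset.mul_sum, Finset.mul_sum]
    refine Finset.sum_le_sum fun m hm ↦ ?_
    linarith [mul_le_mul_of_nonneg_left (hcM m hm) (hf m)]
  · refine mul_le_mul_of_nonneg_left ?_ (by positivity)
    have e : ∑' n : {n // lam n ≤ Λ}, f n = ∑' n, {n | lam n ≤ Λ}.indicator f n :=
      tsum_subtype {n | lam n ≤ Λ} f
    rw [e]
    refine hbs.tsum_le_tsum (fun n ↦ ?_) (hs.indicator _)
    simp only [Set.indicator_apply, Set.mem_ofPred_eq]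
    split_ifs with h
    · exact mul_le_of_le_one_right (hf n) (hc1 n)
    · rw [hc2 n (not_le.1 h), mul_zero]

lemma add_mem_Icc_of_abs_le {L k : ℕ} (hL : 2 ≤ L) {T x u : ℝ} (hT : 0 < T) (hx1 : T ≤ x)
    (hx2 : x ≤ (L - 1 : ℝ) * ((6 * L : ℝ) ^ k * T)) (hu : |u| ≤ T / 2) :
    x + u ∈ Set.Icc (T / 2) ((6 * L : ℝ) ^ (k + 1) * T) := by
  have hL' : (2 : ℝ) ≤ L := by exact_mod_cast hL
  have hp : (1 : ℝ) ≤ (6 * L : ℝ) ^ k := one_le_pow₀ (by linarith)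
  have hpT : T ≤ (6 * L : ℝ) ^ k * T := le_mul_of_one_le_left hT.le hp
  obtain ⟨hu1, hu2⟩ := abs_le.1 hu
  refine ⟨by linarith, ?_⟩
  rw [pow_succ]
  nlinarith

theorem soundararajan_lemma
    (f lam : ℕ+ → ℝ)
    (hf : ∀ n, 0 ≤ f n) (hlam : ∀ n, 0 ≤ lam n)
    (hmono : Monotone lam)
    (hsum : Summable f)
    (L : ℕ) (hL : 2 ≤ L)
    (Y : ℕ+) (hY : 0 < lam Y)
    (γ : ℝ)
    (S : ℝ → ℝ)
    (hS : ∀ t : ℝ, S t = ∑' n : ℕ+, f n * Real.cos (2 * Real.pi * lam n * t + γ))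
    (M : Finset ℕ+)
    (hM : ∀ m ∈ M, lam Y / 2 ≤ lam m ∧ lam m ≤ 3 * lam Y / 2)
    (T : ℝ) (hT : 2 ≤ T) :
    (∃ t : ℝ, t ∈ Set.Icc (T / 2) ((6 * L : ℝ) ^ (M.card + 1) * T) ∧
      |S t| ≥ (1 / 8) * ∑ m ∈ M, f m
        - (1 / (L - 1 : ℝ)) * ∑' n : {n : ℕ+ // lam n ≤ 2 * lam Y}, f n
        - (4 / (Real.pi ^ 2 * T * lam Y)) * ∑' n : ℕ+, f n) ∧
    (∀ w : ℤ, γ = w * Real.pi →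
      ∃ t : ℝ, t ∈ Set.Icc (T / 2) ((6 * L : ℝ) ^ (M.card + 1) * T) ∧
        (-1 : ℝ) ^ w * S t ≥ (1 / 8) * ∑ m ∈ M, f m
          - (1 / (L - 1 : ℝ)) * ∑' n : {n : ℕ+ // lam n ≤ 2 * lam Y}, f n
          - (4 / (Real.pi ^ 2 * T * lam Y)) * ∑' n : ℕ+, f n) := by
  have hT0 : 0 < T := by linarith
  have hterm : ∀ n t, ‖f n * cos (2 * π * lam n * t + γ)‖ ≤ f n := fun n t ↦ by
    rw [norm_mul, norm_of_nonneg (hf n)]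
    exact mul_le_of_le_one_right (hf n) (abs_cos_le_one _)
  have hScont : Continuous S := by
    rw [funext hS]
    exact continuous_tsum (fun n ↦ by fun_prop) hsum hterm
  have hSle : ∀ t, |S t| ≤ ∑' n, f n := fun t ↦ by
    rw [hS]
    exact tsum_of_norm_bounded hsum.hasSum (hterm · t)
  have hSx : ∀ x, Continuous fun u ↦ S (x + u) := fun x ↦
    hScont.comp (continuous_const.add continuous_id)
  have hF : 0 ≤ ∑' n, f n := tsum_nonneg hf
  have hint : ∀ {w : ℝ → ℝ} (x : ℝ), Integrable w → Integrable fun u ↦ w u * S (x + u) :=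
    fun {w} x hw ↦ hw.mul_bdd (hSx x).aestronglyMeasurable (ae_of_all _ fun u ↦ hSle (x + u))
  constructor
  · obtain ⟨x, hx1, hx2, hx⟩ := exists_large_weighted_cos_sum hf hsum hL M hT0
      (lam := lam) (Λ := 2 * lam Y) (c := fun n ↦ triangle ((lam n - lam Y) / lam Y) / 2)
      (fun n ↦ by linarith [triangle_nonneg ((lam n - lam Y) / lam Y)])
      (fun n ↦ by linarith [triangle_le_one ((lam n - lam Y) / lam Y)])
      (fun n hn ↦ by
        rw [triangle_eq_zero, zero_div]
        rw [abs_div, abs_of_pos hY, le_div_iff₀ hY]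
        exact le_trans (by linarith) (le_abs_self _))
      (fun m hm ↦ by
        have : |(lam m - lam Y) / lam Y| ≤ 1 / 2 := by
          rw [abs_div, abs_of_pos hY, div_le_iff₀ hY, abs_le]
          constructor <;> linarith [hM m hm]
        have := le_max_right 0 (1 - |(lam m - lam Y) / lam Y|)
        rw [← triangle] at this
        linarith)
    have hK := integrable_scaled_fejer hY
    have hconv := integral_mul_cos_series (γ := γ) (x := x) (lam := lam) hf hsum
      (c := fun n ↦ triangle ((lam n - lam Y) / lam Y) / 2)
      (integrable_mul_cos hK (2 * π * lam Y) γ) (fun n ↦ by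
        have e : ∀ u, lam Y * fejer (lam Y * u) * cos (2 * π * lam Y * u + γ) *
            cos (2 * π * lam n * (x + u) + γ) =
            (lam Y * fejer (lam Y * u) * cos (2 * π * (lam n - lam Y) * u + 2 * π * lam n * x) +
            lam Y * fejer (lam Y * u) *
              cos (2 * π * (lam n + lam Y) * u + (2 * π * lam n * x + 2 * γ))) / 2 := fun u ↦ by
          have h (A B : ℝ) : cos B * cos A = (cos (A - B) + cos (A + B)) / 2 := by
            rw [cos_sub, cos_add]
            ring
          rw [mul_assoc, ← mul_add, mul_div_assoc, h]
          congr 4 <;> ring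
        simp_rw [e]
        rw [integral_div, integral_add (integrable_mul_cos hK _ _) (integrable_mul_cos hK _ _),
          integral_scaled_fejer_mul_cos hY, integral_scaled_fejer_mul_cos hY,
          triangle_eq_zero (y := (lam n + lam Y) / lam Y)]
        · ring
        · rw [abs_div, abs_of_pos hY, le_div_iff₀ hY]
          exact le_trans (by linarith [hlam n]) (le_abs_self _))
    simp_rw [← hS] at hconv
    obtain ⟨v, hv, hmax⟩ := (isCompact_Icc (a := -(T / 2)) (b := T / 2)).exists_isMaxOn
      ⟨0, by constructor <;> linarith⟩
      (hSx x).abs.continuousOn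
    have hw : ∀ u, lam Y * fejer (lam Y * u) * cos (2 * π * lam Y * u + γ) * S (x + u) ≤
        lam Y * fejer (lam Y * u) * |S (x + u)| := fun u ↦ by
      rw [mul_assoc]
      refine mul_le_mul_of_nonneg_left ?_ (mul_nonneg hY.le (fejer_nonneg _))
      refine (le_abs_self _).trans ?_
      rw [abs_mul]
      exact mul_le_of_le_one_left (abs_nonneg _) (abs_cos_le_one _)
    have hle := integral_le_of_le_scaled_fejer (s := |S (x + v)|) hY (half_pos hT0) hF
      (hint x (integrable_mul_cos hK _ _))
      (fun u hu ↦ (hw u).trans (mul_le_mul_of_nonneg_left (hmax (abs_le.1 hu))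
        (mul_nonneg hY.le (fejer_nonneg _))))
      (fun u _ ↦ (hw u).trans (mul_le_mul_of_nonneg_left
        (by linarith [hSle (x + u), abs_nonneg (S (x + v))])
        (mul_nonneg hY.le (fejer_nonneg _))))
    refine ⟨x + v, add_mem_Icc_of_abs_le hL hT0 hx1 hx2 (abs_le.2 hv), ?_⟩
    have e : (∑' n, f n) * (2 / (π ^ 2 * lam Y * (T / 2))) =
        4 / (π ^ 2 * T * lam Y) * ∑' n, f n := by
      field_simp
      norm_num
    rw [hconv, e] at hle
    linarith
  · rintro w rfl
    have hσ : |(-1 : ℝ) ^ w| = 1 := by rw [abs_zpow]; simp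
    have hσ' : (-1 : ℝ) ^ w * (-1 : ℝ) ^ w = 1 := by rw [← abs_mul_abs_self, hσ, one_mul]
    have h2Y : 0 < 2 * lam Y := by linarith
    obtain ⟨x, hx1, hx2, hx⟩ := exists_large_weighted_cos_sum hf hsum hL M hT0
      (lam := lam) (Λ := 2 * lam Y) (c := fun n ↦ triangle (lam n / (2 * lam Y)))
      (fun n ↦ triangle_nonneg _) (fun n ↦ triangle_le_one _)
      (fun n hn ↦ by
        refine triangle_eq_zero ?_
        rw [abs_div, abs_of_pos h2Y, le_div_iff₀ h2Y]
        exact le_trans (by linarith) (le_abs_self _))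
      (fun m hm ↦ by
        have : |lam m / (2 * lam Y)| ≤ 3 / 4 := by
          rw [abs_div, abs_of_pos h2Y, div_le_iff₀ h2Y, abs_of_nonneg (hlam m)]
          linarith [hM m hm]
        have := le_max_right 0 (1 - |lam m / (2 * lam Y)|)
        rw [← triangle] at this
        linarith)
    have hK := (integrable_scaled_fejer h2Y).mul_const ((-1 : ℝ) ^ w)
    have hconv := integral_mul_cos_series (γ := w * π) (x := x) (lam := lam) hf hsum
      (c := fun n ↦ triangle (lam n / (2 * lam Y))) hK (fun n ↦ by
        have e : ∀ u, 2 * lam Y * fejer (2 * lam Y * u) * (-1 : ℝ) ^ w *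
            cos (2 * π * lam n * (x + u) + w * π) =
            2 * lam Y * fejer (2 * lam Y * u) *
              cos (2 * π * lam n * u + 2 * π * lam n * x) := fun u ↦ by
          rw [cos_add_int_mul_pi, ← mul_assoc, mul_assoc _ _ ((-1 : ℝ) ^ w), hσ', mul_one]
          congr 2
          ring
        simp_rw [e]
        rw [integral_scaled_fejer_mul_cos h2Y])
    simp_rw [← hS] at hconv
    obtain ⟨v, hv, hmax⟩ := (isCompact_Icc (a := -(T / 2)) (b := T / 2)).exists_isMaxOn
      ⟨0, by constructor <;> linarith⟩
      (f := fun u ↦ (-1 : ℝ) ^ w * S (x + u)) (continuous_const.mul (hSx x)).continuousOn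
    have hσS : ∀ t, |(-1 : ℝ) ^ w * S t| ≤ ∑' n, f n := fun t ↦ by
      rw [abs_mul, hσ, one_mul]
      exact hSle t
    have hle := integral_le_of_le_scaled_fejer (s := (-1 : ℝ) ^ w * S (x + v))
      (C := 2 * ∑' n, f n) h2Y (half_pos hT0) (by linarith) (hint x hK)
      (fun u hu ↦ by
        rw [mul_assoc]
        exact mul_le_mul_of_nonneg_left (hmax (abs_le.1 hu)) (mul_nonneg h2Y.le (fejer_nonneg _)))
      (fun u _ ↦ by
        rw [mul_assoc]
        refine mul_le_mul_of_nonneg_left ?_ (mul_nonneg h2Y.le (fejer_nonneg _))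
        linarith [(abs_le.1 (hσS (x + u))).2, (abs_le.1 (hσS (x + v))).1])
    refine ⟨x + v, add_mem_Icc_of_abs_le hL hT0 hx1 hx2 (abs_le.2 hv), ?_⟩
    have e : (2 * ∑' n, f n) * (2 / (π ^ 2 * (2 * lam Y) * (T / 2))) =
        4 / (π ^ 2 * T * lam Y) * ∑' n, f n := by
      field_simp
      ring
    rw [hconv, e] at hle
    linarith
end
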